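/- Let 𝔐 be an R-admissible weight matrix, let U ⊆ ℝ^d be open, and let j be a positive integer. If f : U → ℂ is a function such that f^j and f^{j+1} belong to the Roumieu class E^{{𝔐}}(U), then f belongs to E^{{𝔐}}(U). -/

import Mathlib

open Set Filter Topology Metric
open scoped ENNReal NNReal Topology

noncomputable section

namespace JorisPaper

/-- The sequence `m` with `m_k = M_k / k!`. -/
def lc (M : ℕ → ℝ) (k : ℕ) : ℝ := M k / (Nat.factorial k : ℝ)

/-- A weight sequence: positive, log-convex, `M_0 = 1 ≤ M_1`, `M_k^{1/k} → ∞`. -/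
structure IsWeightSeq (M : ℕ → ℝ) : Prop where
  pos : ∀ k, 0 < M k
  first : M 0 = 1
  one_le : 1 ≤ M 1
  logconvex : ∀ k, 1 ≤ k → M k ^ 2 ≤ M (k - 1) * M (k + 1)
  root : Filter.Tendsto (fun k : ℕ => M k ^ ((1 : ℝ) / (k : ℝ))) atTop atTop

/-- `m_k^{1/k} → ∞`. -/
def RootsTendsto (m : ℕ → ℝ) : Prop :=
  Filter.Tendsto (fun k : ℕ => m k ^ ((1 : ℝ) / (k : ℝ))) atTop atTop

/-- `h_m(t) = inf_k m_k t^k` for `t > 0`, and `0` for `t ≤ 0`. -/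
def hfn (m : ℕ → ℝ) (t : ℝ) : ℝ := if t ≤ 0 then 0 else ⨅ k : ℕ, m k * t ^ k

/-- `Γ̄_m(t) = min {k | h_m(t) = m_k t^k}`. -/
def GammaUpper (m : ℕ → ℝ) (t : ℝ) : ℕ := sInf {k : ℕ | hfn m t = m k * t ^ k}

/-- `Γ̲_m(t) = min {k | m_{k+1}/m_k ≥ 1/t}`. -/
def GammaLower (m : ℕ → ℝ) (t : ℝ) : ℕ := sInf {k : ℕ | 1 / t ≤ m (k + 1) / m k}

/-- `mg(M,N) = sup_{j+k ≥ 1} (M_{j+k}/(N_j N_k))^{1/(j+k)}`, as an extended real. -/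
def mg (M N : ℕ → ℝ) : ℝ≥0∞ :=
  ⨆ (j : ℕ) (k : ℕ) (_ : 1 ≤ j + k),
    ENNReal.ofReal ((M (j + k) / (N j * N k)) ^ (((j : ℝ) + (k : ℝ))⁻¹))

/-- A weight matrix: a totally ordered (pointwise) family of weight sequences. -/
structure IsWeightMatrix (W : Set (ℕ → ℝ)) : Prop where
  weight : ∀ M ∈ W, IsWeightSeq M
  ordered : ∀ M ∈ W, ∀ N ∈ W, (∀ k, M k ≤ N k) ∨ (∀ k, N k ≤ M k)

/-- R-admissible weight matrix. -/
structure RAdmissible (W : Set (ℕ → ℝ)) : Prop where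
  matrix : IsWeightMatrix W
  roots : ∀ M ∈ W, RootsTendsto (lc M)
  gamma : ∀ M ∈ W, ∃ N ∈ W, ∃ C : ℝ, 1 ≤ C ∧
    ∀ t : ℝ, 0 < t → GammaUpper (lc N) (C * t) ≤ GammaLower (lc M) t
  mgrowth : ∀ M ∈ W, ∃ N ∈ W, mg M N < ⊤

/-- B-admissible weight matrix. -/
structure BAdmissible (W : Set (ℕ → ℝ)) : Prop where
  matrix : IsWeightMatrix W
  roots : ∀ M ∈ W, RootsTendsto (lc M)
  gamma : ∀ M ∈ W, ∃ N ∈ W, ∃ C : ℝ, 1 ≤ C ∧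
    ∀ t : ℝ, 0 < t → GammaUpper (lc M) (C * t) ≤ GammaLower (lc N) t
  mgrowth : ∀ M ∈ W, ∃ N ∈ W, mg N M < ⊤

/-- `‖f‖^M_{K,ρ} < ∞` (derivatives taken within `U`). -/
def SeqBoundedOn {E F : Type*} [NormedAddCommGroup E] [NormedSpace ℝ E]
    [NormedAddCommGroup F] [NormedSpace ℝ F]
    (M : ℕ → ℝ) (ρ : ℝ) (f : E → F) (U K : Set E) : Prop :=
  ∃ C : ℝ, ∀ x ∈ K, ∀ k : ℕ, ‖iteratedFDerivWithin ℝ k f U x‖ ≤ C * ρ ^ k * M k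

/-- `f ∈ B^M_ρ(V)`: smooth on `V` with global bounds `‖f‖^M_{V,ρ} < ∞`. -/
def GlobalClass {E F : Type*} [NormedAddCommGroup E] [NormedSpace ℝ E]
    [NormedAddCommGroup F] [NormedSpace ℝ F]
    (M : ℕ → ℝ) (ρ : ℝ) (f : E → F) (V : Set E) : Prop :=
  ContDiffOn ℝ (⊤ : ℕ∞) f V ∧ SeqBoundedOn M ρ f V V

/-- The Roumieu class `E^{{W}}(U)`. -/
def Roumieu {E F : Type*} [NormedAddCommGroup E] [NormedSpace ℝ E]
    [NormedAddCommGroup F] [NormedSpace ℝ F]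
    (W : Set (ℕ → ℝ)) (U : Set E) (f : E → F) : Prop :=
  ContDiffOn ℝ (⊤ : ℕ∞) f U ∧
    ∀ K ⊆ U, IsCompact K → ∃ M ∈ W, ∃ ρ : ℝ, 0 < ρ ∧ SeqBoundedOn M ρ f U K

/-- The Beurling class `E^{(W)}(U)`. -/
def Beurling {E F : Type*} [NormedAddCommGroup E] [NormedSpace ℝ E]
    [NormedAddCommGroup F] [NormedSpace ℝ F]
    (W : Set (ℕ → ℝ)) (U : Set E) (f : E → F) : Prop :=
  ContDiffOn ℝ (⊤ : ℕ∞) f U ∧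
    ∀ K ⊆ U, IsCompact K → ∀ M ∈ W, ∀ ρ : ℝ, 0 < ρ → SeqBoundedOn M ρ f U K

/-- The open ellipse `Ω_ε` with vertices `±cosh ε` and co-vertices `±i sinh ε`. -/
def Omega (ε : ℝ) : Set ℂ :=
  {z : ℂ | (z.re / Real.cosh ε) ^ 2 + (z.im / Real.sinh ε) ^ 2 < 1}

/-- `V_U = ⋃_{x ∈ U} (x + 𝔹)`. -/
def VU {E : Type*} [NormedAddCommGroup E] [NormedSpace ℝ E] (U : Set E) : Set E :=
  ⋃ x ∈ U, Metric.closedBall x 1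

/-- A weight function in the sense of Braun–Meise–Taylor. -/
structure IsWeightFunction (ω : ℝ → ℝ) : Prop where
  cont : ContinuousOn ω (Ici 0)
  mono : MonotoneOn ω (Ici 0)
  nonneg : ∀ t, 0 ≤ t → 0 ≤ ω t
  bigO : (fun t => ω (2 * t)) =O[atTop] ω
  littleO : ω =o[atTop] (fun t => t)
  logLittleO : Real.log =o[atTop] ω
  convex : ConvexOn ℝ (Ici 0) (fun t => ω (Real.exp t))

/-- The Young conjugate `φ*_ω(s) = sup_{t ≥ 0} (s t - ω(e^t))`. -/
def youngConj (ω : ℝ → ℝ) (s : ℝ) : ℝ :=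
  sSup {y : ℝ | ∃ t : ℝ, 0 ≤ t ∧ y = s * t - ω (Real.exp t)}

/-- The Roumieu class `E^{{ω}}(U)` for a weight function `ω`. -/
def RoumieuW {E F : Type*} [NormedAddCommGroup E] [NormedSpace ℝ E]
    [NormedAddCommGroup F] [NormedSpace ℝ F]
    (ω : ℝ → ℝ) (U : Set E) (f : E → F) : Prop :=
  ContDiffOn ℝ (⊤ : ℕ∞) f U ∧
    ∀ K ⊆ U, IsCompact K → ∃ C : ℝ, 0 < C ∧ ∃ ρ : ℝ, 0 < ρ ∧
      ∀ x ∈ K, ∀ k : ℕ, ‖iteratedFDerivWithin ℝ k f U x‖ ≤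
        C * Real.exp ((1 / ρ) * youngConj ω (ρ * k))

/-- The Beurling class `E^{(ω)}(U)` for a weight function `ω`. -/
def BeurlingW {E F : Type*} [NormedAddCommGroup E] [NormedSpace ℝ E]
    [NormedAddCommGroup F] [NormedSpace ℝ F]
    (ω : ℝ → ℝ) (U : Set E) (f : E → F) : Prop :=
  ContDiffOn ℝ (⊤ : ℕ∞) f U ∧
    ∀ K ⊆ U, IsCompact K → ∀ ρ : ℝ, 0 < ρ → ∃ C : ℝ, 0 < C ∧
      ∀ x ∈ K, ∀ k : ℕ, ‖iteratedFDerivWithin ℝ k f U x‖ ≤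
        C * Real.exp ((1 / ρ) * youngConj ω (ρ * k))

section PolynomialBounds
open Polynomial

lemma prod_erase_abs_sub (N i : ℕ) (hi : i ∈ Finset.range (N + 1)) :
    ∏ k ∈ (Finset.range (N + 1)).erase i, |(i : ℝ) - k| = (i.factorial : ℝ) * (N - i).factorial := by
  obtain ⟨m, rfl⟩ : ∃ m, N = i + m := ⟨N - i, by have := Finset.mem_range.1 hi; omega⟩
  have h1 : ∏ k ∈ (Finset.range (i + m + 1)).erase i, |(i : ℝ) - k|
      = ∏ k ∈ Finset.range (i + (m + 1)), if k = i then 1 else |(i : ℝ) - k| := by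
    rw [← Finset.mul_prod_erase (Finset.range (i + (m + 1))) _ hi]
    rw [if_pos rfl, one_mul]
    exact Finset.prod_congr rfl fun k hk => by rw [if_neg (Finset.ne_of_mem_erase hk)]
  rw [h1, Finset.prod_range_add, Finset.prod_range_succ']
  congr 1
  · rw [← Finset.prod_range_reflect, ← Finset.prod_range_add_one_eq_factorial, Nat.cast_prod]
    refine Finset.prod_congr rfl fun k hk => ?_
    have hk := Finset.mem_range.1 hk
    rw [if_neg (by omega)]
    have : ((i - 1 - k : ℕ) : ℝ) = i - 1 - k := by
      rw [Nat.cast_sub (by omega), Nat.cast_sub (by omega)]; simp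
    rw [this]
    push_cast
    rw [abs_of_nonneg] <;> [ring; (ring_nf; positivity)]
  · rw [← Finset.prod_range_add_one_eq_factorial]
    simp only [Nat.add_zero, if_true, mul_one]
    have : i + m - i = m := by omega
    rw [this, Nat.cast_prod]
    refine Finset.prod_congr rfl fun k hk => ?_
    rw [if_neg (by omega)]
    push_cast
    rw [abs_of_nonpos] <;> [ring; (ring_nf; linarith [(k.cast_nonneg : (0 : ℝ) ≤ k)])]

lemma pow_self_le_exp_mul_factorial (N : ℕ) : (N : ℝ) ^ N ≤ Real.exp N * N.factorial := by
  have := Real.pow_div_factorial_le_exp (N : ℝ) (Nat.cast_nonneg N) N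
  rwa [div_le_iff₀ (by positivity)] at this

lemma pow_self_le_three_pow_mul_factorial (N : ℕ) : (N : ℝ) ^ N ≤ 3 ^ N * N.factorial := by
  refine (pow_self_le_exp_mul_factorial N).trans ?_
  gcongr
  rw [← mul_one (N : ℝ), Real.exp_nat_mul]
  exact pow_le_pow_left₀ (Real.exp_pos _).le Real.exp_one_lt_three.le N

/-- A polynomial of degree at most `N` bounded on `[0, 1]` is controlled on the unit disc. -/
lemma norm_eval_le_of_unitInterval {P : ℂ[X]} {N : ℕ} (hP : P.natDegree ≤ N) {M : ℝ}
    (h : ∀ x : ℝ, 0 ≤ x → x ≤ 1 → ‖P.eval (x : ℂ)‖ ≤ M) {z : ℂ} (hz : ‖z‖ ≤ 1) :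
    ‖P.eval z‖ ≤ 12 ^ N * M := by
  have hM : 0 ≤ M := (norm_nonneg _).trans (h 0 le_rfl zero_le_one)
  rcases Nat.eq_zero_or_pos N with rfl | hN
  · rw [eq_C_of_natDegree_le_zero hP]
    have := h 0 le_rfl zero_le_one
    rw [eq_C_of_natDegree_le_zero hP] at this
    simpa using this
  have hN' : (0 : ℝ) < N := Nat.cast_pos.2 hN
  let v : ℕ → ℂ := fun i => (((i : ℝ) / N : ℝ) : ℂ)
  have hv : Set.InjOn v (Finset.range (N + 1)) := by
    intro a _ b _ hab
    have : (a : ℝ) / N = (b : ℝ) / N := Complex.ofReal_injective hab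
    field_simp at this
    exact_mod_cast this
  have hdeg : P.degree < (Finset.range (N + 1)).card := by
    rw [Finset.card_range]
    exact (degree_le_of_natDegree_le hP).trans_lt (by exact_mod_cast Nat.lt_succ_self N)
  rw [Lagrange.eq_interpolate hv hdeg, Lagrange.interpolate_apply, eval_finsetSum]
  have key : ∀ i ∈ Finset.range (N + 1),
      ‖(C (eval (v i) P) * Lagrange.basis (Finset.range (N + 1)) v i).eval z‖
        ≤ M * (6 ^ N * N.choose i) := by
    intro i hi
    have hiN : i ≤ N := Nat.lt_succ_iff.1 (Finset.mem_range.1 hi)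
    rw [eval_mul, eval_C, norm_mul]
    have h1 : ‖P.eval (v i)‖ ≤ M :=
      h _ (by positivity) ((div_le_one hN').2 (by exact_mod_cast hiN))
    refine mul_le_mul h1 ?_ (norm_nonneg _) hM
    rw [Lagrange.basis, eval_prod, norm_prod]
    have h2 : ∀ k ∈ (Finset.range (N + 1)).erase i,
        ‖(Lagrange.basisDivisor (v i) (v k)).eval z‖ ≤ 2 * N * |(i : ℝ) - k|⁻¹ := by
      intro k hk
      have hkN : k ≤ N := Nat.lt_succ_iff.1 (Finset.mem_range.1 (Finset.mem_of_mem_erase hk))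
      rw [Lagrange.basisDivisor, eval_mul, eval_C, eval_sub, eval_X, eval_C, norm_mul, norm_inv]
      have e1 : ‖v i - v k‖ = |(i : ℝ) - k| / N := by
        simp only [v]
        rw [← Complex.ofReal_sub, Complex.norm_real, ← sub_div, Real.norm_eq_abs, abs_div,
          abs_of_pos hN']
      have e2 : ‖z - v k‖ ≤ 2 := by
        refine (norm_sub_le _ _).trans ?_
        have : ‖v k‖ ≤ 1 := by
          simp only [v]
          rw [Complex.norm_real, Real.norm_eq_abs, abs_of_nonneg (by positivity)]
          exact (div_le_one hN').2 (by exact_mod_cast hkN)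
        linarith
      rw [e1, inv_div]
      calc (N : ℝ) / |(i : ℝ) - k| * ‖z - v k‖ ≤ N / |(i : ℝ) - k| * 2 := by gcongr
        _ = _ := by ring
    refine (Finset.prod_le_prod (fun _ _ => norm_nonneg _) h2).trans ?_
    rw [Finset.prod_mul_distrib, Finset.prod_const, Finset.card_erase_of_mem hi,
      Finset.card_range, Finset.prod_inv_distrib, prod_erase_abs_sub N i hi, Nat.add_sub_cancel,
      mul_pow, Nat.cast_choose ℝ hiN]
    have := pow_self_le_three_pow_mul_factorial N
    have e6 : (6 : ℝ) ^ N = 2 ^ N * 3 ^ N := by rw [← mul_pow]; norm_num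
    rw [e6, ← div_eq_mul_inv, mul_div_assoc', div_le_div_iff_of_pos_right (by positivity)]
    nlinarith [pow_pos (two_pos : (0 : ℝ) < 2) N]
  refine (norm_sum_le _ _).trans ((Finset.sum_le_sum key).trans (le_of_eq ?_))
  rw [← Finset.mul_sum, ← Finset.mul_sum, ← Nat.cast_sum, Nat.sum_range_choose]
  push_cast
  rw [← mul_pow]; norm_num; ring

lemma norm_coeff_le_of_unitInterval {P : ℂ[X]} {N : ℕ} (hP : P.natDegree ≤ N) {M : ℝ}
    (h : ∀ x : ℝ, 0 ≤ x → x ≤ 1 → ‖P.eval (x : ℂ)‖ ≤ M) (k : ℕ) :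
    ‖P.coeff k‖ ≤ 12 ^ N * M := by
  have h1 := Complex.norm_iteratedDeriv_le_of_forall_mem_sphere_norm_le (c := 0) (R := 1)
    (F := ℂ) (f := fun z => P.eval z) (C := 12 ^ N * M) k one_pos
    (P.differentiable.diffContOnCl)
    (fun z hz => norm_eval_le_of_unitInterval hP h (by simpa using (mem_sphere_zero_iff_norm.1 hz).le))
  have h2 : iteratedDeriv k (fun z => P.eval z) 0 = k.factorial * P.coeff k := by
    have : ∀ (k : ℕ) (Q : ℂ[X]), iteratedDeriv k (fun z => Q.eval z) = fun z => (derivative^[k] Q).eval z := by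
      intro k
      induction k with
      | zero => intro Q; simp
      | succ k ih =>
        intro Q
        have hd : deriv (fun z => Q.eval z) = fun z => (derivative Q).eval z :=
          funext fun z => Q.deriv
        rw [iteratedDeriv_succ', hd, ih]
        rfl
    rw [this]
    beta_reduce
    rw [← coeff_zero_eq_eval_zero, coeff_iterate_derivative]
    simp [Nat.descFactorial_self]
  rw [h2, norm_mul, Complex.norm_natCast, one_pow, div_one] at h1
  exact le_of_mul_le_mul_left h1 (by positivity)

end PolynomialBounds

section CauchyPompeiu
open MeasureTheory ComplexConjugate

lemma intervalIntegral_swap_of_continuous {F : ℝ → ℝ → ℂ} (hF : Continuous (Function.uncurry F))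
    (a b c d : ℝ) :
    ∫ x in a..b, ∫ y in c..d, F x y = ∫ y in c..d, ∫ x in a..b, F x y := by
  refine intervalIntegral_intervalIntegral_swap ?_
  refine (hF.continuousOn.integrableOn_compact
    (isCompact_uIcc (a := a) (b := b) |>.prod (isCompact_uIcc (a := c) (b := d)))).mono_set ?_
  exact Set.prod_mono uIoc_subset_uIcc uIoc_subset_uIcc

/-- A Cauchy–Pompeiu formula on the unit disc, integrated along the rays issuing from `x`. -/
lemma norm_cauchyIntegral_sub_le {F a b : ℂ → ℂ} (hFc : Continuous F) (ha : Continuous a) (hb : Continuous b)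
    (hF : ∀ (u : ℝ → ℂ) (u' : ℂ) (t : ℝ), HasDerivAt u u' t →
      HasDerivAt (fun t => F (u t)) (a (u t) * u' + b (u t) * conj u') t)
    {x : ℂ} (hx : ‖x‖ < 1) {B : ℝ}
    (hB : ∀ θ : ℝ, ∫ s in (0 : ℝ)..1, ‖b (x + s * (circleMap 0 1 θ - x))‖ ≤ B) :
    ‖(2 * Real.pi * Complex.I : ℂ)⁻¹ • (∮ z in C(0, 1), (z - x)⁻¹ • F z) - F x‖ ≤ 2 * B := by
  set γ : ℝ → ℂ := fun θ => circleMap 0 1 θ - x with hγ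
  set γ' : ℝ → ℂ := fun θ => circleMap 0 1 θ * Complex.I with hγ'
  have hγne : ∀ θ, γ θ ≠ 0 := by
    intro θ h
    have : circleMap 0 1 θ = x := sub_eq_zero.1 h
    rw [← this] at hx
    simp at hx
  have hγc : Continuous γ := by fun_prop
  have hγ'c : Continuous γ' := by fun_prop
  have hγ'n : ∀ θ, ‖γ' θ‖ = 1 := by intro θ; simp [hγ']
  have hγd : ∀ θ, HasDerivAt γ (γ' θ) θ := fun θ => (hasDerivAt_circleMap 0 1 θ).sub_const x
  let P : ℝ → ℝ → ℂ := fun s θ =>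
    (a (x + s * γ θ) * γ θ + b (x + s * γ θ) * conj (γ θ)) * (γ' θ / γ θ)
  let Q : ℝ → ℝ → ℂ := fun s θ =>
    a (x + s * γ θ) * γ' θ + b (x + s * γ θ) * conj (γ' θ)
  have hPc : Continuous (Function.uncurry P) := by
    have : Continuous fun θ => γ' θ / γ θ := hγ'c.div hγc hγne
    have h1 : Continuous fun p : ℝ × ℝ => γ' p.2 / γ p.2 := this.comp continuous_snd
    simp only [P, Function.uncurry_def]
    exact Continuous.mul (by fun_prop) h1
  have hQc : Continuous (Function.uncurry Q) := by
    simp only [Q, Function.uncurry_def]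
    fun_prop
  have hray : ∀ θ, ∫ s in (0:ℝ)..1, P s θ = (F (x + γ θ) - F x) * (γ' θ / γ θ) := by
    intro θ
    rw [intervalIntegral.integral_mul_const]
    congr 1
    rw [intervalIntegral.integral_eq_sub_of_hasDerivAt (f := fun s : ℝ => F (x + s * γ θ))]
    · simp
    · intro s _
      refine hF (fun s : ℝ => x + s * γ θ) (γ θ) s ?_
      simpa using ((hasDerivAt_id s).ofReal_comp.mul_const (γ θ)).const_add x
    · exact Continuous.intervalIntegrable (by fun_prop) _ _
  have hcirc : ∀ s : ℝ, s ≠ 0 → ∫ θ in (0:ℝ)..2 * Real.pi, Q s θ = 0 := by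
    intro s hs
    have h1 : ∫ θ in (0:ℝ)..2 * Real.pi, s * Q s θ = 0 := by
      rw [intervalIntegral.integral_eq_sub_of_hasDerivAt (f := fun θ : ℝ => F (x + s * γ θ))]
      · have : γ (2 * Real.pi) = γ 0 := by simp [hγ, circleMap]
        rw [this, sub_self]
      · intro θ _
        have := hF (fun θ : ℝ => x + s * γ θ) (s * γ' θ) θ (((hγd θ).const_mul (s : ℂ)).const_add x)
        have e : s * Q s θ = a (x + s * γ θ) * (s * γ' θ) + b (x + s * γ θ) * conj (s * γ' θ) := by
          simp only [Q]
          rw [map_mul conj (s : ℂ), Complex.conj_ofReal]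
          ring
        rw [e]
        exact this
      · refine Continuous.intervalIntegrable ?_ _ _
        simp only [Q]
        fun_prop
    rw [intervalIntegral.integral_const_mul] at h1
    exact (mul_eq_zero.1 h1).resolve_left (by exact_mod_cast hs)
  have hQ0 : ∫ θ in (0:ℝ)..2 * Real.pi, ∫ s in (0:ℝ)..1, Q s θ = 0 := by
    rw [← intervalIntegral_swap_of_continuous hQc]
    refine intervalIntegral.integral_zero_ae (Eventually.of_forall fun s hs => hcirc s ?_)
    rw [uIoc_of_le zero_le_one] at hs
    exact hs.1.ne'
  have hPθ : ∀ θ, IntervalIntegrable (fun s => P s θ) volume 0 1 := fun θ =>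
    (hPc.comp (Continuous.prodMk continuous_id continuous_const)).intervalIntegrable _ _
  have hQθ : ∀ θ, IntervalIntegrable (fun s => Q s θ) volume 0 1 := fun θ =>
    (hQc.comp (Continuous.prodMk continuous_id continuous_const)).intervalIntegrable _ _
  have hIc : ∀ {R : ℝ → ℝ → ℂ}, Continuous (Function.uncurry R) →
      Continuous fun θ => ∫ s in (0:ℝ)..1, R s θ := fun {R} hR =>
    intervalIntegral.continuous_parametric_intervalIntegral_of_continuous'
      (f := fun θ s => R s θ) (hR.comp continuous_swap) _ _
  have hdiff : (∮ z in C(0, 1), (z - x)⁻¹ • F z) - (2 * Real.pi * Complex.I) * F x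
      = ∫ θ in (0:ℝ)..2 * Real.pi, ∫ s in (0:ℝ)..1, (P s θ - Q s θ) := by
    have e1 : ∀ θ, ∫ s in (0:ℝ)..1, (P s θ - Q s θ)
        = (∫ s in (0:ℝ)..1, P s θ) - ∫ s in (0:ℝ)..1, Q s θ := fun θ =>
      intervalIntegral.integral_sub (hPθ θ) (hQθ θ)
    simp_rw [e1]
    rw [intervalIntegral.integral_sub ((hIc hPc).intervalIntegrable _ _)
      ((hIc hQc).intervalIntegrable _ _), hQ0, sub_zero]
    simp_rw [hray]
    have hxb : x ∈ ball (0 : ℂ) 1 := by simpa using hx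
    rw [← circleIntegral.integral_sub_inv_of_mem_ball hxb]
    rw [circleIntegral, circleIntegral, ← intervalIntegral.integral_mul_const,
      ← intervalIntegral.integral_sub]
    · refine intervalIntegral.integral_congr fun θ _ => ?_
      have h2 : x + γ θ = circleMap 0 1 θ := by simp [hγ]
      have h3 : (circleMap 0 1 θ - x)⁻¹ = (γ θ)⁻¹ := rfl
      simp only [smul_eq_mul, deriv_circleMap, h2, h3]
      simp only [hγ']
      ring
    · refine Continuous.intervalIntegrable ?_ _ _
      have : Continuous fun θ => (γ θ)⁻¹ := hγc.inv₀ hγne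
      simp only [deriv_circleMap, smul_eq_mul]
      exact (hγ'c.mul (this.mul (hFc.comp (continuous_circleMap 0 1))))
    · refine Continuous.intervalIntegrable ?_ _ _
      have : Continuous fun θ => (γ θ)⁻¹ := hγc.inv₀ hγne
      simp only [deriv_circleMap, smul_eq_mul]
      exact (hγ'c.mul this).mul continuous_const
  have hbound : ‖∫ θ in (0:ℝ)..2 * Real.pi, ∫ s in (0:ℝ)..1, (P s θ - Q s θ)‖
      ≤ (2 * B) * |2 * Real.pi - 0| := by
    refine intervalIntegral.norm_integral_le_of_norm_le_const fun θ _ => ?_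
    refine (intervalIntegral.norm_integral_le_integral_norm zero_le_one).trans ?_
    have hle : ∀ s ∈ Icc (0 : ℝ) 1, ‖P s θ - Q s θ‖ ≤ 2 * ‖b (x + s * γ θ)‖ := by
      intro s _
      have : P s θ - Q s θ
          = b (x + s * γ θ) * (conj (γ θ) * (γ' θ / γ θ) - conj (γ' θ)) := by
        simp only [P, Q]
        field_simp [hγne θ]
        ring
      rw [this, norm_mul, mul_comm]
      refine mul_le_mul_of_nonneg_right ?_ (norm_nonneg _)
      refine (norm_sub_le _ _).trans ?_
      rw [norm_mul, norm_div, RCLike.norm_conj, RCLike.norm_conj, hγ'n]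
      have := norm_pos_iff.2 (hγne θ)
      field_simp
      norm_num
    have hbc : Continuous fun s : ℝ => 2 * ‖b (x + s * γ θ)‖ := by fun_prop
    refine (intervalIntegral.integral_mono_on zero_le_one
      ((hPθ θ).sub (hQθ θ)).norm (hbc.intervalIntegrable _ _) hle).trans ?_
    rw [intervalIntegral.integral_const_mul]
    exact mul_le_mul_of_nonneg_left (hB θ) zero_le_two
  have hpi : (2 * Real.pi * Complex.I : ℂ) ≠ 0 := Complex.two_pi_I_ne_zero
  have e : (2 * Real.pi * Complex.I : ℂ)⁻¹ • (∮ z in C(0, 1), (z - x)⁻¹ • F z) - F x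
      = (2 * Real.pi * Complex.I : ℂ)⁻¹ *
        ((∮ z in C(0, 1), (z - x)⁻¹ • F z) - (2 * Real.pi * Complex.I) * F x) := by
    rw [smul_eq_mul, mul_sub, inv_mul_cancel_left₀ hpi]
  rw [e, hdiff, norm_mul, norm_inv]
  have hn : ‖(2 * Real.pi * Complex.I : ℂ)‖ = 2 * Real.pi := by
    simp [Real.pi_pos.le]
  rw [hn, inv_mul_le_iff₀ Real.two_pi_pos]
  refine hbound.trans (le_of_eq ?_)
  rw [sub_zero, abs_of_pos Real.two_pi_pos]
  ring

end CauchyPompeiu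

section RayIntegrals
open Polynomial

lemma integral_inv_add_abs_sub_le {r : ℝ} (hr : 0 < r) (c : ℝ) :
    ∫ s in (0 : ℝ)..1, (r + |s - c|)⁻¹ ≤ 2 * Real.log ((r + 1) / r) := by
  have hcont : ∀ c : ℝ, Continuous fun s : ℝ => (r + |s - c|)⁻¹ := fun c =>
    Continuous.inv₀ (by fun_prop) fun s => by positivity
  wlog hc : c ∈ Icc (0 : ℝ) 1 generalizing c
  · refine le_trans ?_ (this (max 0 (min c 1)) ⟨le_max_left _ _, by simp⟩)
    refine intervalIntegral.integral_mono_on zero_le_one ((hcont c).intervalIntegrable _ _)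
      ((hcont _).intervalIntegrable _ _) fun s hs => ?_
    refine inv_anti₀ (by positivity) (add_le_add_right ?_ r)
    obtain ⟨h0, h1⟩ := hs
    rcases le_total c 0 with h | h
    · rw [min_eq_left (h.trans zero_le_one), max_eq_left h, abs_of_nonneg (by linarith),
        abs_of_nonneg (by linarith)]
      linarith
    · rcases le_total c 1 with h' | h'
      · rw [min_eq_left h', max_eq_right h]
      · rw [min_eq_right h', max_eq_right zero_le_one, abs_of_nonpos (by linarith),
          abs_of_nonpos (by linarith)]
        linarith
  obtain ⟨h0, h1⟩ := hc
  have hlog : ∀ d : ℝ, 0 ≤ d → d ≤ 1 → ∫ u in r..r + d, u⁻¹ ≤ Real.log ((r + 1) / r) := by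
    intro d hd0 hd1
    rw [integral_inv_of_pos hr (by linarith)]
    exact Real.log_le_log (by positivity) (by gcongr)
  rw [← intervalIntegral.integral_add_adjacent_intervals (b := c)
    ((hcont c).intervalIntegrable _ _) ((hcont c).intervalIntegrable _ _), two_mul]
  refine add_le_add ?_ ?_
  · have e : ∫ s in (0:ℝ)..c, (r + |s - c|)⁻¹ = ∫ s in (0:ℝ)..c, (fun u : ℝ => u⁻¹) ((r + c) - s) := by
      refine intervalIntegral.integral_congr fun s hs => ?_
      rw [uIcc_of_le h0] at hs
      simp only
      rw [abs_of_nonpos (by linarith [hs.2])]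
      congr 1
      ring
    rw [e, intervalIntegral.integral_comp_sub_left]
    simpa using hlog c h0 h1
  · have e : ∫ s in c..(1:ℝ), (r + |s - c|)⁻¹ = ∫ s in c..(1:ℝ), (fun u : ℝ => u⁻¹) (s - (c - r)) := by
      refine intervalIntegral.integral_congr fun s hs => ?_
      rw [uIcc_of_le h1] at hs
      simp only
      rw [abs_of_nonneg (by linarith [hs.1])]
      congr 1
      ring
    rw [e, intervalIntegral.integral_comp_sub_right]
    have e1 : c - (c - r) = r := by ring
    have e2 : 1 - (c - r) = r + (1 - c) := by ring
    rw [e1, e2]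
    exact hlog (1 - c) (by linarith) (by linarith)

lemma norm_eval_derivative_div_le {G : ℂ[X]} {r : ℝ} (hr : 0 < r) {z : ℂ}
    (hz : ‖(derivative G).eval z‖ ≤ 2) :
    ‖(derivative G).eval z‖ / (‖G.eval z‖ + r)
      ≤ (G.roots.map fun a => 4 * (r + 2 * ‖z - a‖)⁻¹).sum := by
  have hnn : ∀ y ∈ G.roots.map fun a => 4 * (r + 2 * ‖z - a‖)⁻¹, (0 : ℝ) ≤ y := by
    intro y hy
    obtain ⟨a, -, rfl⟩ := Multiset.mem_map.1 hy
    positivity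
  by_cases hd : (derivative G).eval z = 0
  · rw [hd, norm_zero, zero_div]
    exact Multiset.sum_nonneg hnn
  by_cases hnear : ∃ a ∈ G.roots, 2 * ‖z - a‖ ≤ r
  · obtain ⟨a, ha, har⟩ := hnear
    refine le_trans ?_ (Multiset.single_le_sum hnn _ (Multiset.mem_map_of_mem _ ha))
    calc ‖(derivative G).eval z‖ / (‖G.eval z‖ + r) ≤ 2 / r := by
          gcongr
          linarith [norm_nonneg (G.eval z)]
      _ = 4 * (r + r)⁻¹ := by field_simp; norm_num
      _ ≤ _ := by gcongr
  · push Not at hnear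
    have hG0 : G ≠ 0 := by rintro rfl; simp at hd
    have hne : G.eval z ≠ 0 := by
      intro h
      have := hnear z ((mem_roots hG0).2 h)
      simp at this
      linarith
    have h1 : ‖(derivative G).eval z‖ / (‖G.eval z‖ + r) ≤ ‖(derivative G).eval z / G.eval z‖ := by
      rw [norm_div]
      have := norm_pos_iff.2 hne
      gcongr
      linarith
    refine h1.trans ?_
    rw [Polynomial.Splits.eval_derivative_div_eval_of_ne_zero (IsAlgClosed.splits G) hne]
    refine (norm_multiset_sum_le _).trans ?_
    rw [Multiset.map_map]
    refine Multiset.sum_map_le_sum_map _ _ fun a ha => ?_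
    have h2 := hnear a ha
    have h3 : 0 < ‖z - a‖ := by linarith
    simp only [Function.comp, norm_div, norm_one]
    rw [← div_eq_mul_inv, div_le_div_iff₀ h3 (by positivity)]
    linarith

lemma integral_multiset_sum_le {α : Type*} (T : Multiset α) (g : α → ℝ → ℝ)
    (hg : ∀ a, Continuous (g a)) {K : ℝ} (hK : ∀ a, ∫ s in (0 : ℝ)..1, g a s ≤ K) :
    ∫ s in (0 : ℝ)..1, (T.map fun a => g a s).sum ≤ T.card * K := by
  induction T using Multiset.induction with
  | empty => simp
  | cons a T ih =>
    simp only [Multiset.map_cons, Multiset.sum_cons, Multiset.card_cons]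
    rw [intervalIntegral.integral_add ((hg a).intervalIntegrable _ _)
      ((continuous_multiset_sum T fun a _ => hg a).intervalIntegrable _ _)]
    push_cast
    linarith [hK a]

/-- Integral along a ray of the truncated logarithmic derivative of a polynomial. -/
lemma integral_logDeriv_ray_le {G : ℂ[X]} {N : ℕ} (hG : G.natDegree ≤ N) {r : ℝ} (hr : 0 < r)
    {x v : ℂ} (hv : 1 / 2 ≤ ‖v‖)
    (hG' : ∀ s ∈ Icc (0 : ℝ) 1, ‖(derivative G).eval (x + s * v)‖ ≤ 2) :
    ∫ s in (0 : ℝ)..1, ‖(derivative G).eval (x + s * v)‖ / (‖G.eval (x + s * v)‖ + r)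
      ≤ N * (8 * Real.log ((r + 1) / r)) := by
  have hv0 : v ≠ 0 := by rintro rfl; norm_num at hv
  set c : ℂ → ℝ := fun a => ((a - x) / v).re
  have hcont : ∀ a : ℂ, Continuous fun s : ℝ => 4 * (r + |s - c a|)⁻¹ := fun a =>
    continuous_const.mul (Continuous.inv₀ (by fun_prop) fun s => by positivity)
  have hle : ∀ s ∈ Icc (0 : ℝ) 1,
      ‖(derivative G).eval (x + s * v)‖ / (‖G.eval (x + s * v)‖ + r)
        ≤ (G.roots.map fun a => 4 * (r + |s - c a|)⁻¹).sum := by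
    intro s hs
    refine (norm_eval_derivative_div_le hr (hG' s hs)).trans ?_
    refine Multiset.sum_map_le_sum_map _ _ fun a _ => ?_
    have h1 : x + s * v - a = v * (s - (a - x) / v) := by field_simp; ring
    have h2 : |s - c a| ≤ ‖(s : ℂ) - (a - x) / v‖ := by
      simpa [c] using Complex.abs_re_le_norm ((s : ℂ) - (a - x) / v)
    have h3 : |s - c a| ≤ 2 * ‖x + s * v - a‖ := by
      rw [h1, norm_mul]
      nlinarith [abs_nonneg (s - c a)]
    gcongr
  refine (intervalIntegral.integral_mono_on zero_le_one ?_ ?_ hle).trans ?_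
  · refine Continuous.intervalIntegrable ?_ _ _
    refine Continuous.div ?_ ?_ fun s => by positivity
    · exact ((derivative G).continuous.comp (by fun_prop)).norm
    · exact (G.continuous.comp (by fun_prop)).norm.add continuous_const
  · exact (continuous_multiset_sum _ fun a _ => hcont a).intervalIntegrable _ _
  · refine (integral_multiset_sum_le _ _ hcont (K := 8 * Real.log ((r + 1) / r)) fun a => ?_).trans ?_
    · rw [intervalIntegral.integral_const_mul]
      linarith [integral_inv_add_abs_sub_le hr (c a)]
    · have : 0 ≤ Real.log ((r + 1) / r) :=
        Real.log_nonneg ((one_le_div hr).2 (by linarith))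
      gcongr
      exact (card_roots' G).trans hG

end RayIntegrals

section RegularisedQuotient
open Polynomial ComplexConjugate

lemma norm_pow_sub_pow_le {a b : ℂ} {R : ℝ} (hR : 1 ≤ R) (ha : ‖a‖ ≤ R) (hb : ‖b‖ ≤ R) (n : ℕ) :
    ‖a ^ n - b ^ n‖ ≤ n * R ^ n * ‖a - b‖ := by
  induction n with
  | zero => simp
  | succ n ih =>
    have e : a ^ (n + 1) - b ^ (n + 1) = a ^ n * (a - b) + (a ^ n - b ^ n) * b := by ring
    rw [e]
    refine (norm_add_le _ _).trans ?_
    rw [norm_mul, norm_mul, norm_pow]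
    have h1 : ‖a‖ ^ n ≤ R ^ (n + 1) :=
      (pow_le_pow_left₀ (norm_nonneg _) ha n).trans (pow_le_pow_right₀ hR n.le_succ)
    have h2 : ‖a ^ n - b ^ n‖ * ‖b‖ ≤ n * R ^ n * ‖a - b‖ * R := by gcongr
    have h3 : ‖a‖ ^ n * ‖a - b‖ ≤ R ^ (n + 1) * ‖a - b‖ := by gcongr
    push_cast
    calc _ ≤ R ^ (n + 1) * ‖a - b‖ + n * R ^ n * ‖a - b‖ * R := add_le_add h3 h2
      _ = _ := by ring

lemma exists_root_of_add_pow {j : ℕ} (hj : 1 ≤ j) {S g : ℝ} (hS : 0 < S) (hg : 0 ≤ g) :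
    ∃ W, S ≤ W ∧ W ^ j = g + S ^ j := by
  have hw : 0 ≤ g + S ^ j := by positivity
  have e : ((g + S ^ j) ^ ((j : ℝ)⁻¹)) ^ j = g + S ^ j := Real.rpow_inv_natCast_pow hw (by omega)
  refine ⟨_, ?_, e⟩
  refine le_of_pow_le_pow_left₀ (n := j) (by omega) (by positivity) ?_
  rw [e]
  linarith

/-- The regularised quotient `H / G`. -/
def regQuot (G H : ℂ[X]) (r : ℝ) (z : ℂ) : ℂ :=
  H.eval z * conj (G.eval z) / (G.eval z * conj (G.eval z) + (r : ℂ) ^ 2)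

lemma regQuot_denom_eq (G : ℂ[X]) (r : ℝ) (z : ℂ) :
    G.eval z * conj (G.eval z) + (r : ℂ) ^ 2 = ((‖G.eval z‖ ^ 2 + r ^ 2 : ℝ) : ℂ) := by
  rw [Complex.mul_conj, Complex.normSq_eq_norm_sq]
  push_cast
  rfl

lemma regQuot_denom_ne (G : ℂ[X]) {r : ℝ} (hr : 0 < r) (z : ℂ) :
    G.eval z * conj (G.eval z) + (r : ℂ) ^ 2 ≠ 0 := by
  rw [regQuot_denom_eq]
  exact_mod_cast (by positivity : (‖G.eval z‖ ^ 2 + r ^ 2 : ℝ) ≠ 0)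

lemma continuous_regQuot (G H : ℂ[X]) {r : ℝ} (hr : 0 < r) : Continuous (regQuot G H r) := by
  have hG := G.continuous
  have hH := H.continuous
  exact Continuous.div (by fun_prop) (by fun_prop) (regQuot_denom_ne G hr)

lemma hasDerivAt_regQuot_comp (G H : ℂ[X]) {r : ℝ} (hr : 0 < r) (u : ℝ → ℂ) (u' : ℂ) (t : ℝ)
    (hu : HasDerivAt u u' t) :
    HasDerivAt (fun t => regQuot G H r (u t))
      (((derivative H).eval (u t) * conj (G.eval (u t)) *
            (G.eval (u t) * conj (G.eval (u t)) + (r : ℂ) ^ 2)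
          - H.eval (u t) * conj (G.eval (u t)) * (derivative G).eval (u t) * conj (G.eval (u t))) /
          (G.eval (u t) * conj (G.eval (u t)) + (r : ℂ) ^ 2) ^ 2 * u'
        + H.eval (u t) * conj ((derivative G).eval (u t)) * (r : ℂ) ^ 2 /
          (G.eval (u t) * conj (G.eval (u t)) + (r : ℂ) ^ 2) ^ 2 * conj u') t := by
  have hG : HasDerivAt (fun t => G.eval (u t)) ((derivative G).eval (u t) * u') t :=
    (G.hasDerivAt (u t)).comp t hu
  have hH : HasDerivAt (fun t => H.eval (u t)) ((derivative H).eval (u t) * u') t :=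
    (H.hasDerivAt (u t)).comp t hu
  have hGc : HasDerivAt (fun t => conj (G.eval (u t))) (conj ((derivative G).eval (u t) * u')) t :=
    hG.star
  have hne := regQuot_denom_ne G hr (u t)
  have := (hH.fun_mul hGc).fun_div ((hG.fun_mul hGc).add_const ((r : ℂ) ^ 2)) hne
  refine this.congr_deriv ?_
  rw [map_mul]
  field_simp
  ring

lemma norm_regQuot (G H : ℂ[X]) (r : ℝ) (z : ℂ) :
    ‖regQuot G H r z‖ = ‖H.eval z‖ * ‖G.eval z‖ / (‖G.eval z‖ ^ 2 + r ^ 2) := by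
  rw [regQuot, regQuot_denom_eq, norm_div, norm_mul, RCLike.norm_conj, Complex.norm_real,
    Real.norm_of_nonneg (by positivity)]

lemma regQuot_bounds {j : ℕ} (hj : 1 ≤ j) {S g h c : ℝ} (hS : 0 < S) (hS1 : S ≤ 1) (hg : 0 ≤ g)
    (hg2 : g ≤ 2) (hc : 1 ≤ c) (hgh : h ^ j ≤ c * (g + S ^ j) ^ (j + 1)) :
    h * g / (g ^ 2 + (S ^ j) ^ 2) ≤ 6 * c ∧
      h * (S ^ j) ^ 2 / (g ^ 2 + (S ^ j) ^ 2) ^ 2 ≤ 4 * c * S / (g + S ^ j) := by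
  obtain ⟨W, hSW, hW⟩ := exists_root_of_add_pow hj hS hg
  have hWp : 0 < W := hS.trans_le hSW
  set r := S ^ j with hr
  have hrp : 0 < r := by positivity
  have hr1 : r ≤ 1 := pow_le_one₀ hS.le hS1
  have hhW : h ≤ c * W ^ (j + 1) := by
    refine le_of_pow_le_pow_left₀ (n := j) (by omega) (by positivity) ?_
    rw [mul_pow, pow_right_comm W, hW]
    refine hgh.trans ?_
    have := le_self_pow₀ hc (show j ≠ 0 by omega)
    gcongr
  have hW3 : W ≤ 3 := by
    by_contra hcon
    push Not at hcon
    have : W ≤ W ^ j := le_self_pow₀ (by linarith) (by omega)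
    linarith
  have hD : (g + r) ^ 2 / 2 ≤ g ^ 2 + r ^ 2 := by nlinarith [sq_nonneg (g - r)]
  have hDp : 0 < g ^ 2 + r ^ 2 := by positivity
  constructor
  · rw [div_le_iff₀ hDp]
    have h1 : h * g ≤ c * W ^ (j + 1) * (g + r) := by gcongr; linarith
    rw [pow_succ, hW] at h1
    have h2 : c * ((g + r) * W) * (g + r) = c * W * (g + r) ^ 2 := by ring
    have h3 : c * W * (g + r) ^ 2 ≤ c * 3 * (g + r) ^ 2 := by gcongr
    nlinarith
  · have hwp : 0 < g + r := by positivity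
    rw [div_le_div_iff₀ (by positivity) hwp]
    have h4 : ((g + r) ^ 2 / 2) ^ 2 ≤ (g ^ 2 + r ^ 2) ^ 2 := by gcongr
    have h5 : h * r ^ 2 * (g + r) ≤ c * S * (g + r) ^ 4 := by
      have h6 : r ^ 2 * W ≤ S * (g + r) ^ 2 := by
        have e1 : r ^ 2 * W = (S ^ (2 * j - 1) * W) * S := by
          obtain ⟨i, rfl⟩ : ∃ i, j = i + 1 := ⟨j - 1, by omega⟩
          rw [hr, show 2 * (i + 1) - 1 = 2 * i + 1 by omega]
          ring
        have e2 : (g + r) ^ 2 = W ^ (2 * j - 1) * W := by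
          obtain ⟨i, rfl⟩ : ∃ i, j = i + 1 := ⟨j - 1, by omega⟩
          rw [← hW, show 2 * (i + 1) - 1 = 2 * i + 1 by omega]
          ring
        rw [e1, e2, mul_comm S]
        gcongr
      calc h * r ^ 2 * (g + r) ≤ c * W ^ (j + 1) * r ^ 2 * (g + r) := by gcongr
        _ = c * (g + r) ^ 2 * (r ^ 2 * W) := by rw [pow_succ, hW]; ring
        _ ≤ c * (g + r) ^ 2 * (S * (g + r) ^ 2) := by gcongr
        _ = _ := by ring
    calc h * r ^ 2 * (g + r) ≤ c * S * (g + r) ^ 4 := h5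
      _ = 4 * c * S * ((g + r) ^ 2 / 2) ^ 2 := by ring
      _ ≤ _ := by gcongr

lemma norm_sub_regQuot_le {j : ℕ} (hj : 1 ≤ j) {S δ : ℝ} (hS : 0 < S) (hS1 : S ≤ 1)
    (hδ : 0 ≤ δ) (hδS : δ ≤ S * S ^ j) {f : ℂ} (hf : ‖f‖ ≤ 3) {G H : ℂ[X]} {z : ℂ}
    (h1 : ‖f ^ j - G.eval z‖ ≤ δ) (h2 : ‖f ^ (j + 1) - H.eval z‖ ≤ δ) :
    ‖f - regQuot G H (S ^ j) z‖ ≤ 6 * S := by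
  obtain ⟨W, hSW, hW⟩ := exists_root_of_add_pow hj hS (norm_nonneg (G.eval z))
  have hWp : 0 < W := hS.trans_le hSW
  set r := S ^ j with hr
  have hrp : 0 < r := by positivity
  set g := ‖G.eval z‖ with hg
  have hg0 : 0 ≤ g := norm_nonneg _
  have hDp : 0 < g ^ 2 + r ^ 2 := by positivity
  have hδr : δ ≤ r := hδS.trans (by nlinarith)
  have hfW : ‖f‖ ≤ W := by
    refine le_of_pow_le_pow_left₀ (n := j) (by omega) (by positivity) ?_
    rw [hW, ← norm_pow]
    have : ‖f ^ j‖ ≤ ‖f ^ j - G.eval z‖ + ‖G.eval z‖ := by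
      simpa using norm_add_le (f ^ j - G.eval z) (G.eval z)
    linarith
  have e : f - regQuot G H r z
      = (conj (G.eval z) * ((f ^ (j + 1) - H.eval z) - f * (f ^ j - G.eval z)) + f * (r : ℂ) ^ 2)
        / (G.eval z * conj (G.eval z) + (r : ℂ) ^ 2) := by
    rw [regQuot, eq_div_iff (regQuot_denom_ne G hrp z), sub_mul,
      div_mul_cancel₀ _ (regQuot_denom_ne G hrp z)]
    ring
  rw [e, regQuot_denom_eq, norm_div, Complex.norm_real, Real.norm_of_nonneg hDp.le,
    div_le_iff₀ hDp]
  have hA : ‖conj (G.eval z) * ((f ^ (j + 1) - H.eval z) - f * (f ^ j - G.eval z))‖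
      ≤ g * (4 * δ) := by
    rw [norm_mul, RCLike.norm_conj]
    refine mul_le_mul_of_nonneg_left ?_ hg0
    refine (norm_sub_le _ _).trans ?_
    rw [norm_mul]
    nlinarith [norm_nonneg f, norm_nonneg (f ^ j - G.eval z)]
  have hB : ‖f * (r : ℂ) ^ 2‖ ≤ W * r ^ 2 := by
    rw [norm_mul, norm_pow, Complex.norm_real, Real.norm_of_nonneg hrp.le]
    gcongr
  have hC : r ^ 2 * W ≤ S * (g + r) ^ 2 := by
    have e1 : r ^ 2 * W = (S ^ (2 * j - 1) * W) * S := by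
      obtain ⟨i, rfl⟩ : ∃ i, j = i + 1 := ⟨j - 1, by omega⟩
      rw [hr, show 2 * (i + 1) - 1 = 2 * i + 1 by omega]
      ring
    have e2 : (g + r) ^ 2 = W ^ (2 * j - 1) * W := by
      obtain ⟨i, rfl⟩ : ∃ i, j = i + 1 := ⟨j - 1, by omega⟩
      rw [← hW, show 2 * (i + 1) - 1 = 2 * i + 1 by omega]
      ring
    rw [e1, e2, mul_comm S]
    gcongr
  refine (norm_add_le _ _).trans ?_
  have hg2 : g * (4 * δ) ≤ 4 * S * (g * r) := by nlinarith
  have h7 : S * (g + r) ^ 2 ≤ S * (2 * (g ^ 2 + r ^ 2)) := by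
    gcongr
    nlinarith [sq_nonneg (g - r)]
  have h8 : S * (g * r) ≤ S * ((g ^ 2 + r ^ 2) / 2) := by
    gcongr
    nlinarith [sq_nonneg (g - r)]
  nlinarith

end RegularisedQuotient

section Approximation
open Polynomial ComplexConjugate

/-- Near-multiplicativity of `G ≈ f ^ j` and `H ≈ f ^ (j + 1)` extends to the complex disc. -/
lemma norm_eval_pow_le_on_disc {j N : ℕ} {σ : ℝ} (hj : 1 ≤ j) (hσ : 0 < σ)
    (hσN : 12 ^ N * σ ≤ 1) {G H : ℂ[X]} {f : ℝ → ℂ} (hG : G.natDegree ≤ N) (hH : H.natDegree ≤ N)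
    (hGb : ∀ z : ℂ, ‖z‖ ≤ 1 → ‖G.eval z‖ ≤ 2) (hHb : ∀ z : ℂ, ‖z‖ ≤ 1 → ‖H.eval z‖ ≤ 2)
    (hf1 : ∀ y ∈ Icc (0 : ℝ) 1, ‖f y ^ j - G.eval (y : ℂ)‖ ≤ σ ^ (6 * j * (j + 1)))
    (hf2 : ∀ y ∈ Icc (0 : ℝ) 1, ‖f y ^ (j + 1) - H.eval (y : ℂ)‖ ≤ σ ^ (6 * j * (j + 1)))
    {z : ℂ} (hz : ‖z‖ ≤ 1) :
    ‖H.eval z‖ ^ j ≤ (1 + (2 * j + 1) * 3 ^ (j + 1)) *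
      (‖G.eval z‖ + (σ ^ 3) ^ j) ^ (j + 1) := by
  set δ := σ ^ (6 * j * (j + 1)) with hδ
  set c : ℝ := (2 * j + 1) * 3 ^ (j + 1) with hc
  have h12 : (1 : ℝ) ≤ 12 ^ N := one_le_pow₀ (by norm_num)
  have hσ1 : σ ≤ 1 := by nlinarith
  have hδ0 : 0 < δ := by positivity
  have hδ1 : δ ≤ 1 := pow_le_one₀ hσ.le hσ1
  have hreal : ∀ y : ℝ, 0 ≤ y → y ≤ 1 →
      ‖(H ^ j - G ^ (j + 1)).eval (y : ℂ)‖ ≤ c * δ := by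
    intro y h0 h1
    have hy : ‖(y : ℂ)‖ ≤ 1 := by rw [Complex.norm_real, Real.norm_of_nonneg h0]; exact h1
    have a1 := hf1 y ⟨h0, h1⟩
    have a2 := hf2 y ⟨h0, h1⟩
    have b1 : ‖f y ^ j‖ ≤ 3 := by
      have : ‖f y ^ j‖ ≤ ‖f y ^ j - G.eval (y : ℂ)‖ + ‖G.eval (y : ℂ)‖ := by
        simpa using norm_add_le (f y ^ j - G.eval (y : ℂ)) (G.eval (y : ℂ))
      linarith [hGb y hy]
    have b2 : ‖f y ^ (j + 1)‖ ≤ 3 := by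
      have : ‖f y ^ (j + 1)‖ ≤ ‖f y ^ (j + 1) - H.eval (y : ℂ)‖ + ‖H.eval (y : ℂ)‖ := by
        simpa using norm_add_le (f y ^ (j + 1) - H.eval (y : ℂ)) (H.eval (y : ℂ))
      linarith [hHb y hy]
    have c1 := norm_pow_sub_pow_le (by norm_num : (1 : ℝ) ≤ 3) b1 ((hGb y hy).trans (by norm_num))
      (j + 1)
    have c2 := norm_pow_sub_pow_le (by norm_num : (1 : ℝ) ≤ 3) b2 ((hHb y hy).trans (by norm_num)) j
    have e : (H ^ j - G ^ (j + 1)).eval (y : ℂ)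
        = ((f y ^ j) ^ (j + 1) - G.eval (y : ℂ) ^ (j + 1))
          - ((f y ^ (j + 1)) ^ j - H.eval (y : ℂ) ^ j) := by
      rw [eval_sub, eval_pow, eval_pow, pow_right_comm (f y)]
      ring
    rw [e]
    refine (norm_sub_le _ _).trans ((add_le_add c1 c2).trans ?_)
    have d1 : ((j + 1 : ℕ) : ℝ) * 3 ^ (j + 1) * ‖f y ^ j - G.eval (y : ℂ)‖
        ≤ ((j + 1 : ℕ) : ℝ) * 3 ^ (j + 1) * δ := by gcongr
    have d2 : (j : ℝ) * 3 ^ j * ‖f y ^ (j + 1) - H.eval (y : ℂ)‖ ≤ j * 3 ^ (j + 1) * δ := by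
      gcongr
      · norm_num
      · omega
    refine (add_le_add d1 d2).trans (le_of_eq ?_)
    rw [hc]
    push_cast
    ring
  have hdeg : (H ^ j - G ^ (j + 1)).natDegree ≤ (j + 1) * N := by
    refine (natDegree_sub_le _ _).trans (max_le ?_ ?_)
    · exact natDegree_pow_le.trans (Nat.mul_le_mul (by omega) hH)
    · exact natDegree_pow_le.trans (Nat.mul_le_mul le_rfl hG)
  have hE := norm_eval_le_of_unitInterval hdeg hreal hz
  have hsmall : 12 ^ ((j + 1) * N) * (c * δ) ≤ c * ((σ ^ 3) ^ j) ^ (j + 1) := by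
    have e : 12 ^ ((j + 1) * N) * (c * δ)
        = c * ((σ ^ 3) ^ j) ^ (j + 1) * (12 ^ N * (σ ^ 3) ^ j) ^ (j + 1) := by
      have : δ = ((σ ^ 3) ^ j) ^ (j + 1) * ((σ ^ 3) ^ j) ^ (j + 1) := by
        rw [hδ, ← pow_mul, ← pow_mul, ← pow_add]
        congr 1
        ring
      rw [this, mul_pow, mul_comm (j + 1) N, pow_mul (12 : ℝ) N]
      ring
    rw [e]
    refine mul_le_of_le_one_right (by positivity) (pow_le_one₀ (by positivity) ?_)
    have : (σ ^ 3) ^ j ≤ σ := by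
      rw [← pow_mul]
      exact pow_le_of_le_one hσ.le hσ1 (by omega)
    exact (mul_le_mul_of_nonneg_left this (by positivity)).trans hσN
  set r := (σ ^ 3) ^ j with hr
  have hr0 : 0 < r := by positivity
  have h1 : ‖H.eval z‖ ^ j ≤ ‖(H ^ j - G ^ (j + 1)).eval z‖ + ‖G.eval z‖ ^ (j + 1) := by
    rw [← norm_pow, ← norm_pow]
    have e : H.eval z ^ j = (H ^ j - G ^ (j + 1)).eval z + G.eval z ^ (j + 1) := by
      rw [eval_sub, eval_pow, eval_pow]
      ring
    rw [e]
    exact norm_add_le _ _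
  have h2 : ‖G.eval z‖ ^ (j + 1) ≤ (‖G.eval z‖ + r) ^ (j + 1) := by gcongr; linarith
  have h3 : c * r ^ (j + 1) ≤ c * (‖G.eval z‖ + r) ^ (j + 1) := by
    gcongr
    linarith [norm_nonneg (G.eval z)]
  linarith

lemma nat_mul_log_le {j N : ℕ} {σ : ℝ} (hσ : 0 < σ) (hσN : 12 ^ N * σ ≤ 1) :
    N * σ ^ 3 * Real.log (((σ ^ 3) ^ j + 1) / (σ ^ 3) ^ j) ≤ (3 * j + 1) * σ := by
  have hN : (N : ℝ) ≤ 12 ^ N := by exact_mod_cast (Nat.lt_pow_self (by norm_num)).le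
  have h12 : (1 : ℝ) ≤ 12 ^ N := one_le_pow₀ (by norm_num)
  have hσ1 : σ ≤ 1 := by nlinarith
  have hNσ : N * σ ≤ 1 := (mul_le_mul_of_nonneg_right hN hσ.le).trans hσN
  have hr1 : (σ ^ 3) ^ j ≤ 1 := pow_le_one₀ (by positivity) (pow_le_one₀ hσ.le hσ1)
  have hr0 : 0 < (σ ^ 3) ^ j := by positivity
  have hlog : Real.log (((σ ^ 3) ^ j + 1) / (σ ^ 3) ^ j) ≤ (3 * j + 1) / σ := by
    rw [Real.log_div (by positivity) (by positivity), Real.log_pow, Real.log_pow]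
    have h1 : Real.log ((σ ^ 3) ^ j + 1) ≤ 1 := by
      refine (Real.log_le_sub_one_of_pos (by positivity)).trans ?_
      linarith
    have h2 : -Real.log σ ≤ 1 / σ := by
      rw [← Real.log_inv, one_div]
      linarith [Real.log_le_sub_one_of_pos (inv_pos.2 hσ)]
    have h3 : 1 ≤ 1 / σ := (one_le_div hσ).2 hσ1
    have h4 : (j : ℝ) * (3 * -Real.log σ) ≤ j * (3 * (1 / σ)) := by gcongr
    calc _ ≤ 1 + (j : ℝ) * (3 * -Real.log σ) := by push_cast; linarith
      _ ≤ 1 / σ + j * (3 * (1 / σ)) := by linarith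
      _ = _ := by ring
  calc N * σ ^ 3 * Real.log (((σ ^ 3) ^ j + 1) / (σ ^ 3) ^ j)
      ≤ N * σ ^ 3 * ((3 * j + 1) / σ) := by gcongr
    _ = (N * σ) * σ * (3 * j + 1) := by field_simp
    _ ≤ 1 * σ * (3 * j + 1) := by gcongr
    _ = _ := by ring

/-- Approximation of `f` by a power series when `f ^ j` and `f ^ (j + 1)` are approximated by
polynomials. -/
lemma exists_powerSeries_approx {j : ℕ} (hj : 1 ≤ j) : ∃ A : ℝ, 1 ≤ A ∧
    ∀ (N : ℕ) (σ : ℝ) (G H : ℂ[X]) (f : ℝ → ℂ), 0 < σ → 12 ^ N * σ ≤ 1 →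
      G.natDegree ≤ N → H.natDegree ≤ N →
      (∀ z : ℂ, ‖z‖ ≤ 1 → ‖G.eval z‖ ≤ 2) → (∀ z : ℂ, ‖z‖ ≤ 1 → ‖H.eval z‖ ≤ 2) →
      (∀ z : ℂ, ‖z‖ ≤ 1 → ‖(derivative G).eval z‖ ≤ 2) →
      (∀ y ∈ Icc (0 : ℝ) 1, ‖f y ^ j - G.eval (y : ℂ)‖ ≤ σ ^ (6 * j * (j + 1))) →
      (∀ y ∈ Icc (0 : ℝ) 1, ‖f y ^ (j + 1) - H.eval (y : ℂ)‖ ≤ σ ^ (6 * j * (j + 1))) →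
      ∃ p : ℕ → ℂ, (∀ k, ‖p k‖ ≤ A) ∧
        ∀ y ∈ Icc (0 : ℝ) (1 / 2), ‖f y - ∑' k, p k * (y : ℂ) ^ k‖ ≤ A * σ := by
  set c : ℝ := 1 + (2 * j + 1) * 3 ^ (j + 1) with hc
  have hc1 : 1 ≤ c := by
    have : (0 : ℝ) ≤ (2 * j + 1) * 3 ^ (j + 1) := by positivity
    linarith
  refine ⟨64 * c * (3 * j + 1) + 6, by nlinarith [(Nat.cast_nonneg j : (0 : ℝ) ≤ j)], ?_⟩
  intro N σ G H f hσ hσN hG hH hGb hHb hG'b hf1 hf2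
  have h12 : (1 : ℝ) ≤ 12 ^ N := one_le_pow₀ (by norm_num)
  have hσ1 : σ ≤ 1 := by nlinarith
  set S := σ ^ 3 with hS
  have hS0 : 0 < S := by positivity
  have hS1 : S ≤ 1 := pow_le_one₀ hσ.le hσ1
  have hSσ : S ≤ σ := pow_le_of_le_one hσ.le hσ1 (by omega)
  set r := S ^ j with hr
  have hr0 : 0 < r := by positivity
  have hdisc : ∀ z : ℂ, ‖z‖ ≤ 1 → ‖regQuot G H r z‖ ≤ 6 * c ∧
      ‖H.eval z‖ * r ^ 2 / (‖G.eval z‖ ^ 2 + r ^ 2) ^ 2 ≤ 4 * c * S / (‖G.eval z‖ + r) := by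
    intro z hz
    rw [norm_regQuot]
    exact regQuot_bounds hj hS0 hS1 (norm_nonneg _) (hGb z hz) hc1
      (norm_eval_pow_le_on_disc hj hσ hσN hG hH hGb hHb hf1 hf2 hz)
  have hFc := continuous_regQuot G H hr0
  set F := regQuot G H r with hF
  have hCI : CircleIntegrable F 0 1 := hFc.continuousOn.circleIntegrable'
  let p : ℕ → ℂ := (cauchyPowerSeries F 0 1).coeff
  have hpy : ∀ (k : ℕ) (y : ℂ), cauchyPowerSeries F 0 1 k (fun _ => y) = p k * y ^ k := by
    intro k y
    rw [FormalMultilinearSeries.apply_eq_pow_smul_coeff, smul_eq_mul, mul_comm]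
  refine ⟨p, fun k => ?_, fun y hy => ?_⟩
  · have h1 : ‖p k‖ ≤ ‖cauchyPowerSeries F 0 1 k‖ :=
      FormalMultilinearSeries.norm_apply_eq_norm_coef.ge
    have h2 := norm_cauchyPowerSeries_le F 0 1 k
    have h3 : ∫ θ in (0:ℝ)..2 * Real.pi, ‖F (circleMap 0 1 θ)‖ ≤ 6 * c * (2 * Real.pi) := by
      refine (intervalIntegral.integral_mono_on Real.two_pi_pos.le
        ((hFc.comp (continuous_circleMap 0 1)).norm.intervalIntegrable _ _)
        (continuous_const.intervalIntegrable _ _)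
        (g := fun _ => 6 * c) fun θ _ => (hdisc _ (by simp)).1).trans ?_
      rw [intervalIntegral.integral_const, smul_eq_mul]
      linarith
    have h4 : ‖p k‖ ≤ 6 * c := by
      refine (h1.trans h2).trans ?_
      rw [abs_one, inv_one, one_pow, mul_one, inv_mul_le_iff₀ Real.two_pi_pos]
      linarith
    nlinarith [(Nat.cast_nonneg j : (0 : ℝ) ≤ j), mul_nonneg (Nat.cast_nonneg j : (0 : ℝ) ≤ j) (zero_le_one.trans hc1)]
  · obtain ⟨hy0, hy1⟩ := hy
    have hyn : ‖(y : ℂ)‖ ≤ 1 / 2 := by rwa [Complex.norm_real, Real.norm_of_nonneg hy0]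
    have hsum := hasSum_cauchyPowerSeries_integral hCI (hyn.trans_lt (by norm_num))
    simp_rw [hpy, zero_add] at hsum
    rw [hsum.tsum_eq]
    have hGc := G.continuous
    have hHc := H.continuous
    have hG'c := (derivative G).continuous
    have hH'c := (derivative H).continuous
    have hDne : ∀ z, (G.eval z * conj (G.eval z) + (r : ℂ) ^ 2) ^ 2 ≠ 0 := fun z =>
      pow_ne_zero 2 (regQuot_denom_ne G hr0 z)
    have hray := norm_cauchyIntegral_sub_le (F := F)
      (a := fun z => ((derivative H).eval z * conj (G.eval z) *
            (G.eval z * conj (G.eval z) + (r : ℂ) ^ 2)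
          - H.eval z * conj (G.eval z) * (derivative G).eval z * conj (G.eval z)) /
          (G.eval z * conj (G.eval z) + (r : ℂ) ^ 2) ^ 2)
      (b := fun z => H.eval z * conj ((derivative G).eval z) * (r : ℂ) ^ 2 /
          (G.eval z * conj (G.eval z) + (r : ℂ) ^ 2) ^ 2) hFc
      (Continuous.div (by fun_prop) (by fun_prop) hDne)
      (Continuous.div (by fun_prop) (by fun_prop) hDne)
      (hasDerivAt_regQuot_comp G H hr0) (x := (y : ℂ)) (hyn.trans_lt (by norm_num))
      (B := 32 * c * (3 * j + 1) * σ) ?_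
    · have hreal : ‖f y - F y‖ ≤ 6 * S := by
        have hy' : y ∈ Icc (0 : ℝ) 1 := ⟨hy0, by linarith⟩
        have hδ1 : σ ^ (6 * j * (j + 1)) ≤ 1 := pow_le_one₀ hσ.le hσ1
        refine norm_sub_regQuot_le hj hS0 hS1 (by positivity) ?_ ?_ (hf1 y hy') (hf2 y hy')
        · rw [hS, ← pow_mul, ← pow_add]
          exact pow_le_pow_of_le_one hσ.le hσ1 (by nlinarith)
        · by_contra hcon
          push Not at hcon
          have h5 : ‖f y‖ ≤ ‖f y‖ ^ j := le_self_pow₀ (by linarith) (by omega)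
          have h6 : ‖f y ^ j‖ ≤ ‖f y ^ j - G.eval (y : ℂ)‖ + ‖G.eval (y : ℂ)‖ := by
            simpa using norm_add_le (f y ^ j - G.eval (y : ℂ)) (G.eval (y : ℂ))
          rw [norm_pow] at h6
          linarith [hf1 y hy', hGb y (hyn.trans (by norm_num))]
      have e : f y - (2 * Real.pi * Complex.I : ℂ)⁻¹ • (∮ z in C(0, 1), (z - y)⁻¹ • F z)
          = (f y - F y)
            - ((2 * Real.pi * Complex.I : ℂ)⁻¹ • (∮ z in C(0, 1), (z - y)⁻¹ • F z) - F y) := by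
        ring
      rw [e]
      refine (norm_sub_le _ _).trans ?_
      linarith
    · intro θ
      have hv : 1 / 2 ≤ ‖circleMap 0 1 θ - y‖ := by
        have := norm_sub_norm_le (circleMap 0 1 θ) (y : ℂ)
        rw [norm_circleMap_zero, abs_one] at this
        linarith
      have hin : ∀ s ∈ Icc (0 : ℝ) 1, ‖(y : ℂ) + s * (circleMap 0 1 θ - y)‖ ≤ 1 := by
        intro s hs
        have e : (y : ℂ) + s * (circleMap 0 1 θ - y)
            = ((1 - s : ℝ) : ℂ) * y + s * circleMap 0 1 θ := by push_cast; ring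
        rw [e]
        refine (norm_add_le _ _).trans ?_
        rw [norm_mul, norm_mul, Complex.norm_real, Complex.norm_real, Complex.norm_real,
          norm_circleMap_zero, abs_one,
          Real.norm_of_nonneg hs.1, Real.norm_of_nonneg (by linarith [hs.2]),
          Real.norm_of_nonneg hy0]
        nlinarith [hs.1, hs.2]
      have hlog := integral_logDeriv_ray_le hG hr0 hv fun s hs => hG'b _ (hin s hs)
      have hmono : ∀ s ∈ Icc (0 : ℝ) 1,
          ‖(H.eval ((y : ℂ) + s * (circleMap 0 1 θ - y)) *
            conj ((derivative G).eval ((y : ℂ) + s * (circleMap 0 1 θ - y))) * (r : ℂ) ^ 2 /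
            (G.eval ((y : ℂ) + s * (circleMap 0 1 θ - y)) *
              conj (G.eval ((y : ℂ) + s * (circleMap 0 1 θ - y))) + (r : ℂ) ^ 2) ^ 2)‖
          ≤ 4 * c * S * (‖(derivative G).eval ((y : ℂ) + s * (circleMap 0 1 θ - y))‖ /
            (‖G.eval ((y : ℂ) + s * (circleMap 0 1 θ - y))‖ + r)) := by
        intro s hs
        have hb := (hdisc _ (hin s hs)).2
        set z := (y : ℂ) + s * (circleMap 0 1 θ - y)
        rw [regQuot_denom_eq, norm_div, norm_mul, norm_mul, RCLike.norm_conj, norm_pow, norm_pow,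
          Complex.norm_real, Complex.norm_real, Real.norm_of_nonneg hr0.le,
          Real.norm_of_nonneg (by positivity)]
        calc _ = ‖(derivative G).eval z‖ *
              (‖H.eval z‖ * r ^ 2 / (‖G.eval z‖ ^ 2 + r ^ 2) ^ 2) := by ring
          _ ≤ ‖(derivative G).eval z‖ * (4 * c * S / (‖G.eval z‖ + r)) := by gcongr
          _ = _ := by ring
      refine (intervalIntegral.integral_mono_on zero_le_one ?_ ?_ hmono).trans ?_
      · refine Continuous.intervalIntegrable (Continuous.norm ?_) _ _
        exact Continuous.div (by fun_prop) (by fun_prop) fun s => hDne _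
      · refine Continuous.intervalIntegrable (continuous_const.mul ?_) _ _
        exact Continuous.div (by fun_prop) (by fun_prop) fun s => by positivity
      · rw [intervalIntegral.integral_const_mul]
        have hl := nat_mul_log_le (j := j) hσ hσN
        calc _ ≤ 4 * c * S * (N * (8 * Real.log ((r + 1) / r))) := by gcongr
          _ = 32 * c * (N * S * Real.log ((r + 1) / r)) := by ring
          _ ≤ 32 * c * ((3 * j + 1) * σ) := by gcongr
          _ = _ := by ring

end Approximation

section Weights

lemma lc_pos {M : ℕ → ℝ} (hM : IsWeightSeq M) (k : ℕ) : 0 < lc M k :=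
  div_pos (hM.pos k) (by positivity)

lemma lc_zero {M : ℕ → ℝ} (hM : IsWeightSeq M) : lc M 0 = 1 := by
  simp [lc, hM.first]

lemma exists_forall_pow_le {m : ℕ → ℝ} (hm : ∀ k, 0 < m k) (h : RootsTendsto m) (R : ℝ) :
    ∃ K, ∀ k, K ≤ k → |R| ^ k ≤ m k := by
  obtain ⟨K, hK⟩ := eventually_atTop.1 (h.eventually_ge_atTop |R|)
  refine ⟨max K 1, fun k hk => ?_⟩
  have h1 := hK k (le_of_max_le_left hk)
  have hk0 : k ≠ 0 := by have := le_of_max_le_right hk; omega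
  have h2 := pow_le_pow_left₀ (abs_nonneg R) h1 k
  rwa [one_div, Real.rpow_inv_natCast_pow (hm k).le hk0] at h2

lemma exists_hfn_eq {m : ℕ → ℝ} (hm : ∀ k, 0 < m k) (h : RootsTendsto m) {t : ℝ} (ht : 0 < t) :
    ∃ k, hfn m t = m k * t ^ k ∧ ∀ i, m k * t ^ k ≤ m i * t ^ i := by
  obtain ⟨K, hK⟩ : ∃ K, ∀ k, K ≤ k → m 0 ≤ m k * t ^ k := by
    obtain ⟨K, hK⟩ := exists_forall_pow_le hm h ((max (m 0) 1) / t)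
    refine ⟨max K 1, fun k hk => ?_⟩
    have h1 := hK k (le_of_max_le_left hk)
    have hk0 : k ≠ 0 := by have := le_of_max_le_right hk; omega
    rw [abs_of_nonneg (by positivity), div_pow, div_le_iff₀ (by positivity)] at h1
    exact (le_max_left _ _).trans ((le_self_pow₀ (le_max_right _ _) hk0).trans h1)
  obtain ⟨k, -, hk⟩ := Finset.exists_min_image (Finset.range (K + 1)) (fun k => m k * t ^ k)
    ⟨0, by simp⟩
  have hmin : ∀ i, m k * t ^ k ≤ m i * t ^ i := by
    intro i
    rcases Nat.lt_or_ge i (K + 1) with hi | hi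
    · exact hk i (Finset.mem_range.2 hi)
    · have h0 := hk 0 (by simp)
      simp only [pow_zero, mul_one] at h0
      exact h0.trans (hK i (by omega))
  refine ⟨k, ?_, hmin⟩
  rw [hfn, if_neg (not_le.2 ht)]
  refine le_antisymm (ciInf_le ⟨0, ?_⟩ k) (le_ciInf hmin)
  rintro _ ⟨i, rfl⟩
  have := hm i
  positivity

lemma hfn_le {m : ℕ → ℝ} (hm : ∀ k, 0 < m k) (h : RootsTendsto m) {t : ℝ} (ht : 0 < t) (k : ℕ) :
    hfn m t ≤ m k * t ^ k := by
  obtain ⟨i, hi, h'⟩ := exists_hfn_eq hm h ht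
  exact hi.trans_le (h' k)

lemma hfn_pos {m : ℕ → ℝ} (hm : ∀ k, 0 < m k) (h : RootsTendsto m) {t : ℝ} (ht : 0 < t) :
    0 < hfn m t := by
  obtain ⟨i, hi, -⟩ := exists_hfn_eq hm h ht
  rw [hi]
  have := hm i
  positivity

lemma hfn_mono {m : ℕ → ℝ} (hm : ∀ k, 0 < m k) (h : RootsTendsto m) {s t : ℝ} (hs : 0 < s)
    (hst : s ≤ t) : hfn m s ≤ hfn m t := by
  obtain ⟨i, hi, -⟩ := exists_hfn_eq hm h (hs.trans_le hst)
  rw [hi]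
  refine (hfn_le hm h hs i).trans ?_
  have := hm i
  gcongr

lemma hfn_eq_gammaUpper {m : ℕ → ℝ} (hm : ∀ k, 0 < m k) (h : RootsTendsto m) {t : ℝ}
    (ht : 0 < t) : hfn m t = m (GammaUpper m t) * t ^ GammaUpper m t := by
  obtain ⟨i, hi, -⟩ := exists_hfn_eq hm h ht
  exact Nat.sInf_mem (s := {k : ℕ | hfn m t = m k * t ^ k}) ⟨i, hi⟩

lemma mul_pow_succ_le_iff {m : ℕ → ℝ} (hm : ∀ k, 0 < m k) {t : ℝ} (ht : 0 < t) (k : ℕ) :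
    m (k + 1) * t ^ (k + 1) ≤ m k * t ^ k ↔ m (k + 1) / m k ≤ 1 / t := by
  rw [div_le_div_iff₀ (hm k) ht, pow_succ, ← mul_assoc, mul_right_comm, mul_comm 1,
    mul_one, mul_le_mul_iff_left₀ (by positivity)]

lemma antitone_upto {u : ℕ → ℝ} {N : ℕ} (h : ∀ k < N, u (k + 1) ≤ u k) {i k : ℕ} (hik : i ≤ k)
    (hk : k ≤ N) : u k ≤ u i := by
  induction k, hik using Nat.le_induction with
  | base => exact le_rfl
  | succ k _ ih => exact (h k (by omega)).trans (ih (by omega))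

lemma mul_pow_le_of_le_gammaLower {m : ℕ → ℝ} (hm : ∀ k, 0 < m k) {t : ℝ} (ht : 0 < t) {i k : ℕ}
    (hik : i ≤ k) (hk : k ≤ GammaLower m t) : m k * t ^ k ≤ m i * t ^ i := by
  refine antitone_upto (u := fun k => m k * t ^ k) (N := GammaLower m t) (fun k hk => ?_) hik hk
  rw [mul_pow_succ_le_iff hm ht]
  have := Nat.notMem_of_lt_sInf hk
  simp only [mem_ofPred_eq, not_le] at this
  exact this.le

lemma le_pow_mul_of_gamma_le {m n : ℕ → ℝ} (hm : ∀ k, 0 < m k) (hn : ∀ k, 0 < n k)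
    (hm0 : m 0 = 1) (hn0 : n 0 = 1) (hnr : RootsTendsto n) {C : ℝ} (hC : 1 ≤ C)
    (h : ∀ t, 0 < t → GammaUpper n (C * t) ≤ GammaLower m t) (k : ℕ) : m k ≤ C ^ k * n k := by
  induction k using Nat.strong_induction_on with
  | _ k ih =>
  rcases Nat.eq_zero_or_pos k with rfl | hk
  · simp [hm0, hn0]
  obtain ⟨i, hi, hmax⟩ := Finset.exists_max_image (Finset.range k) (fun i => m (i + 1) / m i)
    ⟨0, Finset.mem_range.2 hk⟩
  have hi := Finset.mem_range.1 hi
  set μ := m (i + 1) / m i with hμ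
  have hμ0 : 0 < μ := div_pos (hm _) (hm _)
  have ht : 0 < 1 / μ := by positivity
  set t := 1 / μ with htdef
  have hCt : 0 < C * t := by positivity
  have hK : GammaUpper n (C * t) ≤ i := by
    refine (h t ht).trans (Nat.sInf_le ?_)
    simp [htdef, hμ]
  set K := GammaUpper n (C * t)
  have h1 : m k * t ^ k ≤ m K * t ^ K := by
    refine antitone_upto (u := fun k => m k * t ^ k) (N := k) (fun l hl => ?_) (by omega) le_rfl
    rw [mul_pow_succ_le_iff hm ht]
    simpa [htdef] using hmax l (Finset.mem_range.2 hl)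
  have h2 := ih K (by omega)
  have h3 : m K * t ^ K ≤ hfn n (C * t) := by
    rw [hfn_eq_gammaUpper hn hnr hCt, mul_pow]
    calc m K * t ^ K ≤ C ^ K * n K * t ^ K := by gcongr
      _ = _ := by ring
  have h4 := hfn_le hn hnr hCt k
  refine le_of_mul_le_mul_right ?_ (pow_pos ht k)
  calc _ ≤ n k * (C * t) ^ k := h1.trans (h3.trans h4)
    _ = _ := by rw [mul_pow]; ring

lemma mul_pow_gammaLower_le_hfn {m n : ℕ → ℝ} (hm : ∀ k, 0 < m k) (hn : ∀ k, 0 < n k)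
    (hm0 : m 0 = 1) (hn0 : n 0 = 1) (hnr : RootsTendsto n) {C : ℝ} (hC : 1 ≤ C)
    (h : ∀ t, 0 < t → GammaUpper n (C * t) ≤ GammaLower m t) {t : ℝ} (ht : 0 < t) :
    m (GammaLower m t) * t ^ GammaLower m t ≤ hfn n (C * t) := by
  have hCt : 0 < C * t := by positivity
  rw [hfn_eq_gammaUpper hn hnr hCt, mul_pow]
  refine (mul_pow_le_of_le_gammaLower hm ht (h t ht) le_rfl).trans ?_
  have := le_pow_mul_of_gamma_le hm hn hm0 hn0 hnr hC h (GammaUpper n (C * t))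
  calc _ ≤ C ^ GammaUpper n (C * t) * n (GammaUpper n (C * t)) * t ^ GammaUpper n (C * t) := by
        gcongr
    _ = _ := by ring

lemma gammaLower_pos {m : ℕ → ℝ} (hm : ∀ k, 0 < m k) (hmr : RootsTendsto m) {t : ℝ} (ht : 0 < t)
    (h : m 1 / m 0 < 1 / t) : 1 ≤ GammaLower m t := by
  have hne : {k : ℕ | 1 / t ≤ m (k + 1) / m k}.Nonempty := by
    by_contra hcon
    have hall : ∀ k, m (k + 1) / m k ≤ 1 / t := by
      intro k
      by_contra hk
      exact hcon ⟨k, (not_le.1 hk).le⟩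
    have hb : ∀ k, m k * t ^ k ≤ m 0 := fun k => by
      simpa using antitone_upto (u := fun k => m k * t ^ k) (N := k)
        (fun l _ => (mul_pow_succ_le_iff hm ht l).2 (hall l)) (Nat.zero_le k) le_rfl
    obtain ⟨K, hK⟩ := exists_forall_pow_le hm hmr ((m 0 + 1) / t)
    have h1 := hK (K + 1) (by omega)
    have hm0 := hm 0
    rw [abs_of_nonneg (by positivity), div_pow, div_le_iff₀ (by positivity)] at h1
    have h2 : m 0 + 1 ≤ (m 0 + 1) ^ (K + 1) := le_self_pow₀ (by linarith) (by omega)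
    linarith [hb (K + 1)]
  have hmem := Nat.sInf_mem hne
  by_contra hcon
  have h0 : GammaLower m t = 0 := by omega
  rw [show sInf {k : ℕ | 1 / t ≤ m (k + 1) / m k} = 0 from h0] at hmem
  simp only [mem_ofPred_eq, zero_add] at hmem
  linarith

lemma exists_lc_add_le_of_mg {M N : ℕ → ℝ} (hM : IsWeightSeq M) (hN : IsWeightSeq N)
    (h : mg M N < ⊤) : ∃ D : ℝ, 1 ≤ D ∧ ∀ i k, lc M (i + k) ≤ D ^ (i + k) * (lc N i * lc N k) := by
  refine ⟨max 1 (mg M N).toReal, le_max_left _ _, fun i k => ?_⟩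
  set D := max 1 (mg M N).toReal with hD
  have hD1 : 1 ≤ D := le_max_left _ _
  have hMN : M (i + k) ≤ D ^ (i + k) * (N i * N k) := by
    rcases Nat.eq_zero_or_pos (i + k) with h0 | h0
    · obtain ⟨rfl, rfl⟩ : i = 0 ∧ k = 0 := by omega
      simp [hM.first, hN.first]
    · have h1 : ENNReal.ofReal ((M (i + k) / (N i * N k)) ^ (((i : ℝ) + (k : ℝ))⁻¹)) ≤ mg M N :=
        le_iSup_of_le i (le_iSup_of_le k (le_iSup_of_le h0 le_rfl))
      have hq : 0 < M (i + k) / (N i * N k) :=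
        div_pos (hM.pos _) (mul_pos (hN.pos _) (hN.pos _))
      have h2 : (M (i + k) / (N i * N k)) ^ (((i + k : ℕ) : ℝ)⁻¹) ≤ D := by
        refine le_max_of_le_right ?_
        rw [Nat.cast_add]
        exact (ENNReal.ofReal_le_iff_le_toReal h.ne).1 h1
      have h3 := pow_le_pow_left₀ (by positivity) h2 (i + k)
      rw [Real.rpow_inv_natCast_pow hq.le (by omega), div_le_iff₀
        (mul_pos (hN.pos _) (hN.pos _))] at h3
      exact h3
  have hf : ((i.factorial : ℝ) * k.factorial) ≤ (i + k).factorial := by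
    exact_mod_cast Nat.le_of_dvd (Nat.factorial_pos _) (Nat.factorial_mul_factorial_dvd_factorial_add i k)
  have hNi := hN.pos i
  have hNk := hN.pos k
  calc lc M (i + k) ≤ D ^ (i + k) * (N i * N k) / (i + k).factorial := by
        rw [lc]; gcongr
    _ ≤ D ^ (i + k) * (N i * N k) / (i.factorial * k.factorial) := by gcongr
    _ = _ := by simp only [lc]; field_simp

lemma exists_lc_two_pow_mul_le {W : Set (ℕ → ℝ)} (hW : RAdmissible W) (s : ℕ) :
    ∀ M ∈ W, ∃ Q ∈ W, ∃ D : ℝ, 1 ≤ D ∧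
      ∀ p, lc M (2 ^ s * p) ≤ (D ^ p * lc Q p) ^ (2 ^ s) := by
  induction s with
  | zero => exact fun M hM => ⟨M, hM, 1, le_rfl, fun p => by simp⟩
  | succ s ih =>
    intro M hM
    obtain ⟨Q, hQ, D, hD, h⟩ := ih M hM
    obtain ⟨R, hR, hmg⟩ := hW.mgrowth Q hQ
    obtain ⟨D', hD', h'⟩ := exists_lc_add_le_of_mg (hW.matrix.weight Q hQ) (hW.matrix.weight R hR) hmg
    refine ⟨R, hR, D * D', one_le_mul_of_one_le_of_one_le hD hD', fun p => ?_⟩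
    have e : 2 ^ (s + 1) * p = 2 ^ s * (p + p) := by ring
    rw [e]
    refine (h (p + p)).trans ?_
    have hQp := lc_pos (hW.matrix.weight Q hQ) (p + p)
    have hD0 : 0 < D := by linarith
    calc (D ^ (p + p) * lc Q (p + p)) ^ 2 ^ s
        ≤ (D ^ (p + p) * (D' ^ (p + p) * (lc R p * lc R p))) ^ 2 ^ s := by
          gcongr
          exact h' p p
      _ = _ := by rw [pow_succ 2 s, mul_comm (2 ^ s) 2, pow_mul]; congr 1; ring

/-- The consequences of admissibility used for the approximation argument. -/
lemma exists_approx_scale {W : Set (ℕ → ℝ)} (hW : RAdmissible W) {M : ℕ → ℝ} (hM : M ∈ W) (b : ℕ) :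
    ∃ Q ∈ W, ∃ D t₀ : ℝ, 1 ≤ D ∧ 0 < t₀ ∧ ∃ ω : ℝ → ℝ,
      (∀ t, 0 < t → 0 < ω t ∧ ω t ≤ 1) ∧ (∀ s t, 0 < s → s ≤ t → ω s ≤ ω t) ∧
      (∀ t, 0 < t → ∀ p, ω t ≤ D ^ p * lc Q p * t ^ p) ∧
      ∀ t, 0 < t → t ≤ t₀ → ∃ N, 1 ≤ N ∧ (∀ k ≤ N, lc M k * t ^ k ≤ 1) ∧
        lc M N * t ^ N ≤ ω t ^ b := by
  obtain ⟨N, hN, C, hC, hγ⟩ := hW.gamma M hM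
  obtain ⟨Q, hQ, D, hD, hQD⟩ := exists_lc_two_pow_mul_le hW b N hN
  have hMw := hW.matrix.weight M hM
  have hNw := hW.matrix.weight N hN
  have hm := lc_pos hMw
  have hn := lc_pos hNw
  have hq := lc_pos (hW.matrix.weight Q hQ)
  have hnr := hW.roots N hN
  have hm0 := lc_zero hMw
  have hn0 := lc_zero hNw
  have hC0 : 0 < C := by linarith
  have hh1 : ∀ t, 0 < t → hfn (lc N) (C * t) ≤ 1 := fun t ht => by
    simpa [hn0] using hfn_le hn hnr (mul_pos hC0 ht) 0
  have hh0 : ∀ t, 0 < t → 0 < hfn (lc N) (C * t) := fun t ht => hfn_pos hn hnr (mul_pos hC0 ht)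
  have hωpow : ∀ t, 0 < t → (hfn (lc N) (C * t) ^ (((2 ^ b : ℕ) : ℝ)⁻¹)) ^ (2 ^ b)
      = hfn (lc N) (C * t) := fun t ht => Real.rpow_inv_natCast_pow (hh0 t ht).le (by positivity)
  have hω0 : ∀ t, 0 < t → 0 < hfn (lc N) (C * t) ^ (((2 ^ b : ℕ) : ℝ)⁻¹) := fun t ht =>
    Real.rpow_pos_of_pos (hh0 t ht) _
  have hω1 : ∀ t, 0 < t → hfn (lc N) (C * t) ^ (((2 ^ b : ℕ) : ℝ)⁻¹) ≤ 1 := fun t ht =>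
    Real.rpow_le_one (hh0 t ht).le (hh1 t ht) (by positivity)
  refine ⟨Q, hQ, D * C, 1 / (lc M 1 + 1), one_le_mul_of_one_le_of_one_le hD hC,
    by have := hm 1; positivity, fun t => hfn (lc N) (C * t) ^ (((2 ^ b : ℕ) : ℝ)⁻¹),
    fun t ht => ⟨hω0 t ht, hω1 t ht⟩, ?_, ?_, ?_⟩
  · intro s t hs hst
    exact Real.rpow_le_rpow (hh0 s hs).le
      (hfn_mono hn hnr (mul_pos hC0 hs) (by gcongr)) (by positivity)
  · intro t ht p
    have hqp := hq p
    refine le_of_pow_le_pow_left₀ (n := 2 ^ b) (by positivity) (by positivity) ?_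
    rw [hωpow t ht]
    refine (hfn_le hn hnr (mul_pos hC0 ht) (2 ^ b * p)).trans ?_
    calc lc N (2 ^ b * p) * (C * t) ^ (2 ^ b * p)
        ≤ (D ^ p * lc Q p) ^ (2 ^ b) * (C * t) ^ (2 ^ b * p) := by
          gcongr
          exact hQD p
      _ = _ := by rw [mul_comm (2 ^ b) p, pow_mul, ← mul_pow]; congr 1; ring
  · intro t ht htt
    have hm1 := hm 1
    refine ⟨GammaLower (lc M) t, ?_, fun k hk => ?_, ?_⟩
    · refine gammaLower_pos hm (hW.roots M hM) ht ?_
      rw [hm0, div_one, lt_div_iff₀ ht]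
      rw [le_div_iff₀ (by positivity)] at htt
      linarith
    · simpa [hm0] using mul_pow_le_of_le_gammaLower hm ht (Nat.zero_le k) hk
    · refine (mul_pow_gammaLower_le_hfn hm hn hm0 hn0 hnr hC hγ ht).trans ?_
      beta_reduce
      conv_lhs => rw [← hωpow t ht]
      exact pow_le_pow_of_le_one (hω0 t ht).le (hω1 t ht) Nat.lt_two_pow_self.le

end Weights

section PowerSeries
open Polynomial

/-- A power series that is small on an interval has small coefficients. -/
lemma norm_coeff_le_of_powerSeries_small {d : ℕ → ℂ} {A ε : ℝ} (hA : 0 ≤ A) (hε : 0 < ε)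
    (hε1 : ε ≤ 1) (hd : ∀ k, ‖d k‖ ≤ A * 2 ^ k)
    (hs : ∀ y ∈ Icc (0 : ℝ) (1 / 4), ‖∑' k, d k * (y : ℂ) ^ k‖ ≤ A * ε ^ 2) (k : ℕ) :
    ‖d k‖ ≤ 2 * A * 288 ^ k * ε := by
  obtain ⟨N, hN1, hN2⟩ := exists_nat_pow_near (one_le_inv_iff₀.2 ⟨hε, hε1⟩)
    (by norm_num : (1 : ℝ) < 12)
  have hNe : 12 ^ N * ε ≤ 1 := by
    rw [← le_div_iff₀ hε, one_div]; exact hN1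
  have hNe' : 1 ≤ 12 ^ (N + 1) * ε := by
    rw [← div_le_iff₀ hε, one_div]; exact hN2.le
  rcases Nat.lt_or_ge N k with hk | hk
  · refine (hd k).trans ?_
    have h1 : (12 : ℝ) ^ (N + 1) ≤ 12 ^ k := pow_le_pow_right₀ (by norm_num) hk
    have h2 : 1 ≤ 12 ^ k * ε := hNe'.trans (by gcongr)
    have h3 : (24 : ℝ) ^ k ≤ 288 ^ k := by gcongr; norm_num
    have h4 : (24 : ℝ) ^ k = 2 ^ k * 12 ^ k := by rw [← mul_pow]; norm_num
    calc A * 2 ^ k ≤ A * 2 ^ k * (12 ^ k * ε) := le_mul_of_one_le_right (by positivity) h2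
      _ = A * 24 ^ k * ε := by rw [h4]; ring
      _ ≤ A * 288 ^ k * ε := by gcongr
      _ ≤ _ := by nlinarith [show 0 ≤ A * 288 ^ k * ε by positivity]
  · let P : ℂ[X] := ∑ i ∈ Finset.range (N + 1), C (d i * (1 / 288) ^ i) * X ^ i
    have hdeg : P.natDegree ≤ N := by
      refine natDegree_sum_le_of_forall_le _ _ fun i hi => ?_
      refine (natDegree_C_mul_X_pow_le _ _).trans ?_
      have := Finset.mem_range.1 hi
      omega
    have hcoef : P.coeff k = d k * (1 / 288) ^ k := by
      simp only [P, finsetSum_coeff, coeff_C_mul_X_pow]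
      rw [Finset.sum_ite_eq, if_pos (Finset.mem_range.2 (by omega))]
    have hP : ∀ x : ℝ, 0 ≤ x → x ≤ 1 →
        ‖P.eval (x : ℂ)‖ ≤ A * ε ^ 2 + 2 * A * (1 / 144) ^ (N + 1) := by
      intro x hx0 hx1
      set y : ℝ := x / 288 with hy
      have hy0 : 0 ≤ y := by positivity
      have hy1 : y ≤ 1 / 288 := by rw [hy]; gcongr
      have hterm : ∀ i, ‖d i * (y : ℂ) ^ i‖ ≤ A * (1 / 144) ^ i := by
        intro i
        rw [norm_mul, norm_pow, Complex.norm_real, Real.norm_of_nonneg hy0]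
        have e : (1 / 144 : ℝ) ^ i = 2 ^ i * (1 / 288) ^ i := by rw [← mul_pow]; norm_num
        rw [e, ← mul_assoc]
        exact mul_le_mul (hd i) (by gcongr) (by positivity) (by positivity)
      have hgeo : Summable fun i : ℕ => A * (1 / 144 : ℝ) ^ i :=
        (summable_geometric_of_lt_one (by norm_num) (by norm_num)).mul_left A
      have hsum : Summable fun i => d i * (y : ℂ) ^ i := Summable.of_norm_bounded hgeo hterm
      have heval : P.eval (x : ℂ) = ∑ i ∈ Finset.range (N + 1), d i * (y : ℂ) ^ i := by
        simp only [P, eval_finsetSum, eval_mul, eval_C, eval_pow, eval_X]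
        refine Finset.sum_congr rfl fun i _ => ?_
        rw [hy]
        push_cast
        rw [div_pow, div_pow]
        ring
      have hsplit := hsum.sum_add_tsum_nat_add (N + 1)
      have htail : ‖∑' i, d (i + (N + 1)) * (y : ℂ) ^ (i + (N + 1))‖
          ≤ 2 * A * (1 / 144) ^ (N + 1) := by
        have hg : HasSum (fun i : ℕ => A * (1 / 144 : ℝ) ^ (N + 1) * (1 / 144 : ℝ) ^ i)
            (A * (1 / 144 : ℝ) ^ (N + 1) * (1 - 1 / 144)⁻¹) :=
          (hasSum_geometric_of_lt_one (by norm_num) (by norm_num)).mul_left _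
        refine (tsum_of_norm_bounded hg fun i => ?_).trans ?_
        · refine (hterm _).trans (le_of_eq ?_)
          rw [pow_add]; ring
        · have : (0 : ℝ) ≤ A * (1 / 144 : ℝ) ^ (N + 1) := by positivity
          calc _ ≤ A * (1 / 144 : ℝ) ^ (N + 1) * 2 := by gcongr; norm_num
            _ = _ := by ring
      have e : P.eval (x : ℂ) = (∑' i, d i * (y : ℂ) ^ i)
          - ∑' i, d (i + (N + 1)) * (y : ℂ) ^ (i + (N + 1)) := by
        rw [heval, ← hsplit]; ring
      rw [e]
      exact (norm_sub_le _ _).trans (add_le_add (hs y ⟨hy0, by linarith⟩) htail)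
    have hc := norm_coeff_le_of_unitInterval hdeg hP k
    rw [hcoef, norm_mul, norm_pow] at hc
    have e1 : ‖(1 / 288 : ℂ)‖ = 1 / 288 := by norm_num
    rw [e1, one_div, inv_pow, ← div_eq_mul_inv, div_le_iff₀ (by positivity)] at hc
    refine hc.trans ?_
    have h5 : (12 : ℝ) ^ N * (A * ε ^ 2) ≤ A * ε := by
      calc (12 : ℝ) ^ N * (A * ε ^ 2) = A * ε * (12 ^ N * ε) := by ring
        _ ≤ A * ε * 1 := by gcongr
        _ = _ := mul_one _
    have h6 : (12 : ℝ) ^ N * (2 * A * (1 / 144) ^ (N + 1)) ≤ A * ε := by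
      have e2 : (1 / 144 : ℝ) ^ (N + 1) = 1 / (12 ^ (N + 1) * (12 ^ N * 12)) := by
        rw [div_pow, one_pow, ← pow_succ, ← mul_pow]; norm_num
      rw [e2]
      have h7 : (1 : ℝ) / 12 ^ (N + 1) ≤ ε := by
        rw [div_le_iff₀ (by positivity), mul_comm]; exact hNe'
      calc (12 : ℝ) ^ N * (2 * A * (1 / (12 ^ (N + 1) * (12 ^ N * 12))))
          = A * (1 / 12 ^ (N + 1)) * (1 / 6) := by field_simp; ring
        _ ≤ A * ε * 1 := by gcongr; norm_num
        _ = _ := mul_one _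
    have h8 : (12 : ℝ) ^ N * (A * ε ^ 2 + 2 * A * (1 / 144) ^ (N + 1)) ≤ 2 * A * ε := by
      linarith
    calc _ ≤ 2 * A * ε * 288 ^ k := by gcongr
      _ = _ := by ring

end PowerSeries

section Scales
open Polynomial

/-- `g` has an asymptotic expansion at `0` on `[0, R]` with bounds governed by `ρ` and `m`. -/
def TaylorBounded (m : ℕ → ℝ) (ρ R : ℝ) (g : ℝ → ℂ) : Prop :=
  ∃ a : ℕ → ℂ, (∀ k, ‖a k‖ ≤ ρ ^ k * m k) ∧ ∀ N, ∀ x ∈ Icc (0 : ℝ) R,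
    ‖g x - ∑ k ∈ Finset.range N, a k * (x : ℂ) ^ k‖ ≤ ρ ^ N * m N * x ^ N

lemma sum_half_pow_le_two (N : ℕ) : ∑ k ∈ Finset.range N, (1 / 2 : ℝ) ^ k ≤ 2 := by
  have h := (summable_geometric_two).sum_le_tsum (Finset.range N)
    (fun _ _ => by positivity)
  rwa [tsum_geometric_two] at h

lemma natDegree_sum_C_mul_X_pow_le (b : ℕ → ℂ) (N : ℕ) :
    (∑ k ∈ Finset.range N, C (b k) * X ^ k).natDegree ≤ N :=
  natDegree_sum_le_of_forall_le _ _ fun _ hk =>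
    (natDegree_C_mul_X_pow_le _ _).trans (Finset.mem_range.1 hk).le

lemma norm_eval_sum_le_two {b : ℕ → ℂ} {N : ℕ} (hb : ∀ k < N, ‖b k‖ ≤ (1 / 4) ^ k) {z : ℂ}
    (hz : ‖z‖ ≤ 1) : ‖(∑ k ∈ Finset.range N, C (b k) * X ^ k).eval z‖ ≤ 2 := by
  rw [eval_finsetSum]
  refine (norm_sum_le _ _).trans ((Finset.sum_le_sum fun k hk => ?_).trans (sum_half_pow_le_two N))
  rw [eval_mul, eval_C, eval_pow, eval_X, norm_mul, norm_pow]
  calc ‖b k‖ * ‖z‖ ^ k ≤ (1 / 4) ^ k * 1 := by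
        gcongr
        · exact hb k (Finset.mem_range.1 hk)
        · exact pow_le_one₀ (norm_nonneg _) hz
    _ ≤ (1 / 2) ^ k := by rw [mul_one]; gcongr; norm_num

lemma norm_eval_derivative_sum_le_two {b : ℕ → ℂ} {N : ℕ} (hb : ∀ k < N, ‖b k‖ ≤ (1 / 4) ^ k)
    {z : ℂ} (hz : ‖z‖ ≤ 1) :
    ‖(derivative (∑ k ∈ Finset.range N, C (b k) * X ^ k)).eval z‖ ≤ 2 := by
  rw [derivative_sum, eval_finsetSum]
  refine (norm_sum_le _ _).trans ((Finset.sum_le_sum fun k hk => ?_).trans (sum_half_pow_le_two N))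
  rw [derivative_C_mul_X_pow, eval_mul, eval_C, eval_pow, eval_X, norm_mul, norm_pow, norm_mul,
    Complex.norm_natCast]
  have h2 : (k : ℝ) ≤ 2 ^ k := by exact_mod_cast (Nat.lt_two_pow_self (n := k)).le
  calc ‖b k‖ * k * ‖z‖ ^ (k - 1) ≤ (1 / 4) ^ k * 2 ^ k * 1 := by
        gcongr
        · exact hb k (Finset.mem_range.1 hk)
        · exact pow_le_one₀ (norm_nonneg _) hz
    _ = (1 / 2) ^ k := by rw [mul_one, ← mul_pow]; norm_num

/-- At a fixed scale `t`, a function two consecutive powers of which have good Taylor expansions is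
close to a power series. -/
lemma exists_powerSeries_at_scale {j : ℕ} (hj : 1 ≤ j) : ∃ A : ℝ, 1 ≤ A ∧
    ∀ (m : ℕ → ℝ) (ρ R t w η : ℝ) (N : ℕ) (u : ℝ → ℂ), 0 < ρ → 0 < t → 0 < w → w ≤ 1 →
      (∀ k, 0 ≤ m k) → η = (1 / 12) ^ (6 * j * (j + 1)) → η * t / (2 * ρ) ≤ R →
      (∀ k ≤ N, m k * t ^ k ≤ 1) → m N * t ^ N ≤ w ^ (24 * j * (j + 1)) →
      TaylorBounded m ρ R (fun x => u x ^ j) → TaylorBounded m ρ R (fun x => u x ^ (j + 1)) →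
      ∃ p : ℕ → ℂ, (∀ k, ‖p k‖ ≤ A) ∧ ∀ y ∈ Icc (0 : ℝ) (1 / 2),
        ‖u (η * t / (2 * ρ) * y) - ∑' k, p k * (y : ℂ) ^ k‖ ≤ A * w ^ 4 := by
  obtain ⟨A, hA, h⟩ := exists_powerSeries_approx hj
  refine ⟨A, hA, ?_⟩
  rintro m ρ R t w η N u hρ ht hw hw1 hm hη hR hmk hmN ⟨a, ha, hau⟩ ⟨b, hb, hbu⟩
  set τ := η * t / (2 * ρ) with hτ
  set e := 6 * j * (j + 1) with he
  have hη0 : 0 < η := by rw [hη]; positivity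
  have hη2 : η ≤ 1 / 2 := by
    rw [hη]
    refine (pow_le_of_le_one (by norm_num) (by norm_num) ?_).trans (by norm_num)
    positivity
  have hτ0 : 0 < τ := by positivity
  have hρτ : ρ * τ = η / 2 * t := by rw [hτ]; field_simp
  have hcoef : ∀ c : ℕ → ℂ, (∀ k, ‖c k‖ ≤ ρ ^ k * m k) →
      ∀ k < N, ‖c k * (τ : ℂ) ^ k‖ ≤ (1 / 4) ^ k := by
    intro c hc k hk
    rw [norm_mul, norm_pow, Complex.norm_real, Real.norm_of_nonneg hτ0.le]
    calc ‖c k‖ * τ ^ k ≤ ρ ^ k * m k * τ ^ k := by gcongr; exact hc k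
      _ = (ρ * τ) ^ k * m k := by rw [mul_pow]; ring
      _ = (η / 2) ^ k * (m k * t ^ k) := by rw [hρτ, mul_pow]; ring
      _ ≤ (1 / 4) ^ k * 1 :=
          mul_le_mul (pow_le_pow_left₀ (by positivity) (by linarith) _) (hmk k hk.le)
            (mul_nonneg (hm k) (by positivity)) (by positivity)
      _ = _ := mul_one _
  set σ := (1 / 12 : ℝ) ^ N * w ^ 4 with hσ
  have hσe : σ ^ e = η ^ N * w ^ (24 * j * (j + 1)) := by
    rw [hσ, mul_pow, ← pow_mul, ← pow_mul, hη, ← pow_mul, he]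
    congr 2 <;> ring
  have hrem : ∀ (c : ℕ → ℂ) (g : ℝ → ℂ), (∀ N, ∀ x ∈ Icc (0 : ℝ) R,
      ‖g x - ∑ k ∈ Finset.range N, c k * (x : ℂ) ^ k‖ ≤ ρ ^ N * m N * x ^ N) →
      ∀ y ∈ Icc (0 : ℝ) 1, ‖g (τ * y) -
        (∑ k ∈ Finset.range N, C (c k * (τ : ℂ) ^ k) * X ^ k).eval (y : ℂ)‖ ≤ σ ^ e := by
    intro c g hg y hy
    have h1 := hg N (τ * y) ⟨mul_nonneg hτ0.le hy.1,
      (mul_le_of_le_one_right hτ0.le hy.2).trans hR⟩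
    have h2 : (∑ k ∈ Finset.range N, C (c k * (τ : ℂ) ^ k) * X ^ k).eval (y : ℂ) =
        ∑ k ∈ Finset.range N, c k * ((τ * y : ℝ) : ℂ) ^ k := by
      rw [eval_finsetSum]
      refine Finset.sum_congr rfl fun k _ => ?_
      rw [eval_mul, eval_C, eval_pow, eval_X, Complex.ofReal_mul, mul_pow]; ring
    rw [h2]
    refine h1.trans ?_
    have hm' := hm N
    have hy0 := hy.1
    calc ρ ^ N * m N * (τ * y) ^ N ≤ ρ ^ N * m N * (τ * 1) ^ N := by gcongr; exact hy.2
      _ = (ρ * τ) ^ N * m N := by rw [mul_one, mul_pow]; ring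
      _ = (η / 2) ^ N * (m N * t ^ N) := by rw [hρτ, mul_pow]; ring
      _ ≤ η ^ N * w ^ (24 * j * (j + 1)) := by
          gcongr
          linarith
      _ = _ := hσe.symm
  obtain ⟨p, hp, hpu⟩ := h N σ _ _ (fun y => u (τ * y)) (by positivity)
    (by
      rw [hσ, ← mul_assoc, ← mul_pow]
      norm_num
      exact pow_le_one₀ hw.le hw1)
    (natDegree_sum_C_mul_X_pow_le (fun k => a k * (τ : ℂ) ^ k) N)
    (natDegree_sum_C_mul_X_pow_le (fun k => b k * (τ : ℂ) ^ k) N)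
    (fun z hz => norm_eval_sum_le_two (hcoef a ha) hz)
    (fun z hz => norm_eval_sum_le_two (hcoef b hb) hz)
    (fun z hz => norm_eval_derivative_sum_le_two (hcoef a ha) hz)
    (hrem a _ hau) (hrem b _ hbu)
  refine ⟨p, hp, fun y hy => (hpu y hy).trans ?_⟩
  gcongr
  rw [hσ]
  exact mul_le_of_le_one_left (by positivity) (pow_le_one₀ (by norm_num) (by norm_num))

end Scales

section Telescoping

lemma norm_mul_ofReal_pow_le {A y : ℝ} {b : ℂ} (hb : ‖b‖ ≤ A) (hy : 0 ≤ y) (k : ℕ) :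
    ‖b * (y : ℂ) ^ k‖ ≤ A * y ^ k := by
  rw [norm_mul, norm_pow, Complex.norm_real, Real.norm_of_nonneg hy]
  gcongr

lemma summable_mul_ofReal_pow {A y : ℝ} {b : ℕ → ℂ} (hb : ∀ k, ‖b k‖ ≤ A) (hy : 0 ≤ y)
    (hy1 : y < 1) : Summable fun k => b k * (y : ℂ) ^ k :=
  .of_norm_bounded ((summable_geometric_of_lt_one hy hy1).mul_left A)
    fun k => norm_mul_ofReal_pow_le (hb k) hy k

/-- Power series approximating a function at consecutive dyadic scales have close coefficients. -/
lemma norm_sub_coeff_consecutive_le {u : ℝ → ℂ} {A τ w w' : ℝ} {p p' : ℕ → ℂ} (hA : 1 ≤ A)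
    (hw' : 0 < w') (hww : w' ≤ w) (hw1 : w ≤ 1) (hp : ∀ k, ‖p k‖ ≤ A) (hp' : ∀ k, ‖p' k‖ ≤ A)
    (hu : ∀ y ∈ Icc (0 : ℝ) (1 / 2), ‖u (τ * y) - ∑' k, p k * (y : ℂ) ^ k‖ ≤ A * w ^ 4)
    (hu' : ∀ y ∈ Icc (0 : ℝ) (1 / 2), ‖u (τ / 2 * y) - ∑' k, p' k * (y : ℂ) ^ k‖ ≤ A * w' ^ 4)
    (k : ℕ) : ‖p' k * 2 ^ k - p k‖ ≤ 4 * A * 288 ^ k * w ^ 2 := by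
  have hw : 0 < w := hw'.trans_le hww
  have h := norm_coeff_le_of_powerSeries_small (d := fun k => p' k * 2 ^ k - p k) (A := 2 * A)
    (ε := w ^ 2) (by positivity) (by positivity) (pow_le_one₀ hw.le hw1) ?_ ?_ k
  · calc _ ≤ 2 * (2 * A) * 288 ^ k * w ^ 2 := h
      _ = _ := by ring
  · intro k
    have h2 : (1 : ℝ) ≤ 2 ^ k := one_le_pow₀ (by norm_num)
    calc ‖p' k * 2 ^ k - p k‖ ≤ ‖p' k * 2 ^ k‖ + ‖p k‖ := norm_sub_le _ _
      _ ≤ A * 2 ^ k + A * 2 ^ k := by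
          refine add_le_add ?_ ((hp k).trans (le_mul_of_one_le_right (by positivity) h2))
          rw [norm_mul, norm_pow, Complex.norm_ofNat]
          gcongr
          exact hp' k
      _ = _ := by ring
  · intro y hy
    have h1 := hu y ⟨hy.1, by linarith [hy.2]⟩
    have h2 := hu' (2 * y) ⟨by linarith [hy.1], by linarith [hy.2]⟩
    rw [show τ / 2 * (2 * y) = τ * y by ring] at h2
    have s1 := summable_mul_ofReal_pow hp hy.1 (by linarith [hy.2])
    have s2 := summable_mul_ofReal_pow hp' (y := 2 * y) (by linarith [hy.1]) (by linarith [hy.2])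
    have e : ∑' k, (p' k * 2 ^ k - p k) * (y : ℂ) ^ k =
        ∑' k, p' k * ((2 * y : ℝ) : ℂ) ^ k - ∑' k, p k * (y : ℂ) ^ k := by
      rw [← s2.tsum_sub s1]
      refine tsum_congr fun k => ?_
      push_cast
      ring
    rw [e]
    calc ‖∑' k, p' k * ((2 * y : ℝ) : ℂ) ^ k - ∑' k, p k * (y : ℂ) ^ k‖
        = ‖(u (τ * y) - ∑' k, p k * (y : ℂ) ^ k) -
            (u (τ * y) - ∑' k, p' k * ((2 * y : ℝ) : ℂ) ^ k)‖ := by congr 1; ring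
      _ ≤ A * w ^ 4 + A * w' ^ 4 := (norm_sub_le _ _).trans (add_le_add h1 h2)
      _ ≤ A * w ^ 4 + A * w ^ 4 := by gcongr
      _ = _ := by ring

/-- A function that is well approximated by power series at every dyadic scale is well approximated
by polynomials of every degree. -/
lemma exists_poly_approx {u : ℝ → ℂ} {A τ E : ℝ} {w s : ℕ → ℝ} {p : ℕ → ℕ → ℂ} (hA : 1 ≤ A)
    (hτ : 0 < τ) (hE : 0 < E) (hw : ∀ i, 0 < w i) (hw1 : ∀ i, w i ≤ 1) (hwa : Antitone w)
    (hws : ∀ i n, w i ≤ E ^ n * s n * (τ / 2 ^ i) ^ n) (hp : ∀ i k, ‖p i k‖ ≤ A)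
    (hu : ∀ i, ∀ y ∈ Icc (0 : ℝ) (1 / 2),
      ‖u (τ / 2 ^ i * y) - ∑' k, p i k * (y : ℂ) ^ k‖ ≤ A * w i ^ 4)
    {T : ℝ} (hT : 0 < T) (hTτ : 1152 * T ≤ τ) (n : ℕ) :
    ∃ c : ℕ → ℂ, ∀ x ∈ Icc (0 : ℝ) T, ‖u x - ∑ k ∈ Finset.range n, c k * (x : ℂ) ^ k‖ ≤
      (A + 2 * A / w 0 + 16 * A * E * s 1 * τ) * (2304 * E) ^ n * s n * T ^ n := by
  obtain ⟨i, hi1, hi2⟩ := exists_nat_pow_near (x := τ / (1152 * T))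
    (by rw [one_le_div (by positivity)]; exact hTτ) (by norm_num : (1 : ℝ) < 2)
  have hs : ∀ n, 0 < s n := fun n => by
    have h := (hw 0).trans_le (hws 0 n)
    have h2 : 0 < E ^ n * (τ / 2 ^ 0) ^ n := by positivity
    by_contra hc
    have : E ^ n * s n * (τ / 2 ^ 0) ^ n = s n * (E ^ n * (τ / 2 ^ 0) ^ n) := by ring
    nlinarith
  have hT1 : 1152 * T ≤ τ / 2 ^ i := by
    rw [le_div_iff₀ (by positivity)] at hi1 ⊢
    linarith
  have hT2 : τ / 2 ^ i ≤ 2304 * T := by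
    rw [div_lt_iff₀ (by positivity), pow_succ] at hi2
    rw [div_le_iff₀ (by positivity)]
    linarith
  set c : ℕ → ℕ → ℂ := fun i k => p i k / ((τ / 2 ^ i : ℝ) : ℂ) ^ k with hc
  have hτi : ∀ i : ℕ, 0 < τ / 2 ^ i := fun i => by positivity
  have hstep : ∀ i k, ‖c (i + 1) k - c i k‖ ≤ 4 * A * (288 / (τ / 2 ^ i)) ^ k * w i ^ 2 := by
    intro i k
    have h := norm_sub_coeff_consecutive_le hA (hw (i + 1)) (hwa (Nat.le_succ i)) (hw1 i) (hp i)
      (hp (i + 1)) (hu i) (by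
        have := hu (i + 1)
        rwa [pow_succ, ← div_div] at this) k
    have e : c (i + 1) k - c i k =
        (p (i + 1) k * 2 ^ k - p i k) / ((τ / 2 ^ i : ℝ) : ℂ) ^ k := by
      have h0 : ((τ : ℝ) : ℂ) ≠ 0 := by exact_mod_cast hτ.ne'
      simp only [hc]
      push_cast
      rw [sub_div, pow_succ (2 : ℂ) i, ← div_div, div_pow (_ / _) (2 : ℂ)]
      field_simp
    rw [e, norm_div, norm_pow, Complex.norm_real, Real.norm_of_nonneg (hτi i).le,
      div_pow 288, div_le_iff₀ (by positivity)]
    refine h.trans_eq ?_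
    have := (pow_pos (hτi i) k).ne'
    field_simp
  have hci : ∀ i k, ‖c i k‖ ≤ A * (1 / τ) ^ k +
      ∑ i' ∈ Finset.range i, 4 * A * (288 / (τ / 2 ^ i')) ^ k * w i' ^ 2 := by
    intro i k
    induction i with
    | zero =>
      simp only [hc, pow_zero, div_one, Finset.range_zero, Finset.sum_empty, add_zero]
      rw [norm_div, norm_pow, Complex.norm_real, Real.norm_of_nonneg hτ.le, div_pow, one_pow,
        mul_one_div]
      gcongr
      exact hp 0 k
    | succ i ih =>
      rw [Finset.sum_range_succ, ← add_assoc]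
      calc ‖c (i + 1) k‖ = ‖c i k + (c (i + 1) k - c i k)‖ := by congr 1; ring
        _ ≤ _ := (norm_add_le _ _).trans (add_le_add ih (hstep i k))
  set L := A * (T / τ) ^ n +
    ∑ i' ∈ Finset.range i, 4 * A * (288 * T / (τ / 2 ^ i')) ^ n * w i' ^ 2 with hL
  have hratio : ∀ {r : ℝ} (k : ℕ), 0 ≤ r → r ≤ 1 / 2 → r ^ (k + n) ≤ r ^ n * (1 / 2) ^ k := by
    intro r k h0 h1
    rw [pow_add, mul_comm]
    gcongr
  have htail : ∀ k, ‖c i (k + n)‖ * T ^ (k + n) ≤ L * (1 / 2) ^ k := by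
    intro k
    calc ‖c i (k + n)‖ * T ^ (k + n) ≤ (A * (1 / τ) ^ (k + n) +
          ∑ i' ∈ Finset.range i, 4 * A * (288 / (τ / 2 ^ i')) ^ (k + n) * w i' ^ 2) *
            T ^ (k + n) := by gcongr; exact hci i _
      _ = A * (T / τ) ^ (k + n) +
          ∑ i' ∈ Finset.range i, 4 * A * (288 * T / (τ / 2 ^ i')) ^ (k + n) * w i' ^ 2 := by
          rw [add_mul, Finset.sum_mul]
          congr 1
          · rw [mul_assoc, ← mul_pow]; congr 2; ring
          · refine Finset.sum_congr rfl fun i' _ => ?_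
            rw [show 288 * T / (τ / 2 ^ i') = 288 / (τ / 2 ^ i') * T by ring, mul_pow]
            ring
      _ ≤ A * ((T / τ) ^ n * (1 / 2) ^ k) + ∑ i' ∈ Finset.range i,
            4 * A * ((288 * T / (τ / 2 ^ i')) ^ n * (1 / 2) ^ k) * w i' ^ 2 := by
          gcongr with i' hi'
          · refine hratio k (by positivity) ?_
            rw [div_le_iff₀ hτ]; linarith
          · refine hratio k (by positivity) ?_
            rw [div_le_iff₀ (hτi i')]
            have : τ / 2 ^ i ≤ τ / 2 ^ i' := by
              gcongr
              · norm_num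
              · exact (Finset.mem_range.1 hi').le
            linarith
      _ = L * (1 / 2) ^ k := by
          rw [hL, add_mul, Finset.sum_mul]
          congr 1
          · ring
          · refine Finset.sum_congr rfl fun i' _ => ?_
            ring
  have hL0 : (T / τ) ^ n ≤ E ^ n * s n * T ^ n / w 0 := by
    rw [le_div_iff₀ (hw 0)]
    calc (T / τ) ^ n * w 0 ≤ (T / τ) ^ n * (E ^ n * s n * (τ / 2 ^ 0) ^ n) := by
          gcongr; exact hws 0 n
      _ = E ^ n * s n * ((T / τ) * τ) ^ n := by rw [pow_zero, div_one, mul_pow]; ring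
      _ = _ := by rw [div_mul_cancel₀ _ hτ.ne']
  have hsum : ∑ i' ∈ Finset.range i, 4 * A * (288 * T / (τ / 2 ^ i')) ^ n * w i' ^ 2 ≤
      8 * A * E * s 1 * τ * ((288 * E) ^ n * s n * T ^ n) := by
    have hterm : ∀ i', 4 * A * (288 * T / (τ / 2 ^ i')) ^ n * w i' ^ 2 ≤
        4 * A * E * s 1 * τ * ((288 * E) ^ n * s n * T ^ n) * (1 / 2) ^ i' := by
      intro i'
      have h1 := hws i' n
      have h2 := hws i' 1
      have := hs n
      have := hs 1
      have := hτi i'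
      calc 4 * A * (288 * T / (τ / 2 ^ i')) ^ n * w i' ^ 2
          = 4 * A * (288 * T / (τ / 2 ^ i')) ^ n * (w i' * w i') := by ring
        _ ≤ 4 * A * (288 * T / (τ / 2 ^ i')) ^ n *
            ((E ^ n * s n * (τ / 2 ^ i') ^ n) * (E ^ 1 * s 1 * (τ / 2 ^ i') ^ 1)) := by
            have := hw i'
            gcongr
        _ = 4 * A * ((288 * T / (τ / 2 ^ i')) * (τ / 2 ^ i')) ^ n *
            (E ^ n * s n * (E * s 1 * (τ / 2 ^ i'))) := by rw [mul_pow]; ring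
        _ = _ := by
            rw [div_mul_cancel₀ _ (hτi i').ne', mul_pow, mul_pow, one_div, inv_pow]
            ring
    calc _ ≤ ∑ i' ∈ Finset.range i,
          4 * A * E * s 1 * τ * ((288 * E) ^ n * s n * T ^ n) * (1 / 2) ^ i' :=
          Finset.sum_le_sum fun i' _ => hterm i'
      _ = 4 * A * E * s 1 * τ * ((288 * E) ^ n * s n * T ^ n) *
          ∑ i' ∈ Finset.range i, (1 / 2) ^ i' := by rw [Finset.mul_sum]
      _ ≤ 4 * A * E * s 1 * τ * ((288 * E) ^ n * s n * T ^ n) * 2 := by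
          have := hs n
          have := hs 1
          gcongr
          exact sum_half_pow_le_two i
      _ = _ := by ring
  have hwi : w i ^ 4 ≤ (2304 * E) ^ n * s n * T ^ n := by
    have := hs n
    calc w i ^ 4 ≤ w i := pow_le_of_le_one (hw i).le (hw1 i) (by norm_num)
      _ ≤ E ^ n * s n * (2304 * T) ^ n := (hws i n).trans (by have := hτi i; gcongr)
      _ = _ := by rw [mul_pow, mul_pow]; ring
  have hfin : A * w i ^ 4 + 2 * L ≤
      (A + 2 * A / w 0 + 16 * A * E * s 1 * τ) * (2304 * E) ^ n * s n * T ^ n := by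
    have := hs n
    have := hs 1
    have := hw 0
    have e1 : E ^ n * s n * T ^ n ≤ (2304 * E) ^ n * s n * T ^ n := by
      gcongr; linarith
    have e2 : (288 * E) ^ n * s n * T ^ n ≤ (2304 * E) ^ n * s n * T ^ n := by
      gcongr; linarith
    set Y := (2304 * E) ^ n * s n * T ^ n with hY
    calc A * w i ^ 4 + 2 * L ≤ A * Y + 2 * (A * (Y / w 0) + 8 * A * E * s 1 * τ * Y) := by
          rw [hL]
          gcongr
          · exact hL0.trans (by gcongr)
          · exact hsum.trans (by gcongr)
      _ = (A + 2 * A / w 0 + 16 * A * E * s 1 * τ) * Y := by ring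
      _ = _ := by rw [hY]; ring
  refine ⟨c i, fun x hx => le_trans ?_ hfin⟩
  have hy : x / (τ / 2 ^ i) ∈ Icc (0 : ℝ) (1 / 2) :=
    ⟨div_nonneg hx.1 (hτi i).le, by rw [div_le_iff₀ (hτi i)]; linarith [hx.2]⟩
  have h1 := hu i _ hy
  rw [mul_div_cancel₀ _ (hτi i).ne'] at h1
  have e : ∀ k, p i k * ((x / (τ / 2 ^ i) : ℝ) : ℂ) ^ k = c i k * (x : ℂ) ^ k := by
    intro k
    simp only [hc]
    rw [Complex.ofReal_div, div_pow]
    ring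
  have hsm := summable_mul_ofReal_pow (hp i) hy.1 (by linarith [hy.2])
  simp only [e] at h1 hsm
  have h2 : ‖∑' k, c i (k + n) * (x : ℂ) ^ (k + n)‖ ≤ L * 2 := by
    refine tsum_of_norm_bounded (hasSum_geometric_two.mul_left L) fun k => ?_
    rw [norm_mul, norm_pow, Complex.norm_real, Real.norm_of_nonneg hx.1]
    refine le_trans ?_ (htail k)
    have := hx.1
    gcongr
    exact hx.2
  rw [← hsm.sum_add_tsum_nat_add n] at h1
  calc ‖u x - ∑ k ∈ Finset.range n, c i k * (x : ℂ) ^ k‖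
      = ‖(u x - (∑ k ∈ Finset.range n, c i k * (x : ℂ) ^ k +
          ∑' k, c i (k + n) * (x : ℂ) ^ (k + n))) +
          ∑' k, c i (k + n) * (x : ℂ) ^ (k + n)‖ := by congr 1; ring
    _ ≤ A * w i ^ 4 + L * 2 := (norm_add_le _ _).trans (add_le_add h1 h2)
    _ = _ := by ring

end Telescoping

section ForwardDifferences

lemma norm_sum_choose_smul_le {F : Type*} [NormedAddCommGroup F] {n : ℕ} {g : ℕ → F} {ε : ℝ}
    (hg : ∀ k ≤ n, ‖g k‖ ≤ ε) :
    ‖∑ k ∈ Finset.range (n + 1), ((-1 : ℤ) ^ (n - k) * n.choose k) • g k‖ ≤ 2 ^ n * ε := by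
  have h : ((2 : ℝ) ^ n) = ∑ k ∈ Finset.range (n + 1), (n.choose k : ℝ) := by
    exact_mod_cast (Nat.sum_range_choose n).symm
  rw [h, Finset.sum_mul]
  refine (norm_sum_le _ _).trans (Finset.sum_le_sum fun k hk => ?_)
  have h1 : ‖((-1 : ℤ) ^ (n - k) * n.choose k) • g k‖ = ‖(n.choose k : ℕ) • g k‖ := by
    rcases neg_one_pow_eq_or ℤ (n - k) with h | h <;> simp [h]
  rw [h1]
  refine (norm_nsmul_le).trans ?_
  gcongr
  exact hg k (Nat.lt_succ_iff.1 (Finset.mem_range.1 hk))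

lemma norm_fwdDiff_iter_le_of_poly_approx {u : ℝ → ℂ} {n : ℕ} {s ε : ℝ} (hs : 0 ≤ s) {c : ℕ → ℂ}
    (hc : ∀ x ∈ Icc (0 : ℝ) (n * s), ‖u x - ∑ k ∈ Finset.range n, c k * (x : ℂ) ^ k‖ ≤ ε) :
    ‖(fwdDiff s)^[n] u 0‖ ≤ 2 ^ n * ε := by
  have h0 := congrFun (fwdDiff_iter_sum_mul_pow_eq_zero (n := n) fun l => c l * (s : ℂ) ^ l) 0
  rw [fwdDiff_iter_eq_sum_shift, Pi.zero_apply] at h0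
  rw [fwdDiff_iter_eq_sum_shift, ← sub_zero (∑ _ ∈ _, _), ← h0, ← Finset.sum_sub_distrib]
  simp only [← smul_sub]
  refine norm_sum_choose_smul_le fun k hk => ?_
  have := hc (k * s) ⟨by positivity, by gcongr⟩
  refine le_of_eq_of_le ?_ this
  have e : ∀ l, c l * (s : ℂ) ^ l * (k * 1) ^ l = c l * ((k * s : ℝ) : ℂ) ^ l := fun l => by
    push_cast
    rw [mul_pow]
    ring
  simp only [e, zero_add, nsmul_eq_mul]

/-- Uniform bounds on iterated forward differences of a function two consecutive powers of which
have good Taylor expansions. -/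
lemma exists_fwdDiff_bound {W : Set (ℕ → ℝ)} (hW : RAdmissible W) {M : ℕ → ℝ} (hM : M ∈ W) {j : ℕ}
    (hj : 1 ≤ j) {ρ R : ℝ} (hρ : 0 < ρ) (hR : 0 < R) :
    ∃ Q ∈ W, ∃ C F T : ℝ, 0 < C ∧ 0 < F ∧ 0 < T ∧ ∀ u : ℝ → ℂ,
      TaylorBounded (lc M) ρ R (fun x => u x ^ j) →
      TaylorBounded (lc M) ρ R (fun x => u x ^ (j + 1)) →
      ∀ (n : ℕ) (s : ℝ), 0 < s → n * s ≤ T → ‖(fwdDiff s)^[n] u 0‖ ≤ C * F ^ n * Q n * s ^ n := by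
  obtain ⟨A, hA, hcore⟩ := exists_powerSeries_at_scale hj
  obtain ⟨Q, hQ, D, t₀, hD, ht₀, ω, hω, hωm, hωQ, hN⟩ := exists_approx_scale hW hM (24 * j * (j + 1))
  set η : ℝ := (1 / 12) ^ (6 * j * (j + 1)) with hη
  have hη0 : 0 < η := by positivity
  set t₁ := min t₀ (2 * ρ * R / η) with ht₁
  have ht₁0 : 0 < t₁ := lt_min ht₀ (by positivity)
  set τ := η * t₁ / (2 * ρ) with hτ
  have hτ0 : 0 < τ := by positivity
  have hτR : τ ≤ R := by
    rw [hτ, div_le_iff₀ (by positivity)]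
    have := min_le_right t₀ (2 * ρ * R / η)
    rw [← ht₁, le_div_iff₀ hη0] at this
    linarith
  have hmpos : ∀ k, 0 ≤ lc M k := fun k =>
    div_nonneg ((hW.matrix.weight M hM).pos k).le (Nat.cast_nonneg _)
  have hqpos : ∀ k, 0 < lc Q k := fun k =>
    div_pos ((hW.matrix.weight Q hQ).pos k) (by positivity)
  have ht : ∀ i : ℕ, 0 < t₁ / 2 ^ i := fun i => by positivity
  have ht1 : ∀ i : ℕ, t₁ / 2 ^ i ≤ t₁ := fun i =>
    div_le_self ht₁0.le (one_le_pow₀ (by norm_num))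
  have hE : 0 < D * (2 * ρ / η) := by positivity
  have hw0 := (hω t₁ ht₁0).1
  have hq1 := hqpos 1
  refine ⟨Q, hQ, A + 2 * A / ω t₁ + 16 * A * (D * (2 * ρ / η)) * lc Q 1 * τ,
    2 * (2304 * (D * (2 * ρ / η))) * 3, τ / 1152, by positivity, by positivity, by positivity, ?_⟩
  intro u hu1 hu2 n s hs hns
  have hscale : ∀ i : ℕ, ∃ p : ℕ → ℂ, (∀ k, ‖p k‖ ≤ A) ∧ ∀ y ∈ Icc (0 : ℝ) (1 / 2),
      ‖u (τ / 2 ^ i * y) - ∑' k, p k * (y : ℂ) ^ k‖ ≤ A * ω (t₁ / 2 ^ i) ^ 4 := by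
    intro i
    obtain ⟨N, -, hN1, hN2⟩ := hN (t₁ / 2 ^ i) (ht i) ((ht1 i).trans (min_le_left _ _))
    have e : η * (t₁ / 2 ^ i) / (2 * ρ) = τ / 2 ^ i := by rw [hτ]; ring
    have h := hcore (lc M) ρ R (t₁ / 2 ^ i) (ω (t₁ / 2 ^ i)) η N u hρ (ht i) (hω _ (ht i)).1
      (hω _ (ht i)).2 hmpos hη
      (by rw [e]; exact (div_le_self hτ0.le (one_le_pow₀ (by norm_num))).trans hτR)
      hN1 hN2 hu1 hu2
    rwa [e] at h
  choose p hp hpu using hscale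
  obtain ⟨T, hT0, hTτ, hsT, hTn⟩ : ∃ T : ℝ, 0 < T ∧ 1152 * T ≤ τ ∧ n * s ≤ T ∧
      T ^ n = (n * s) ^ n := by
    rcases Nat.eq_zero_or_pos n with rfl | hn
    · exact ⟨τ / 1152, by positivity, by linarith, hns, by simp⟩
    · exact ⟨n * s, by positivity, by linarith, le_rfl, rfl⟩
  obtain ⟨c, hc⟩ := exists_poly_approx (u := u) (w := fun i => ω (t₁ / 2 ^ i)) (s := lc Q) hA hτ0 hE
    (fun i => (hω _ (ht i)).1) (fun i => (hω _ (ht i)).2)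
    (fun i i' hii => hωm _ _ (ht i') (by gcongr; norm_num))
    (fun i k => (hωQ _ (ht i) k).trans_eq (by
      rw [mul_pow D, show τ / 2 ^ i = (t₁ / 2 ^ i) * (η / (2 * ρ)) by rw [hτ]; ring,
        mul_pow (t₁ / 2 ^ i),
        show D ^ k * (2 * ρ / η) ^ k * lc Q k * ((t₁ / 2 ^ i) ^ k * (η / (2 * ρ)) ^ k) =
          D ^ k * lc Q k * (t₁ / 2 ^ i) ^ k * ((2 * ρ / η) * (η / (2 * ρ))) ^ k by
            rw [mul_pow (2 * ρ / η)]; ring,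
        show (2 * ρ / η) * (η / (2 * ρ)) = 1 by field_simp, one_pow, mul_one]))
    hp hpu hT0 hTτ n
  refine (norm_fwdDiff_iter_le_of_poly_approx hs.le
    fun x hx => hc x ⟨hx.1, hx.2.trans hsT⟩).trans ?_
  have hqn := hqpos n
  simp only [pow_zero, div_one]
  set K := A + 2 * A / ω t₁ + 16 * A * (D * (2 * ρ / η)) * lc Q 1 * τ with hK
  have hK0 : 0 < K := by positivity
  set G := 2304 * (D * (2 * ρ / η)) with hG
  have hQn : lc Q n * n.factorial = Q n := by
    rw [lc, div_mul_cancel₀]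
    positivity
  rw [hTn]
  calc 2 ^ n * (K * G ^ n * lc Q n * (n * s) ^ n)
      = K * (2 ^ n * G ^ n) * lc Q n * ((n : ℝ) ^ n) * s ^ n := by rw [mul_pow]; ring
    _ ≤ K * (2 ^ n * G ^ n) * lc Q n * (3 ^ n * n.factorial) * s ^ n := by
        gcongr
        exact pow_self_le_three_pow_mul_factorial n
    _ = K * (2 * G * 3) ^ n * (lc Q n * n.factorial) * s ^ n := by
        rw [mul_pow (2 * G) 3, mul_pow 2 G]; ring
    _ = _ := by rw [hQn]

end ForwardDifferences

section Limits

variable {E F : Type*} [NormedAddCommGroup E] [NormedSpace ℝ E] [NormedAddCommGroup F]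
  [NormedSpace ℝ F]

lemma exists_tendsto_clm_of_forall_tendsto_apply [FiniteDimensional ℝ E]
    {L : ℕ → E →L[ℝ] F} (h : ∀ v, ∃ y, Tendsto (fun i => L i v) atTop (𝓝 y)) :
    ∃ L₀, Tendsto L atTop (𝓝 L₀) := by
  let d := Module.finrank ℝ E
  have hd : d = Module.finrank ℝ (Fin d → ℝ) := (Module.finrank_fin_fun ℝ).symm
  let e₁ : E ≃L[ℝ] Fin d → ℝ := ContinuousLinearEquiv.ofFinrankEq hd
  let e₂ : (E →L[ℝ] F) ≃L[ℝ] Fin d → F :=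
    (e₁.arrowCongr (1 : F ≃L[ℝ] F)).trans (ContinuousLinearEquiv.piRing (Fin d))
  choose y hy using h
  have h2 : Tendsto (fun i => e₂ (L i)) atTop
      (𝓝 fun k => y (e₁.symm (Pi.single k 1))) :=
    tendsto_pi_nhds.2 fun k => hy _
  refine ⟨e₂.symm fun k => y (e₁.symm (Pi.single k 1)), ?_⟩
  exact ((e₂.symm.continuous.tendsto _).comp h2).congr fun i => e₂.symm_apply_apply (L i)

/-- Quadratic remainder estimate for functions with Lipschitz derivative. -/
lemma norm_sub_sub_apply_le_of_lipschitz {V : Set E} (hV : Convex ℝ V) {h : E → F}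
    {h' : E → E →L[ℝ] F} {K : ℝ} (hK : 0 ≤ K) (hd : ∀ x ∈ V, HasFDerivAt h (h' x) x)
    (hL : ∀ x ∈ V, ∀ y ∈ V, ‖h' y - h' x‖ ≤ K * ‖y - x‖) {x y : E} (hx : x ∈ V) (hy : y ∈ V) :
    ‖h y - h x - h' x (y - x)‖ ≤ K * ‖y - x‖ * ‖y - x‖ := by
  have hs := hV.inter (convex_closedBall x ‖y - x‖)
  refine hs.norm_image_sub_le_of_norm_hasFDerivWithin_le'
    (fun z hz => (hd z hz.1).hasFDerivWithinAt) (fun z hz => ?_)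
    ⟨hx, mem_closedBall_self (norm_nonneg _)⟩ ⟨hy, by simp [dist_eq_norm]⟩
  refine (hL x hx z hz.1).trans ?_
  gcongr
  simpa [dist_eq_norm] using hz.2

/-- A pointwise limit of functions with equi-Lipschitz derivatives is differentiable. -/
lemma exists_hasFDerivAt_of_tendsto [FiniteDimensional ℝ E] [CompleteSpace F] {V : Set E}
    (hVo : IsOpen V) (hVc : Convex ℝ V) {h : ℕ → E → F} {g : E → F} {h' : ℕ → E → E →L[ℝ] F}
    {K : ℝ} (hK : 0 ≤ K) (hd : ∀ i, ∀ x ∈ V, HasFDerivAt (h i) (h' i x) x)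
    (hL : ∀ i, ∀ x ∈ V, ∀ y ∈ V, ‖h' i y - h' i x‖ ≤ K * ‖y - x‖)
    (hlim : ∀ x ∈ V, Tendsto (fun i => h i x) atTop (𝓝 (g x))) {x : E} (hx : x ∈ V) :
    ∃ L, HasFDerivAt g L x ∧ Tendsto (fun i => h' i x) atTop (𝓝 L) := by
  have hquad := fun i {y : E} (hy : y ∈ V) =>
    norm_sub_sub_apply_le_of_lipschitz hVc hK (hd i) (hL i) hx hy
  have hex : ∃ L, Tendsto (fun i => h' i x) atTop (𝓝 L) := by
    refine exists_tendsto_clm_of_forall_tendsto_apply fun v => ?_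
    refine cauchySeq_tendsto_of_complete (Metric.cauchySeq_iff.2 fun ε hε => ?_)
    have hnear : ∀ᶠ s : ℝ in 𝓝[>] 0, x + s • v ∈ V ∧ K * s * ‖v‖ * ‖v‖ < ε / 4 := by
      refine (Filter.Eventually.and ?_ ?_).filter_mono nhdsWithin_le_nhds
      · have : Tendsto (fun s : ℝ => x + s • v) (𝓝 0) (𝓝 (x + (0 : ℝ) • v)) :=
          Continuous.tendsto (by fun_prop) 0
        rw [zero_smul, add_zero] at this
        exact this (hVo.mem_nhds hx)
      · have : Tendsto (fun s : ℝ => K * s * ‖v‖ * ‖v‖) (𝓝 0) (𝓝 (K * 0 * ‖v‖ * ‖v‖)) :=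
          Continuous.tendsto (by fun_prop) 0
        rw [mul_zero, zero_mul, zero_mul] at this
        exact this.eventually_lt_const (by linarith)
    obtain ⟨s, ⟨hsV, hsK⟩, hs⟩ := (hnear.and self_mem_nhdsWithin).exists
    have hs : 0 < s := hs
    have happ : ∀ i, ‖s⁻¹ • (h i (x + s • v) - h i x) - h' i x v‖ < ε / 4 := by
      intro i
      have h1 := hquad i hsV
      rw [add_sub_cancel_left, map_smul, norm_smul, Real.norm_of_nonneg hs.le] at h1
      have e : s⁻¹ • (h i (x + s • v) - h i x) - h' i x v =
          s⁻¹ • (h i (x + s • v) - h i x - s • h' i x v) := by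
        rw [smul_sub s⁻¹ (_ - _), inv_smul_smul₀ hs.ne']
      rw [e, norm_smul, norm_inv, Real.norm_of_nonneg hs.le]
      calc s⁻¹ * ‖h i (x + s • v) - h i x - s • h' i x v‖
          ≤ s⁻¹ * (K * (s * ‖v‖) * (s * ‖v‖)) := by gcongr
        _ = K * s * ‖v‖ * ‖v‖ := by field_simp
        _ < _ := hsK
    have hq : Tendsto (fun i => s⁻¹ • (h i (x + s • v) - h i x)) atTop
        (𝓝 (s⁻¹ • (g (x + s • v) - g x))) :=
      ((hlim _ hsV).sub (hlim x hx)).const_smul _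
    obtain ⟨N, hN⟩ := Metric.cauchySeq_iff.1 hq.cauchySeq (ε / 2) (by linarith)
    refine ⟨N, fun m hm n hn => ?_⟩
    have h1 := happ m
    have h2 := happ n
    have h3 := hN m hm n hn
    rw [← dist_eq_norm] at h1 h2
    rw [dist_comm] at h1
    linarith [dist_triangle4 (h' m x v) (s⁻¹ • (h m (x + s • v) - h m x))
      (s⁻¹ • (h n (x + s • v) - h n x)) (h' n x v)]
  obtain ⟨L, hLlim⟩ := hex
  refine ⟨L, ?_, hLlim⟩
  have hlimq : ∀ y ∈ V, ‖g y - g x - L (y - x)‖ ≤ K * ‖y - x‖ * ‖y - x‖ := by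
    intro y hy
    have ht : Tendsto (fun i => ‖h i y - h i x - h' i x (y - x)‖) atTop
        (𝓝 ‖g y - g x - L (y - x)‖) :=
      (((hlim y hy).sub (hlim x hx)).sub
        (((ContinuousLinearMap.apply ℝ F (y - x)).continuous.tendsto L).comp hLlim)).norm
    exact le_of_tendsto' ht fun i => hquad i hy
  refine HasFDerivAt.of_isLittleO (Asymptotics.isLittleO_iff.2 fun c hc => ?_)
  have hnear : ∀ᶠ y in 𝓝 x, K * ‖y - x‖ < c := by
    have : Tendsto (fun y => K * ‖y - x‖) (𝓝 x) (𝓝 (K * ‖x - x‖)) :=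
      Continuous.tendsto (by fun_prop) x
    rw [sub_self, norm_zero, mul_zero] at this
    exact this.eventually_lt_const hc
  filter_upwards [hnear, hVo.mem_nhds hx] with y hy1 hy2
  exact (hlimq y hy2).trans (by gcongr)

/-- A pointwise limit of smooth functions with derivatives of all orders bounded uniformly along the
sequence is smooth, and inherits the bounds. -/
lemma contDiffOn_of_tendsto_of_iteratedFDeriv_le [FiniteDimensional ℝ E] [CompleteSpace F]
    {V : Set E} (hVo : IsOpen V) (hVc : Convex ℝ V) {h : ℕ → E → F} {g : E → F} {L : ℕ → ℝ}
    (hs : ∀ i, ContDiff ℝ (⊤ : ℕ∞) (h i))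
    (hL : ∀ i n, ∀ x ∈ V, ‖iteratedFDeriv ℝ n (h i) x‖ ≤ L n)
    (hlim : ∀ x ∈ V, Tendsto (fun i => h i x) atTop (𝓝 (g x))) :
    ContDiffOn ℝ (⊤ : ℕ∞) g V ∧ ∀ n, ∀ x ∈ V, ‖iteratedFDeriv ℝ n g x‖ ≤ L n := by
  rcases V.eq_empty_or_nonempty with rfl | ⟨x₀, hx₀⟩
  · exact ⟨fun x hx => hx.elim, fun n x hx => hx.elim⟩
  have hL0 : ∀ n, 0 ≤ L n := fun n => (norm_nonneg _).trans (hL 0 n x₀ hx₀)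
  have hdiff : ∀ i n, Differentiable ℝ (iteratedFDeriv ℝ n (h i)) := fun i n =>
    (hs i).differentiable_iteratedFDeriv (by exact_mod_cast WithTop.coe_lt_top _)
  have hfnorm : ∀ i n x, ‖fderiv ℝ (iteratedFDeriv ℝ n (h i)) x‖ =
      ‖iteratedFDeriv ℝ (n + 1) (h i) x‖ := fun i n x => norm_fderiv_iteratedFDeriv
  have hstep : ∀ n, (∀ x ∈ V, Tendsto (fun i => iteratedFDeriv ℝ n (h i) x) atTop
      (𝓝 (iteratedFDeriv ℝ n g x))) → ∀ x ∈ V, DifferentiableAt ℝ (iteratedFDeriv ℝ n g) x ∧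
        Tendsto (fun i => iteratedFDeriv ℝ (n + 1) (h i) x) atTop
          (𝓝 (iteratedFDeriv ℝ (n + 1) g x)) := by
    intro n hn x hx
    have hLip : ∀ i, ∀ x ∈ V, ∀ y ∈ V, ‖fderiv ℝ (iteratedFDeriv ℝ n (h i)) y -
        fderiv ℝ (iteratedFDeriv ℝ n (h i)) x‖ ≤ L (n + 2) * ‖y - x‖ := by
      intro i x hx y hy
      have e : ∀ z, fderiv ℝ (iteratedFDeriv ℝ n (h i)) z =
          (continuousMultilinearCurryLeftEquiv ℝ (fun _ : Fin (n + 1) => E) F)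
            (iteratedFDeriv ℝ (n + 1) (h i) z) := fun z => by
        rw [iteratedFDeriv_succ_eq_comp_left]; simp
      rw [e, e, ← dist_eq_norm (E := E →L[ℝ] E [×n]→L[ℝ] F), LinearIsometryEquiv.dist_map,
        dist_eq_norm]
      exact hVc.norm_image_sub_le_of_norm_fderiv_le (fun z _ => hdiff i (n + 1) z)
        (fun z hz => (hfnorm i (n + 1) z).le.trans (hL i (n + 2) z hz)) hx hy
    obtain ⟨Λ, h1, h2⟩ := exists_hasFDerivAt_of_tendsto hVo hVc (hL0 (n + 2))
      (fun i x _ => (hdiff i n x).hasFDerivAt) hLip hn hx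
    refine ⟨h1.differentiableAt, ?_⟩
    simp only [iteratedFDeriv_succ_eq_comp_left, Function.comp_apply]
    rw [h1.fderiv]
    exact ((LinearIsometryEquiv.continuous _).tendsto _).comp h2
  have hall : ∀ n, ∀ x ∈ V, Tendsto (fun i => iteratedFDeriv ℝ n (h i) x) atTop
      (𝓝 (iteratedFDeriv ℝ n g x)) := by
    intro n
    induction n with
    | zero =>
      intro x hx
      simp only [iteratedFDeriv_zero_eq_comp, Function.comp_apply]
      exact ((LinearIsometryEquiv.continuous _).tendsto _).comp (hlim x hx)
    | succ n ih => exact fun x hx => (hstep n ih x hx).2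
  refine ⟨contDiffOn_of_differentiableOn fun n _ => ?_, fun n x hx =>
    le_of_tendsto' (hall n x hx).norm fun i => hL i n x hx⟩
  refine DifferentiableOn.congr (fun x hx => ((hstep n (hall n) x hx).1).differentiableWithinAt)
    fun x hx => iteratedFDerivWithin_of_isOpen n hVo hx

end Limits

section Symmetry

variable {E F : Type*} [NormedAddCommGroup E] [NormedSpace ℝ E] [NormedAddCommGroup F]
  [NormedSpace ℝ F]

lemma differentiable_iteratedFDeriv_of_smooth {h : E → F} (hh : ContDiff ℝ (⊤ : ℕ∞) h) (n : ℕ) :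
    Differentiable ℝ (iteratedFDeriv ℝ n h) :=
  hh.differentiable_iteratedFDeriv (by exact_mod_cast WithTop.coe_lt_top _)

lemma iteratedFDeriv_comp_swap_succ {h : E → F} (hh : ContDiff ℝ (⊤ : ℕ∞) h) (n : ℕ) (x : E)
    (i : Fin n) (v : Fin (n + 1) → E) :
    iteratedFDeriv ℝ (n + 1) h x (v ∘ Equiv.swap i.castSucc i.succ) =
      iteratedFDeriv ℝ (n + 1) h x v := by
  induction n generalizing x with
  | zero => exact i.elim0
  | succ n ih =>
    rcases Fin.eq_zero_or_eq_succ i with rfl | ⟨k, rfl⟩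
    · have hD : ∀ w : Fin (n + 2) → E, iteratedFDeriv ℝ (n + 2) h x w =
          fderiv ℝ (fderiv ℝ (iteratedFDeriv ℝ n h)) x (w 0) (w 1) (fun k => w k.succ.succ) := by
        intro w
        have hd : DifferentiableAt ℝ (fderiv ℝ (iteratedFDeriv ℝ n h)) x := by
          have : ContDiff ℝ 2 (iteratedFDeriv ℝ n h) :=
            hh.iteratedFDeriv_right (m := 2) (i := n) 
              (WithTop.coe_le_coe.2 (le_top : (2 + n : ℕ∞) ≤ ⊤))
          exact (this.fderiv_right (m := 1) (by norm_num)).differentiable (by norm_num) x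
        rw [iteratedFDeriv_succ_apply_left]
        have e : (fun y => iteratedFDeriv ℝ (n + 1) h y (Fin.tail w)) =
            fun y => fderiv ℝ (iteratedFDeriv ℝ n h) y (w 1) (fun k => w k.succ.succ) := by
          funext y
          rw [iteratedFDeriv_succ_apply_left]
          rfl
        have h1 : fderiv ℝ (iteratedFDeriv ℝ (n + 1) h) x (w 0) (Fin.tail w) =
            fderiv ℝ (fun y => iteratedFDeriv ℝ (n + 1) h y (Fin.tail w)) x (w 0) := by
          rw [fderiv_continuousMultilinear_apply_const_apply
            (differentiable_iteratedFDeriv_of_smooth hh (n + 1) x)]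
        rw [h1, e, fderiv_continuousMultilinear_apply_const_apply
          (hd.clm_apply (differentiableAt_const _)), fderiv_clm_apply hd (differentiableAt_const _)]
        simp
      have hsymm : IsSymmSndFDerivAt ℝ (iteratedFDeriv ℝ n h) x := by
        have : ContDiff ℝ 2 (iteratedFDeriv ℝ n h) :=
          hh.iteratedFDeriv_right (m := 2) (i := n) 
              (WithTop.coe_le_coe.2 (le_top : (2 + n : ℕ∞) ≤ ⊤))
        exact this.contDiffAt.isSymmSndFDerivAt (by simp)
      rw [hD, hD]
      simp only [Function.comp_apply, Fin.castSucc_zero, Fin.succ_zero_eq_one,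
        Equiv.swap_apply_left, Equiv.swap_apply_right]
      rw [hsymm.eq]
      congr 1
    · have hD : ∀ w : Fin (n + 2) → E, iteratedFDeriv ℝ (n + 2) h x w =
          fderiv ℝ (fun y => iteratedFDeriv ℝ (n + 1) h y (Fin.tail w)) x (w 0) := by
        intro w
        rw [iteratedFDeriv_succ_apply_left, fderiv_continuousMultilinear_apply_const_apply
            (differentiable_iteratedFDeriv_of_smooth hh (n + 1) x)]
      have ht : Fin.tail (v ∘ Equiv.swap k.succ.castSucc k.succ.succ) =
          Fin.tail v ∘ Equiv.swap k.castSucc k.succ := by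
        funext l
        simp only [Fin.tail, Function.comp_apply, ← Fin.succ_castSucc]
        rw [← (Fin.succ_injective (n + 1)).map_swap]
      have h0 : (v ∘ Equiv.swap k.succ.castSucc k.succ.succ) 0 = v 0 := by
        rw [Function.comp_apply, Equiv.swap_apply_of_ne_of_ne]
        · rw [← Fin.succ_castSucc]; exact (Fin.succ_ne_zero _).symm
        · exact (Fin.succ_ne_zero _).symm
      rw [hD, hD, ht, h0]
      simp only [ih]

/-- The iterated derivatives of a smooth function are symmetric. -/
lemma iteratedFDeriv_comp_perm_of_smooth {h : E → F} (hh : ContDiff ℝ (⊤ : ℕ∞) h) (n : ℕ) (x : E)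
    (σ : Equiv.Perm (Fin n)) (v : Fin n → E) :
    iteratedFDeriv ℝ n h x (v ∘ σ) = iteratedFDeriv ℝ n h x v := by
  rcases n with _ | n
  · congr 1
    exact Subsingleton.elim _ _
  have hσ : σ ∈ Submonoid.closure
      (Set.range fun i : Fin n => Equiv.swap i.castSucc i.succ) := by
    rw [Equiv.Perm.mclosure_swap_castSucc_succ]; trivial
  induction hσ using Submonoid.closure_induction generalizing v with
  | mem σ hσ =>
    obtain ⟨i, rfl⟩ := hσ
    exact iteratedFDeriv_comp_swap_succ hh n x i v
  | one => rfl
  | mul σ τ _ _ h1 h2 =>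
    rw [Equiv.Perm.coe_mul, ← Function.comp_assoc, h2, h1]

end Symmetry

section Polarization

variable {E F : Type*} [NormedAddCommGroup E] [NormedSpace ℝ E] [NormedAddCommGroup F]
  [NormedSpace ℝ F]

lemma sum_powerset_neg_one_pow_range_subset {n : ℕ} (r : Fin n → Fin n) :
    ∑ S : Finset (Fin n), (-1 : ℝ) ^ (Sᶜ).card * (if ∀ i, r i ∈ S then 1 else 0) =
      if Function.Surjective r then 1 else 0 := by
  have h := Finset.prod_add (fun _ : Fin n => (1 : ℝ))
    (fun i => if i ∈ Set.range r then 0 else -1) Finset.univ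
  have hl : ∏ i : Fin n, ((1 : ℝ) + if i ∈ Set.range r then 0 else -1) =
      if Function.Surjective r then 1 else 0 := by
    split_ifs with hr
    · exact Finset.prod_eq_one fun i _ => by rw [if_pos (mem_range.2 (hr i)), add_zero]
    · simp only [Function.Surjective, not_forall] at hr
      obtain ⟨i, hi⟩ := hr
      exact Finset.prod_eq_zero (Finset.mem_univ i) (by rw [if_neg (mt mem_range.1 hi)]; norm_num)
  rw [← hl, h, Finset.powerset_univ]
  refine Finset.sum_congr rfl fun S _ => ?_
  rw [Finset.prod_const_one, one_mul]
  split_ifs with hS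
  · rw [mul_one, ← Finset.compl_eq_univ_sdiff, ← Finset.prod_const]
    refine Finset.prod_congr rfl fun i hi => ?_
    rw [if_neg]
    rintro ⟨k, rfl⟩
    exact Finset.mem_compl.1 hi (hS k)
  · push Not at hS
    obtain ⟨k, hk⟩ := hS
    rw [mul_zero, ← Finset.compl_eq_univ_sdiff]
    exact (Finset.prod_eq_zero (Finset.mem_compl.2 hk) (by simp)).symm

/-- The polarization identity for symmetric multilinear maps. -/
lemma factorial_smul_eq_sum_diagonal {n : ℕ} (T : MultilinearMap ℝ (fun _ : Fin n => E) F)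
    (hT : ∀ (σ : Equiv.Perm (Fin n)) v, T (v ∘ σ) = T v) (v : Fin n → E) :
    (n.factorial : ℝ) • T v =
      ∑ S : Finset (Fin n), (-1 : ℝ) ^ (Sᶜ).card • T (fun _ => ∑ i ∈ S, v i) := by
  have h1 : ∀ S : Finset (Fin n), T (fun _ => ∑ i ∈ S, v i) =
      ∑ r : Fin n → Fin n, (if ∀ i, r i ∈ S then (1 : ℝ) else 0) • T (v ∘ r) := by
    intro S
    rw [T.map_sum_finset (fun _ i => v i) (fun _ => S)]
    simp only [ite_smul, one_smul, zero_smul]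
    rw [← Finset.sum_filter]
    refine Finset.sum_congr ?_ fun r _ => rfl
    ext r
    simp [Fintype.mem_piFinset]
  simp only [h1, Finset.smul_sum, smul_smul]
  rw [Finset.sum_comm]
  simp only [← Finset.sum_smul, sum_powerset_neg_one_pow_range_subset]
  simp only [ite_smul, one_smul, zero_smul]
  rw [← Finset.sum_filter]
  have h2 : ∀ r ∈ Finset.univ.filter (fun r : Fin n → Fin n => Function.Surjective r),
      T (v ∘ r) = T v := by
    intro r hr
    have hb := Finite.surjective_iff_bijective.1 (Finset.mem_filter.1 hr).2
    exact hT (Equiv.ofBijective r hb) v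
  rw [Finset.sum_congr rfl h2, Finset.sum_const, ← Nat.cast_smul_eq_nsmul ℝ]
  congr 2
  rw [← Fintype.card_fin n, ← Fintype.card_perm, Fintype.card_fin]
  refine Finset.card_bij (fun σ _ => (σ : Fin n → Fin n)) (by simp [Equiv.surjective])
    (fun σ _ τ _ h => DFunLike.coe_injective h) fun r hr => ?_
  have hb := Finite.surjective_iff_bijective.1 (Finset.mem_filter.1 hr).2
  exact ⟨Equiv.ofBijective r hb, Finset.mem_univ _, rfl⟩

/-- A symmetric multilinear map is controlled by its values on the diagonal. -/
lemma norm_le_of_diagonal_le {n : ℕ} (T : ContinuousMultilinearMap ℝ (fun _ : Fin n => E) F)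
    (hT : ∀ (σ : Equiv.Perm (Fin n)) v, T (v ∘ σ) = T v) {L : ℝ}
    (hL : ∀ w : E, ‖w‖ ≤ 1 → ‖T fun _ => w‖ ≤ L) : ‖T‖ ≤ 6 ^ n * L := by
  have hL0 : 0 ≤ L := (norm_nonneg _).trans (hL 0 (by simp))
  have hdiag : ∀ w : E, ‖T fun _ => w‖ ≤ L * ‖w‖ ^ n := by
    intro w
    rcases eq_or_ne w 0 with rfl | hw
    · rcases n with _ | n
      · simpa using hL 0 (by simp)
      · rw [T.map_coord_zero 0 rfl]; simp
    · have hw' : ‖w‖ ≠ 0 := norm_ne_zero_iff.2 hw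
      have := hL (‖w‖⁻¹ • w) (by rw [norm_smul, norm_inv, norm_norm, inv_mul_cancel₀ hw'])
      have e := T.map_smul_univ (fun _ => ‖w‖) (fun _ => ‖w‖⁻¹ • w)
      simp only [smul_smul, mul_inv_cancel₀ hw', one_smul, Finset.prod_const, Finset.card_univ,
        Fintype.card_fin] at e
      rw [e, norm_smul, norm_pow, norm_norm, mul_comm]
      gcongr
  have hball : ∀ v : Fin n → E, (∀ i, ‖v i‖ ≤ 1) → ‖T v‖ ≤ 6 ^ n * L := by
    intro v hv
    have h := factorial_smul_eq_sum_diagonal T.toMultilinearMap hT v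
    have hn : (0 : ℝ) < n.factorial := by exact_mod_cast n.factorial_pos
    have h2 : (n.factorial : ℝ) * ‖T v‖ ≤ ∑ S : Finset (Fin n), L * (n : ℝ) ^ n := by
      rw [← Real.norm_of_nonneg hn.le, ← norm_smul]
      refine (congrArg norm h).le.trans (norm_sum_le_of_le _ fun S _ => ?_)
      rw [norm_smul, norm_pow, norm_neg, norm_one, one_pow, one_mul]
      refine (hdiag _).trans ?_
      gcongr
      calc ‖∑ i ∈ S, v i‖ ≤ ∑ i ∈ S, (1 : ℝ) := norm_sum_le_of_le _ fun i _ => hv i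
        _ ≤ n := by
          rw [Finset.sum_const, nsmul_one]
          exact_mod_cast (Finset.card_le_univ S).trans_eq (Fintype.card_fin n)
    rw [Finset.sum_const, Finset.card_univ, Fintype.card_finset, Fintype.card_fin,
      nsmul_eq_mul] at h2
    push_cast at h2
    refine le_of_mul_le_mul_left (h2.trans ?_) hn
    have h3 := pow_self_le_three_pow_mul_factorial n
    calc (2 : ℝ) ^ n * (L * (n : ℝ) ^ n) ≤ 2 ^ n * (L * (3 ^ n * n.factorial)) := by gcongr
      _ = n.factorial * (6 ^ n * L) := by
        rw [show (6 : ℝ) = 2 * 3 by norm_num, mul_pow]; ring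
  refine T.opNorm_le_bound (by positivity) fun v => ?_
  by_cases h0 : ∃ i, v i = 0
  · obtain ⟨i, hi⟩ := h0
    rw [T.map_coord_zero i hi, norm_zero]
    positivity
  · push Not at h0
    have e := T.map_smul_univ (fun i => ‖v i‖) (fun i => ‖v i‖⁻¹ • v i)
    have e' : (fun i => ‖v i‖ • ‖v i‖⁻¹ • v i) = v := by
      funext i
      rw [smul_smul, mul_inv_cancel₀ (norm_ne_zero_iff.2 (h0 i)), one_smul]
    rw [e'] at e
    rw [e, norm_smul, Real.norm_of_nonneg (by positivity), mul_comm]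
    gcongr
    exact hball _ fun i => by
      rw [norm_smul, norm_inv, norm_norm, inv_mul_cancel₀ (norm_ne_zero_iff.2 (h0 i))]

end Polarization

section Lines

variable {E F : Type*} [NormedAddCommGroup E] [NormedSpace ℝ E] [NormedAddCommGroup F]
  [NormedSpace ℝ F]

lemma iteratedDeriv_comp_line {U : Set E} (hU : IsOpen U) {g : E → F}
    (hg : ContDiffOn ℝ (⊤ : ℕ∞) g U) (x₀ v : E) (k : ℕ) {x : ℝ} (hx : x₀ + x • v ∈ U) :
    iteratedDeriv k (fun y : ℝ => g (x₀ + y • v)) x =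
      iteratedFDeriv ℝ k g (x₀ + x • v) fun _ => v := by
  induction k generalizing x with
  | zero => simp
  | succ k ih =>
    rw [iteratedDeriv_succ]
    have hc : Continuous fun y : ℝ => x₀ + y • v := by fun_prop
    have hev : iteratedDeriv k (fun y : ℝ => g (x₀ + y • v)) =ᶠ[𝓝 x]
        fun y => iteratedFDeriv ℝ k g (x₀ + y • v) fun _ => v := by
      filter_upwards [hc.continuousAt.preimage_mem_nhds (hU.mem_nhds hx)] with y hy
      exact ih hy
    rw [hev.deriv_eq, iteratedFDeriv_succ_apply_left]
    have hd : DifferentiableAt ℝ (iteratedFDeriv ℝ k g) (x₀ + x • v) :=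
      (hg.contDiffAt (hU.mem_nhds hx)).differentiableAt_iteratedFDeriv
        (WithTop.coe_lt_coe.2 (ENat.natCast_lt_top k))
    have hl : HasDerivAt (fun y : ℝ => x₀ + y • v) v x := by
      simpa using ((hasDerivAt_id x).smul_const v).const_add x₀
    have h1 := hd.hasFDerivAt.comp_hasDerivAt x hl
    exact ((ContinuousMultilinearMap.apply ℝ (fun _ : Fin k => E) F
      (fun _ => v)).hasFDerivAt.comp_hasDerivAt x h1).deriv

/-- Restrictions to segments of functions with controlled derivatives have controlled Taylor
expansions. -/
lemma taylorBounded_comp_line {U : Set E} (hU : IsOpen U) {g : E → ℂ}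
    (hg : ContDiffOn ℝ (⊤ : ℕ∞) g U) {M : ℕ → ℝ} (hM : ∀ k, 0 < M k) {ρ R : ℝ} (hρ : 0 < ρ)
    (hR : 0 < R) {x₀ v : E} (hv : ‖v‖ ≤ 1) (hxU : ∀ x ∈ Icc (0 : ℝ) R, x₀ + x • v ∈ U)
    (hbd : ∀ x ∈ Icc (0 : ℝ) R, ∀ k, ‖iteratedFDeriv ℝ k g (x₀ + x • v)‖ ≤ ρ ^ k * M k) :
    TaylorBounded (lc M) (2 * ρ) R (fun x => g (x₀ + x • v)) := by
  set φ : ℝ → ℂ := fun x => g (x₀ + x • v) with hφ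
  have hderiv : ∀ x ∈ Icc (0 : ℝ) R, ∀ k, ‖iteratedDeriv k φ x‖ ≤ ρ ^ k * M k := by
    intro x hx k
    rw [hφ, iteratedDeriv_comp_line hU hg x₀ v k (hxU x hx)]
    refine ((iteratedFDeriv ℝ k g _).le_opNorm _).trans ?_
    rw [Finset.prod_const, Finset.card_univ, Fintype.card_fin]
    calc _ ≤ ‖iteratedFDeriv ℝ k g (x₀ + x • v)‖ * 1 := by
          gcongr
          exact pow_le_one₀ (norm_nonneg _) hv
      _ ≤ _ := by rw [mul_one]; exact hbd x hx k
  have hsm : ∀ x ∈ Icc (0 : ℝ) R, ContDiffAt ℝ (⊤ : ℕ∞) φ x := by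
    intro x hx
    exact ContDiffAt.comp x (hg.contDiffAt (hU.mem_nhds (hxU x hx)))
      (by fun_prop : ContDiffAt ℝ (⊤ : ℕ∞) (fun x : ℝ => x₀ + x • v) x)
  have hwithin : ∀ x ∈ Icc (0 : ℝ) R, ∀ k,
      iteratedDerivWithin k φ (Icc 0 R) x = iteratedDeriv k φ x := fun x hx k =>
    iteratedDerivWithin_eq_iteratedDeriv (uniqueDiffOn_Icc hR)
      ((hsm x hx).of_le (WithTop.coe_le_coe.2 le_top)) hx
  have h0 : (0 : ℝ) ∈ Icc (0 : ℝ) R := ⟨le_rfl, hR.le⟩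
  have hlc : ∀ k, 0 < lc M k := fun k => div_pos (hM k) (by positivity)
  refine ⟨fun k => ((k.factorial : ℝ)⁻¹ : ℝ) • iteratedDeriv k φ 0, fun k => ?_, fun N x hx => ?_⟩
  · rw [norm_smul, norm_inv, Real.norm_natCast]
    calc (k.factorial : ℝ)⁻¹ * ‖iteratedDeriv k φ 0‖ ≤ (k.factorial : ℝ)⁻¹ * (ρ ^ k * M k) := by
          gcongr; exact hderiv 0 h0 k
      _ = ρ ^ k * lc M k := by rw [lc]; ring
      _ ≤ (2 * ρ) ^ k * lc M k := by
          gcongr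
          · exact (hlc k).le
          · linarith
  · rcases N with _ | n
    · have := hderiv x hx 0
      simpa [lc] using this
    · have ht := taylor_mean_remainder_bound (f := φ) (n := n) (C := ρ ^ (n + 1) * M (n + 1)) hR.le
        (fun y hy => ((hsm y hy).of_le
          (WithTop.coe_le_coe.2 (le_top : (n + 1 : ℕ∞) ≤ ⊤))).contDiffWithinAt) hx
        (fun y hy => by rw [hwithin y hy]; exact hderiv y hy (n + 1))
      have he : taylorWithinEval φ n (Icc 0 R) 0 x = ∑ k ∈ Finset.range (n + 1),
          (((k.factorial : ℝ)⁻¹ : ℝ) • iteratedDeriv k φ 0) * (x : ℂ) ^ k := by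
        rw [taylor_within_apply]
        refine Finset.sum_congr rfl fun k _ => ?_
        rw [hwithin 0 h0, sub_zero, Complex.real_smul, Complex.real_smul]
        push_cast
        ring
      rw [he, sub_zero] at ht
      refine ht.trans ?_
      have hfac : ((n + 1).factorial : ℝ) = (n + 1) * n.factorial := by
        push_cast [Nat.factorial_succ]; ring
      have hn : ((n : ℝ) + 1) ≤ 2 ^ (n + 1) := by
        exact_mod_cast (Nat.lt_two_pow_self (n := n + 1)).le
      have hx0 := hx.1
      have hM' := hM (n + 1)
      have hf : (0 : ℝ) < n.factorial := by positivity
      calc ρ ^ (n + 1) * M (n + 1) * x ^ (n + 1) / n.factorial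
          = ((n : ℝ) + 1) * (ρ ^ (n + 1) * lc M (n + 1) * x ^ (n + 1)) := by
            rw [lc, hfac]; field_simp
        _ ≤ 2 ^ (n + 1) * (ρ ^ (n + 1) * lc M (n + 1) * x ^ (n + 1)) := by
            have := hlc (n + 1)
            gcongr
        _ = (2 * ρ) ^ (n + 1) * lc M (n + 1) * x ^ (n + 1) := by rw [mul_pow]; ring

lemma sum_choose_mul_pow (n i : ℕ) (hi : i ≤ n) :
    ∑ k ∈ Finset.range (n + 1), (((-1 : ℤ) ^ (n - k) * n.choose k : ℤ) : ℝ) * (k : ℝ) ^ i =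
      if i = n then (n.factorial : ℝ) else 0 := by
  have h := fwdDiff_iter_eq_sum_shift (1 : ℝ) (fun r : ℝ => r ^ i) n 0
  simp only [zero_add, nsmul_eq_mul, mul_one, zsmul_eq_mul] at h
  rw [← h]
  split_ifs with hin
  · subst hin
    rw [fwdDiff_iter_eq_factorial]
    simp
  · rw [fwdDiff_iter_pow_eq_zero_of_lt (lt_of_le_of_ne hi hin)]
    rfl

/-- Divided differences converge to the derivative. -/
lemma tendsto_fwdDiff_iter_smul {φ : ℝ → F} {n : ℕ} (hφ : ContDiff ℝ n φ) :
    Tendsto (fun s : ℝ => (s ^ n)⁻¹ • (fwdDiff s)^[n] φ 0) (𝓝[>] 0)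
      (𝓝 (iteratedDeriv n φ 0)) := by
  set T : ℝ → F := fun x => taylorWithinEval φ n univ 0 x with hT
  set c : ℕ → ℤ := fun k => (-1 : ℤ) ^ (n - k) * n.choose k with hc
  have hTs : ∀ s : ℝ, ∑ k ∈ Finset.range (n + 1), c k • T (k * s) =
      s ^ n • iteratedDeriv n φ 0 := by
    intro s
    simp only [hT, taylor_within_apply, iteratedDerivWithin_univ, sub_zero]
    simp only [← Int.cast_smul_eq_zsmul ℝ, Finset.smul_sum, smul_smul]
    rw [Finset.sum_comm]
    simp only [← Finset.sum_smul]
    rw [Finset.sum_eq_single n]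
    · congr 1
      have := sum_choose_mul_pow n n le_rfl
      rw [if_pos rfl] at this
      have hf : (n.factorial : ℝ) ≠ 0 := by positivity
      calc _ = (∑ k ∈ Finset.range (n + 1), (c k : ℝ) * (k : ℝ) ^ n) *
            ((n.factorial : ℝ)⁻¹ * s ^ n) := by
            rw [Finset.sum_mul]
            exact Finset.sum_congr rfl fun k _ => by rw [mul_pow]; ring
        _ = s ^ n := by rw [this]; field_simp
    · intro i hi hin
      have := sum_choose_mul_pow n i (Nat.lt_succ_iff.1 (Finset.mem_range.1 hi))
      rw [if_neg hin] at this
      have e : ∑ k ∈ Finset.range (n + 1), (c k : ℝ) * ((i.factorial : ℝ)⁻¹ * (k * s) ^ i) =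
          (∑ k ∈ Finset.range (n + 1), (c k : ℝ) * (k : ℝ) ^ i) *
            ((i.factorial : ℝ)⁻¹ * s ^ i) := by
        rw [Finset.sum_mul]
        exact Finset.sum_congr rfl fun k _ => by rw [mul_pow]; ring
      rw [e, this, zero_mul, zero_smul]
    · intro h; simp at h
  have hrem : Tendsto (fun s : ℝ => ∑ k ∈ Finset.range (n + 1),
      c k • ((s ^ n)⁻¹ • (φ (k * s) - T (k * s)))) (𝓝[>] 0) (𝓝 0) := by
    rw [show (0 : F) = ∑ k ∈ Finset.range (n + 1), c k • (0 : F) by simp]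
    refine tendsto_finsetSum _ fun k _ => Tendsto.const_smul ?_ _
    have ho := taylor_isLittleO_univ (x₀ := 0) hφ
    have hk : Tendsto (fun s : ℝ => (k : ℝ) * s) (𝓝[>] 0) (𝓝 0) := by
      have : Tendsto (fun s : ℝ => (k : ℝ) * s) (𝓝 0) (𝓝 ((k : ℝ) * 0)) :=
        (continuous_const_mul (k : ℝ)).tendsto 0
      rw [mul_zero] at this
      exact this.mono_left nhdsWithin_le_nhds
    have h1 := ho.comp_tendsto hk
    have h2 : (fun s : ℝ => φ (k * s) - T (k * s)) =o[𝓝[>] 0] fun s : ℝ => s ^ n := by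
      refine h1.trans_isBigO (Asymptotics.IsBigO.of_bound ((k : ℝ) ^ n) (Eventually.of_forall ?_))
      intro s
      simp [mul_pow]
    rw [tendsto_zero_iff_norm_tendsto_zero]
    have h3 := h2.norm_norm.tendsto_div_nhds_zero
    refine h3.congr fun s => ?_
    rw [norm_smul, norm_inv, div_eq_inv_mul]
  have hsum := (hrem.add_const (iteratedDeriv n φ 0))
  rw [zero_add] at hsum
  refine hsum.congr' ?_
  filter_upwards [self_mem_nhdsWithin] with s hs
  have hs' : s ^ n ≠ 0 := pow_ne_zero _ (ne_of_gt hs)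
  rw [fwdDiff_iter_eq_sum_shift]
  have e : iteratedDeriv n φ 0 =
      ∑ k ∈ Finset.range (n + 1), c k • ((s ^ n)⁻¹ • T (k * s)) := by
    have := congrArg (fun z => (s ^ n)⁻¹ • z) (hTs s)
    simp only [smul_smul, inv_mul_cancel₀ hs', one_smul] at this
    rw [← this, Finset.smul_sum]
    exact Finset.sum_congr rfl fun k _ => smul_comm _ _ _
  rw [e, ← Finset.sum_add_distrib, Finset.smul_sum]
  refine Finset.sum_congr rfl fun k _ => ?_
  rw [← smul_add, ← smul_add, sub_add_cancel, smul_comm, zero_add, nsmul_eq_mul]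

end Lines

section Mollification
open MeasureTheory
open scoped Convolution

lemma continuousOn_of_pow_of_pow_succ {X : Type*} [TopologicalSpace X] {U : Set X} {f : X → ℂ}
    {j : ℕ} (hj : 1 ≤ j) (h1 : ContinuousOn (fun x => f x ^ j) U)
    (h2 : ContinuousOn (fun x => f x ^ (j + 1)) U) : ContinuousOn f U := by
  intro x hx
  have hj0 : j ≠ 0 := by omega
  by_cases h0 : f x = 0
  · have h := (h1 x hx).tendsto.norm
    rw [h0, zero_pow hj0, norm_zero] at h
    rw [ContinuousWithinAt, h0, tendsto_zero_iff_norm_tendsto_zero]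
    have hp : Tendsto (fun y => (‖f y ^ j‖) ^ ((j : ℝ)⁻¹)) (𝓝[U] x) (𝓝 ((0 : ℝ) ^ ((j : ℝ)⁻¹))) :=
      h.rpow_const (Or.inr (by positivity))
    rw [Real.zero_rpow (by positivity)] at hp
    refine hp.congr fun y => ?_
    rw [norm_pow, Real.pow_rpow_inv_natCast (norm_nonneg _) hj0]
  · have hd := (h2 x hx).div (h1 x hx) (pow_ne_zero _ h0)
    have hne : ∀ᶠ y in 𝓝[U] x, f y ^ j ≠ 0 := (h1 x hx).eventually_ne (pow_ne_zero _ h0)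
    refine hd.congr_of_eventuallyEq ?_ ?_
    · filter_upwards [hne] with y hy
      rw [Pi.div_apply, pow_succ, mul_div_cancel_left₀ _ hy]
    · rw [Pi.div_apply, pow_succ, mul_div_cancel_left₀ _ (pow_ne_zero _ h0)]

variable {d : ℕ}

/-- Uniform bounds for all directional differences pass to mollifications. -/
lemma norm_fwdDiff_iter_convolution_le {g : EuclideanSpace ℝ (Fin d) → ℂ}
    (hg : LocallyIntegrable g) (φ : ContDiffBump (0 : EuclideanSpace ℝ (Fin d)))
    {x v : EuclideanSpace ℝ (Fin d)} {n : ℕ} {s B : ℝ} (hB : 0 ≤ B)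
    (h : ∀ z ∈ ball x φ.rOut, ‖(fwdDiff s)^[n] (fun y : ℝ => g (z + y • v)) 0‖ ≤ B) :
    ‖(fwdDiff s)^[n] (fun y : ℝ =>
      (φ.normed volume ⋆[ContinuousLinearMap.lsmul ℝ ℝ, volume] g) (x + y • v)) 0‖ ≤ B := by
  set c : ℕ → ℤ := fun k => (-1 : ℤ) ^ (n - k) * n.choose k with hc
  set G : EuclideanSpace ℝ (Fin d) → ℂ := fun z =>
    (fwdDiff s)^[n] (fun y : ℝ => g (z + y • v)) 0 with hG
  have hGe : ∀ z, G z = ∑ k ∈ Finset.range (n + 1), c k • g (z + (0 + k • s) • v) := fun z =>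
    fwdDiff_iter_eq_sum_shift s _ n 0
  have hex : ConvolutionExists (φ.normed volume) g (ContinuousLinearMap.lsmul ℝ ℝ) volume :=
    φ.hasCompactSupport_normed.convolutionExists_left _ φ.continuous_normed hg
  have hmeas : AEStronglyMeasurable G volume := by
    have : G = fun z => ∑ k ∈ Finset.range (n + 1), c k • g (z + (0 + k • s) • v) := funext hGe
    rw [this]
    refine Finset.aestronglyMeasurable_fun_sum _ fun k _ => AEStronglyMeasurable.const_smul ?_ _
    exact hg.aestronglyMeasurable.comp_quasiMeasurePreserving
      (measurePreserving_add_right volume _).quasiMeasurePreserving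
  have hconv : (fwdDiff s)^[n] (fun y : ℝ =>
      (φ.normed volume ⋆[ContinuousLinearMap.lsmul ℝ ℝ, volume] g) (x + y • v)) 0 =
      (φ.normed volume ⋆[ContinuousLinearMap.lsmul ℝ ℝ, volume] G) x := by
    rw [fwdDiff_iter_eq_sum_shift]
    simp only [convolution, ContinuousLinearMap.lsmul_apply, hGe, Finset.smul_sum]
    rw [integral_finsetSum]
    · refine Finset.sum_congr rfl fun k _ => ?_
      rw [← Int.cast_smul_eq_zsmul ℝ, ← integral_smul]
      refine integral_congr_ae (Eventually.of_forall fun t => ?_)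
      simp only [Int.cast_smul_eq_zsmul]
      rw [smul_comm, add_sub_right_comm]
    · intro k _
      have := (hex (x + (0 + k • s) • v)).smul (c k : ℝ)
      refine this.congr (Eventually.of_forall fun t => ?_)
      simp only [Pi.smul_apply, Int.cast_smul_eq_zsmul, ContinuousLinearMap.lsmul_apply]
      rw [smul_comm, add_sub_right_comm]
  rw [hconv, ← dist_zero_right]
  refine dist_convolution_le hB (by rw [φ.support_normed_eq]) φ.nonneg_normed
    (φ.integral_normed) hmeas fun z hz => ?_
  rw [dist_zero_right]
  exact h z hz

/-- A continuous function whose iterated differences along lines are controlled is smooth, with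
control on its derivatives. -/
lemma contDiffOn_ball_of_fwdDiff_le {f : EuclideanSpace ℝ (Fin d) → ℂ}
    {x₀ : EuclideanSpace ℝ (Fin d)} {r T : ℝ} (hr : 0 < r) (hT : 0 < T)
    (hf : ContinuousOn f (closedBall x₀ (3 * r))) {L : ℕ → ℝ}
    (hd : ∀ z ∈ ball x₀ (2 * r), ∀ v, ‖v‖ ≤ 1 → ∀ (n : ℕ) (s : ℝ), 0 < s → n * s ≤ T →
      ‖(fwdDiff s)^[n] (fun y : ℝ => f (z + y • v)) 0‖ ≤ L n * s ^ n) :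
    ContDiffOn ℝ (⊤ : ℕ∞) f (ball x₀ r) ∧
      ∀ n, ∀ x ∈ ball x₀ r, ‖iteratedFDeriv ℝ n f x‖ ≤ 6 ^ n * L n := by
  have hL : ∀ n, 0 ≤ L n := by
    intro n
    have hs : 0 < T / (n + 1) := by positivity
    have h := hd x₀ (mem_ball_self (by positivity)) 0 (by simp) n (T / (n + 1)) hs (by
      rw [mul_div_assoc', div_le_iff₀ (by positivity)]
      nlinarith)
    exact nonneg_of_mul_nonneg_left ((norm_nonneg _).trans h) (by positivity)
  set g : EuclideanSpace ℝ (Fin d) → ℂ := (closedBall x₀ (3 * r)).indicator f with hg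
  have hgi : LocallyIntegrable g volume :=
    ((hf.integrableOn_compact (isCompact_closedBall _ _)).integrable_indicator
      measurableSet_closedBall).locallyIntegrable
  have hgf : ∀ z ∈ closedBall x₀ (3 * r), g z = f z := fun z hz => indicator_of_mem hz f
  let φ : ℕ → ContDiffBump (0 : EuclideanSpace ℝ (Fin d)) := fun i =>
    { rIn := r / (2 * (i + 2))
      rOut := r / (i + 2)
      rIn_pos := by positivity
      rIn_lt_rOut := div_lt_div_of_pos_left hr (by positivity) (by
        have : (0 : ℝ) < i + 2 := by positivity
        linarith) }
  have hout : ∀ i, (φ i).rOut < r := fun i => div_lt_self hr (by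
    have : (0 : ℝ) ≤ i := by positivity
    linarith)
  have hout0 : Tendsto (fun i => (φ i).rOut) atTop (𝓝 0) :=
    tendsto_const_nhds.div_atTop
      (tendsto_atTop_add_const_right _ _ tendsto_natCast_atTop_atTop)
  refine contDiffOn_of_tendsto_of_iteratedFDeriv_le (F := ℂ) isOpen_ball (convex_ball x₀ r)
    (h := fun i => (φ i).normed volume ⋆[ContinuousLinearMap.lsmul ℝ ℝ, volume] g)
    (L := fun n => 6 ^ n * L n) (fun i => ?_) (fun i n x hx => ?_) (fun x hx => ?_)
  · exact (φ i).hasCompactSupport_normed.contDiff_convolution_left _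
      ((φ i).contDiff_normed (n := (⊤ : ℕ∞))) hgi
  · have hsm : ContDiff ℝ (⊤ : ℕ∞)
        ((φ i).normed volume ⋆[ContinuousLinearMap.lsmul ℝ ℝ, volume] g) :=
      (φ i).hasCompactSupport_normed.contDiff_convolution_left _
        ((φ i).contDiff_normed (n := (⊤ : ℕ∞))) hgi
    refine norm_le_of_diagonal_le _
      (fun σ v => iteratedFDeriv_comp_perm_of_smooth hsm n x σ v) fun v hv => ?_
    have hline := iteratedDeriv_comp_line isOpen_univ hsm.contDiffOn x v n (x := 0) (mem_univ _)
    rw [zero_smul, add_zero] at hline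
    rw [← hline]
    have hlsm : ContDiff ℝ n (fun y : ℝ =>
        ((φ i).normed volume ⋆[ContinuousLinearMap.lsmul ℝ ℝ, volume] g) (x + y • v)) :=
      (hsm.of_le (WithTop.coe_le_coe.2 le_top)).comp (by fun_prop)
    refine le_of_tendsto (tendsto_fwdDiff_iter_smul hlsm).norm ?_
    have hmem : Ioo (0 : ℝ) (min T r / (n + 1)) ∈ 𝓝[>] (0 : ℝ) :=
      Ioo_mem_nhdsGT (by positivity)
    filter_upwards [hmem] with s hs
    have hns : (n : ℝ) * s ≤ min T r := by
      have := (lt_div_iff₀ (by positivity : (0 : ℝ) < n + 1)).1 hs.2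
      nlinarith [hs.1]
    have hsn : 0 < s ^ n := pow_pos hs.1 n
    rw [norm_smul, norm_inv, Real.norm_of_nonneg hsn.le, inv_mul_le_iff₀ hsn, mul_comm]
    refine norm_fwdDiff_iter_convolution_le hgi (φ i) (mul_nonneg (hL n) hsn.le) fun z hz => ?_
    have hz2 : z ∈ ball x₀ (2 * r) := by
      rw [mem_ball] at hz hx ⊢
      linarith [dist_triangle z x x₀, hout i]
    have heq : (fwdDiff s)^[n] (fun y : ℝ => g (z + y • v)) 0 =
        (fwdDiff s)^[n] (fun y : ℝ => f (z + y • v)) 0 := by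
      rw [fwdDiff_iter_eq_sum_shift, fwdDiff_iter_eq_sum_shift]
      refine Finset.sum_congr rfl fun k hk => ?_
      rw [hgf]
      have hkn : (k : ℝ) ≤ n := by exact_mod_cast Nat.lt_succ_iff.1 (Finset.mem_range.1 hk)
      rw [zero_add, nsmul_eq_mul, mem_closedBall]
      have h1 : dist (z + ((k : ℝ) * s) • v) z ≤ r := by
        rw [dist_eq_norm, add_sub_cancel_left, norm_smul, Real.norm_of_nonneg
          (mul_nonneg k.cast_nonneg hs.1.le)]
        calc (k : ℝ) * s * ‖v‖ ≤ n * s * 1 := by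
              have := hs.1.le
              gcongr
          _ ≤ r := by rw [mul_one]; exact hns.trans (min_le_right _ _)
      rw [mem_ball] at hz2
      linarith [dist_triangle (z + ((k : ℝ) * s) • v) z x₀]
    rw [heq]
    exact hd z hz2 v hv n s hs.1 (hns.trans (min_le_left _ _))
  · have hx3 : closedBall x₀ (3 * r) ∈ 𝓝 x :=
      mem_of_superset (isOpen_ball.mem_nhds hx) (ball_subset_closedBall.trans
        (closedBall_subset_closedBall (by linarith)))
    have hgx : ContinuousAt g x := (hf.continuousAt hx3).congr
      (mem_of_superset hx3 fun z hz => (hgf z hz).symm)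
    rw [← hgf x (mem_of_mem_nhds hx3)]
    exact ContDiffBump.convolution_tendsto_right hout0
      (Eventually.of_forall fun _ => hgi.aestronglyMeasurable)
      (hgx.tendsto.comp tendsto_snd) tendsto_const_nhds

end Mollification

section Assembly

lemma IsWeightMatrix.exists_le_le {W : Set (ℕ → ℝ)} (hW : IsWeightMatrix W) {M N : ℕ → ℝ}
    (hM : M ∈ W) (hN : N ∈ W) : ∃ Q ∈ W, (∀ k, M k ≤ Q k) ∧ ∀ k, N k ≤ Q k := by
  rcases hW.ordered M hM N hN with h | h
  · exact ⟨N, hN, h, fun _ => le_rfl⟩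
  · exact ⟨M, hM, fun _ => le_rfl, h⟩

lemma SeqBoundedOn.exists_pos_bound {E F : Type*} [NormedAddCommGroup E] [NormedSpace ℝ E]
    [NormedAddCommGroup F] [NormedSpace ℝ F] {M N : ℕ → ℝ} {ρ σ : ℝ} {f : E → F} {U K : Set E}
    (h : SeqBoundedOn M ρ f U K) (hρ : 0 < ρ) (hσ : ρ ≤ σ) (hM : ∀ k, 0 < M k)
    (hMN : ∀ k, M k ≤ N k) :
    ∃ C : ℝ, 1 ≤ C ∧ ∀ x ∈ K, ∀ k : ℕ, ‖iteratedFDerivWithin ℝ k f U x‖ ≤ C * σ ^ k * N k := by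
  obtain ⟨C, hC⟩ := h
  refine ⟨max C 1, le_max_right _ _, fun x hx k => (hC x hx k).trans ?_⟩
  have := hM k
  have := hMN k
  calc C * ρ ^ k * M k ≤ max C 1 * ρ ^ k * M k := by gcongr; exact le_max_left _ _
    _ ≤ max C 1 * σ ^ k * N k := by
      have := hρ.trans_le hσ
      gcongr

lemma SeqBoundedOn.union {E F : Type*} [NormedAddCommGroup E] [NormedSpace ℝ E]
    [NormedAddCommGroup F] [NormedSpace ℝ F] {W : Set (ℕ → ℝ)} (hW : IsWeightMatrix W)
    {f : E → F} {U s t : Set E} (hs : ∃ M ∈ W, ∃ ρ : ℝ, 0 < ρ ∧ SeqBoundedOn M ρ f U s)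
    (ht : ∃ M ∈ W, ∃ ρ : ℝ, 0 < ρ ∧ SeqBoundedOn M ρ f U t) :
    ∃ M ∈ W, ∃ ρ : ℝ, 0 < ρ ∧ SeqBoundedOn M ρ f U (s ∪ t) := by
  obtain ⟨M, hM, ρ, hρ, h1⟩ := hs
  obtain ⟨N, hN, σ, hσ, h2⟩ := ht
  obtain ⟨Q, hQ, hMQ, hNQ⟩ := hW.exists_le_le hM hN
  obtain ⟨A, hA, h1⟩ := h1.exists_pos_bound hρ (le_max_left ρ σ) (hW.weight M hM).pos hMQ
  obtain ⟨B, hB, h2⟩ := h2.exists_pos_bound hσ (le_max_right ρ σ) (hW.weight N hN).pos hNQ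
  have hmax : 0 < max ρ σ := lt_max_of_lt_left hρ
  refine ⟨Q, hQ, max ρ σ, hmax, max A B, fun x hx k => ?_⟩
  have hQk := (hW.weight Q hQ).pos k
  rcases hx with hx | hx
  · refine (h1 x hx k).trans ?_
    gcongr
    exact le_max_left _ _
  · refine (h2 x hx k).trans ?_
    gcongr
    exact le_max_right _ _

variable {d : ℕ}

lemma taylorBounded_pow_of_iteratedFDeriv_le {U : Set (EuclideanSpace ℝ (Fin d))} (hU : IsOpen U)
    {f : EuclideanSpace ℝ (Fin d) → ℂ} {i : ℕ} (hi : 1 ≤ i)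
    (hg : ContDiffOn ℝ (⊤ : ℕ∞) (fun x => f x ^ i) U) {M : ℕ → ℝ} (hM : ∀ k, 0 < M k)
    {ρ R A l : ℝ} (hρ : 0 < ρ) (hR : 0 < R) (hl : 1 ≤ l) (hAl : A ≤ l)
    {z v : EuclideanSpace ℝ (Fin d)} (hv : ‖v‖ ≤ 1) (hzU : ∀ x ∈ Icc (0 : ℝ) R, z + x • v ∈ U)
    (hbd : ∀ x ∈ Icc (0 : ℝ) R, ∀ k,
      ‖iteratedFDerivWithin ℝ k (fun x => f x ^ i) U (z + x • v)‖ ≤ A * ρ ^ k * M k) :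
    TaylorBounded (lc M) (2 * ρ) R (fun x => (l⁻¹ • f (z + x • v)) ^ i) := by
  have hl0 : 0 < l := by linarith
  have hsm : ContDiffOn ℝ (⊤ : ℕ∞) (fun y => (l⁻¹ ^ i) • f y ^ i) U := hg.const_smul _
  have h := taylorBounded_comp_line hU hsm hM hρ hR hv hzU fun x hx k => by
    have hc : ContDiffAt ℝ k (fun y => f y ^ i) (z + x • v) :=
      (hg.contDiffAt (hU.mem_nhds (hzU x hx))).of_le (WithTop.coe_le_coe.2 le_top)
    have e := iteratedFDeriv_const_smul_apply' (a := l⁻¹ ^ i) hc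
    rw [e, norm_smul, ← iteratedFDerivWithin_of_isOpen k hU (hzU x hx)]
    have hMk := hM k
    have hli : l ≤ l ^ i := le_self_pow₀ hl (by omega)
    rw [Real.norm_of_nonneg (by positivity), inv_pow, inv_mul_le_iff₀ (by positivity)]
    refine (hbd x hx k).trans ?_
    rw [mul_assoc]
    gcongr
    exact hAl.trans hli
  have e : (fun x : ℝ => (l⁻¹ • f (z + x • v)) ^ i) =
      fun x : ℝ => (l⁻¹ ^ i) • f (z + x • v) ^ i := by
    funext x
    rw [smul_pow]
  rw [e]
  exact h

lemma exists_ball_contDiffOn_and_bound {W : Set (ℕ → ℝ)} (hW : RAdmissible W)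
    {U : Set (EuclideanSpace ℝ (Fin d))} (hU : IsOpen U) {j : ℕ} (hj : 1 ≤ j)
    {f : EuclideanSpace ℝ (Fin d) → ℂ} (h1 : Roumieu W U (fun x => f x ^ j))
    (h2 : Roumieu W U (fun x => f x ^ (j + 1))) {x₀ : EuclideanSpace ℝ (Fin d)} (hx₀ : x₀ ∈ U) :
    ∃ r > 0, ContDiffOn ℝ (⊤ : ℕ∞) f (ball x₀ r) ∧
      ∃ M ∈ W, ∃ ρ : ℝ, 0 < ρ ∧ SeqBoundedOn M ρ f U (ball x₀ r ∩ U) := by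
  obtain ⟨ε, hε, hεU⟩ := Metric.isOpen_iff.1 hU x₀ hx₀
  set r := ε / 4 with hr
  have hr0 : 0 < r := by positivity
  have hKU : closedBall x₀ (3 * r) ⊆ U :=
    (closedBall_subset_ball (by rw [hr]; linarith)).trans hεU
  obtain ⟨M₁, hM₁, ρ₁, hρ₁, hb₁⟩ := h1.2 _ hKU (isCompact_closedBall _ _)
  obtain ⟨M₂, hM₂, ρ₂, hρ₂, hb₂⟩ := h2.2 _ hKU (isCompact_closedBall _ _)
  obtain ⟨M, hM, hM₁M, hM₂M⟩ := hW.matrix.exists_le_le hM₁ hM₂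
  obtain ⟨A, hA, hb₁⟩ := hb₁.exists_pos_bound hρ₁ (le_max_left ρ₁ ρ₂)
    (hW.matrix.weight M₁ hM₁).pos hM₁M
  obtain ⟨B, hB, hb₂⟩ := hb₂.exists_pos_bound hρ₂ (le_max_right ρ₁ ρ₂)
    (hW.matrix.weight M₂ hM₂).pos hM₂M
  have hρ : 0 < max ρ₁ ρ₂ := lt_max_of_lt_left hρ₁
  obtain ⟨Q, hQ, C, F, T, hC, hF, hT, hmain⟩ :=
    exists_fwdDiff_bound hW hM hj (mul_pos two_pos hρ) hr0
  set l := max A B with hl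
  have hl1 : 1 ≤ l := hA.trans (le_max_left _ _)
  have hl0 : 0 < l := by linarith
  have hcont : ContinuousOn f (closedBall x₀ (3 * r)) :=
    (continuousOn_of_pow_of_pow_succ hj h1.1.continuousOn h2.1.continuousOn).mono hKU
  have hdiff : ∀ z ∈ ball x₀ (2 * r), ∀ v, ‖v‖ ≤ 1 → ∀ (n : ℕ) (s : ℝ), 0 < s → n * s ≤ T →
      ‖(fwdDiff s)^[n] (fun y : ℝ => f (z + y • v)) 0‖ ≤ l * (C * F ^ n * Q n) * s ^ n := by
    intro z hz v hv n s hs hns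
    have hzK : ∀ x ∈ Icc (0 : ℝ) r, z + x • v ∈ closedBall x₀ (3 * r) := by
      intro x hx
      have h1 : dist (z + x • v) z ≤ r := by
        rw [dist_eq_norm, add_sub_cancel_left, norm_smul, Real.norm_of_nonneg hx.1]
        calc x * ‖v‖ ≤ r * 1 := by
              gcongr
              exact hx.2
          _ = r := mul_one r
      rw [mem_ball] at hz
      rw [mem_closedBall]
      linarith [dist_triangle (z + x • v) z x₀]
    have hzU : ∀ x ∈ Icc (0 : ℝ) r, z + x • v ∈ U := fun x hx => hKU (hzK x hx)
    have hMp := (hW.matrix.weight M hM).pos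
    have hu := hmain (fun y => l⁻¹ • f (z + y • v))
      (taylorBounded_pow_of_iteratedFDeriv_le hU hj h1.1 hMp hρ hr0 hl1 (le_max_left _ _) hv hzU
        fun x hx => hb₁ _ (hzK x hx))
      (taylorBounded_pow_of_iteratedFDeriv_le hU (by omega) h2.1 hMp hρ hr0 hl1
        (le_max_right _ _) hv hzU fun x hx => hb₂ _ (hzK x hx)) n s hs hns
    have e : (fun y : ℝ => l⁻¹ • f (z + y • v)) = l⁻¹ • fun y : ℝ => f (z + y • v) := rfl
    rw [e, fwdDiff_iter_const_smul, Pi.smul_apply, norm_smul,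
      Real.norm_of_nonneg (by positivity), inv_mul_le_iff₀ hl0] at hu
    exact hu.trans_eq (by ring)
  obtain ⟨hsm, hbd⟩ := contDiffOn_ball_of_fwdDiff_le hr0 hT hcont hdiff
  refine ⟨r, hr0, hsm, Q, hQ, 6 * F, by positivity, l * C, fun x hx k => ?_⟩
  rw [iteratedFDerivWithin_of_isOpen k hU hx.2]
  refine (hbd k x hx.1).trans_eq ?_
  rw [mul_pow]
  ring

end Assembly

/-- Joris' theorem for Roumieu classes given by an R-admissible weight matrix. -/
theorem statement0 {d : ℕ} (W : Set (ℕ → ℝ)) (hW : RAdmissible W)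
    (U : Set (EuclideanSpace ℝ (Fin d))) (hU : IsOpen U)
    (j : ℕ) (hj : 1 ≤ j) (f : EuclideanSpace ℝ (Fin d) → ℂ)
    (h1 : Roumieu W U (fun x => f x ^ j))
    (h2 : Roumieu W U (fun x => f x ^ (j + 1))) :
    Roumieu W U f := by
  refine ⟨fun x hx => ?_, fun K hKU hK => ?_⟩
  · obtain ⟨r, hr, hsm, -⟩ := exists_ball_contDiffOn_and_bound hW hU hj h1 h2 hx
    exact (hsm.contDiffAt (ball_mem_nhds x hr)).contDiffWithinAt
  · refine hK.induction_on (p := fun s => ∃ M ∈ W, ∃ ρ : ℝ, 0 < ρ ∧ SeqBoundedOn M ρ f U s)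
      ?_ ?_ (fun s t hs ht => SeqBoundedOn.union hW.matrix hs ht) fun x hx => ?_
    · obtain ⟨M, hM, -⟩ := h1.2 ∅ (empty_subset _) isCompact_empty
      exact ⟨M, hM, 1, one_pos, 0, fun x hx => hx.elim⟩
    · rintro s t hst ⟨M, hM, ρ, hρ, C, hC⟩
      exact ⟨M, hM, ρ, hρ, C, fun x hx => hC x (hst hx)⟩
    · obtain ⟨r, hr, -, hb⟩ := exists_ball_contDiffOn_and_bound hW hU hj h1 h2 (hKU hx)
      exact ⟨ball x r ∩ U, mem_nhdsWithin_of_mem_nhds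
        (inter_mem (ball_mem_nhds x hr) (hU.mem_nhds (hKU hx))), hb⟩

end JorisPaper
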